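/- arXiv:cs/0111062 — 5 statements merged into one kernel-verified Lean document; each statement's English description precedes it below -/
import Mathlib

section
/- There is a constant C such that for every n ≥ 1 there exists a fair probabilistic formula F over the 2n² input variables of the matrix product function MP_n and at most Cn² random variables, of size at most Cn², with the following properties: on every input (T⁽¹⁾,T⁽²⁾) with T⁽¹⁾·T⁽²⁾ = 0, F outputs 0 with probability 1; and on every input with T⁽¹⁾·T⁽²⁾ ≠ 0, F outputs 1 with probability at least 1/2. (That is, MP_n has a fair Monte Carlo formula of size O(n²).) -/
open scoped ENNReal

/-- A Boolean formula over variables `V`. -/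
inductive BFormula (V : Type) : Type
  | var : V → BFormula V
  | const : Bool → BFormula V
  | node : (Bool → Bool → Bool) → BFormula V → BFormula V → BFormula V

namespace BFormula

/-- Evaluation of a formula on an assignment. -/
def eval {V : Type} (x : V → Bool) : BFormula V → Bool
  | var v => x v
  | const b => b
  | node g l r => g (eval x l) (eval x r)

/-- Number of leaves labeled by variables. -/
def size {V : Type} : BFormula V → ℕ
  | var _ => 1
  | const _ => 0
  | node _ l r => size l + size r

end BFormula

/-- Variables of the matrix product function: the entries of the two `n×n`
matrices over GF(2). -/
abbrev MPVar (n : ℕ) : Type := (Fin n × Fin n) ⊕ (Fin n × Fin n)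

/-- The matrix product function `MP_n` (as a predicate on assignments): the product
of the two encoded `n×n` matrices over GF(2) is not the all-zero matrix. -/
def MPholds (n : ℕ) (x : MPVar n → Bool) : Prop :=
  (Matrix.of fun i j : Fin n => if x (Sum.inl (i, j)) then (1 : ZMod 2) else 0) *
    (Matrix.of fun i j : Fin n => if x (Sum.inr (i, j)) then (1 : ZMod 2) else 0) ≠ 0

/-- The element of `GF(2)` encoded by a bit. -/
def bitVal (b : Bool) : ZMod 2 := if b then 1 else 0

lemma bitVal_xor (a b : Bool) : bitVal (a ^^ b) = bitVal a + bitVal b := by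
  revert a b; decide

lemma bitVal_and (a b : Bool) : bitVal (a && b) = bitVal a * bitVal b := by
  revert a b; decide

lemma bitVal_not (a : Bool) : bitVal (!a) = bitVal a + 1 := by
  revert a; decide

lemma bitVal_eq_zero_iff (a : Bool) : bitVal a = 0 ↔ a = false := by
  revert a; decide

namespace BFormula

/-- The parity of a finite family of formulas. -/
def bigXor {V : Type} : (k : ℕ) → (Fin k → BFormula V) → BFormula V
  | 0, _ => const false
  | k + 1, f => node Bool.xor (f 0) (bigXor k fun i => f i.succ)

lemma size_bigXor {V : Type} (k : ℕ) (f : Fin k → BFormula V) :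
    (bigXor k f).size = ∑ i, (f i).size := by
  induction k with
  | zero => rfl
  | succ k ih => simp [bigXor, size, ih, Fin.sum_univ_succ]

lemma bitVal_eval_bigXor {V : Type} (x : V → Bool) (k : ℕ) (f : Fin k → BFormula V) :
    bitVal ((bigXor k f).eval x) = ∑ i, bitVal ((f i).eval x) := by
  induction k with
  | zero => rfl
  | succ k ih => simp [bigXor, eval, ih, Fin.sum_univ_succ, bitVal_xor]

/-- The formula computing `uᵀ T⁽¹⁾ T⁽²⁾ v`, where the bits of `u` and `v` are the random variables
`e (inl i)` and `e (inr i)`. -/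
def bilinear {R : Type} (n : ℕ) (e : Fin n ⊕ Fin n → R) : BFormula (MPVar n ⊕ R) :=
  bigXor n fun j => node Bool.and
    (bigXor n fun i => node Bool.and (var (.inr (e (.inl i)))) (var (.inl (.inl (i, j)))))
    (bigXor n fun k => node Bool.and (var (.inl (.inr (j, k)))) (var (.inr (e (.inr k)))))

lemma size_bilinear {R : Type} (n : ℕ) (e : Fin n ⊕ Fin n → R) :
    (bilinear n e).size = 4 * n ^ 2 := by
  simp [bilinear, size, size_bigXor]
  ring

lemma bitVal_eval_bilinear {R : Type} (n : ℕ) (e : Fin n ⊕ Fin n → R) (x : MPVar n → Bool)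
    (r : R → Bool) :
    bitVal ((bilinear n e).eval (Sum.elim x r)) =
      ∑ i, ∑ k, bitVal (r (e (.inl i))) *
        ((Matrix.of fun i j : Fin n => if x (Sum.inl (i, j)) then (1 : ZMod 2) else 0) *
          (Matrix.of fun i j : Fin n => if x (Sum.inr (i, j)) then (1 : ZMod 2) else 0)) i k *
        bitVal (r (e (.inr k))) := by
  simp only [bilinear, bitVal_eval_bigXor, eval, bitVal_and, Sum.elim_inl, Sum.elim_inr,
    Matrix.mul_apply, Matrix.of_apply, Finset.mul_sum, Finset.sum_mul]
  rw [Finset.sum_comm]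
  conv_rhs => rw [Finset.sum_comm]
  refine Finset.sum_congr rfl fun k _ => ?_
  rw [Finset.sum_comm]
  refine Finset.sum_congr rfl fun i _ => Finset.sum_congr rfl fun j _ => ?_
  simp only [bitVal]
  ring

end BFormula

section Counting

/-- Flipping one bit of an assignment. -/
def flipBit {α : Type} [DecidableEq α] (a : α) (r : α → Bool) : α → Bool := Function.update r a (!r a)

lemma flipBit_involutive {α : Type} [DecidableEq α] (a : α) : Function.Involutive (flipBit a) := by
  intro r
  simp [flipBit]

lemma bitVal_flipBit {α : Type} [DecidableEq α] (a b : α) (r : α → Bool) :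
    bitVal (flipBit a r b) = bitVal (r b) + if b = a then 1 else 0 := by
  by_cases h : b = a
  · subst h
    simp [flipBit, bitVal_not]
  · simp [flipBit, h]

/-- The value of the bilinear form of `M` on a pair of bit vectors. -/
def bilinVal {α β : Type} [Fintype α] [Fintype β] (M : Matrix α β (ZMod 2)) (r : α ⊕ β → Bool) : ZMod 2 :=
  ∑ i, ∑ k, bitVal (r (.inl i)) * M i k * bitVal (r (.inr k))

variable {α β : Type} [Fintype α] [Fintype β] [DecidableEq α] [DecidableEq β]

lemma bilinVal_flip_inl (M : Matrix α β (ZMod 2)) (i : α) (r : α ⊕ β → Bool) :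
    bilinVal M (flipBit (.inl i) r) = bilinVal M r + ∑ k, M i k * bitVal (r (.inr k)) := by
  simp [bilinVal, bitVal_flipBit, add_mul, Finset.sum_add_distrib, ite_mul,
    Finset.sum_ite_irrel]

/-- The values of the form on the four translates of a point sum to an entry of the matrix. -/
lemma bilinVal_flip_sum (M : Matrix α β (ZMod 2)) (i : α) (k : β) (r : α ⊕ β → Bool) :
    bilinVal M r + bilinVal M (flipBit (.inl i) r) + bilinVal M (flipBit (.inr k) r) +
      bilinVal M (flipBit (.inl i) (flipBit (.inr k) r)) = M i k := by
  rw [bilinVal_flip_inl, bilinVal_flip_inl]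
  simp only [bitVal_flipBit, Sum.inr.injEq, mul_add, Finset.sum_add_distrib, mul_ite, mul_one,
    mul_zero, Finset.sum_ite_eq', Finset.mem_univ, if_true]
  have h : (2 : ZMod 2) = 0 := rfl
  linear_combination (bilinVal M r + bilinVal M (flipBit (.inr k) r) +
    ∑ k, M i k * bitVal (r (.inr k))) * h

lemma card_le_four_mul_bilinVal_ne_zero {M : Matrix α β (ZMod 2)} (hM : M ≠ 0) :
    Fintype.card (α ⊕ β → Bool) ≤
      4 * (Finset.univ.filter fun r : α ⊕ β → Bool => bilinVal M r ≠ 0).card := by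
  obtain ⟨i, k, hik⟩ : ∃ i k, M i k ≠ 0 := by
    by_contra! h
    exact hM (Matrix.ext h)
  set G := Finset.univ.filter fun r : α ⊕ β → Bool => bilinVal M r ≠ 0 with hG
  let f := flipBit (Sum.inl i : α ⊕ β)
  let g := flipBit (Sum.inr k : α ⊕ β)
  have hf : Function.Involutive f := flipBit_involutive _
  have hg : Function.Involutive g := flipBit_involutive _
  have hcover : (Finset.univ : Finset (α ⊕ β → Bool)) ⊆
      ((G ∪ G.image f) ∪ G.image g) ∪ G.image (g ∘ f) := by
    intro r _
    by_contra hr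
    simp only [Finset.mem_union, Finset.mem_image, not_or, not_exists, not_and] at hr
    obtain ⟨⟨⟨h1, h2⟩, h3⟩, h4⟩ := hr
    have h1' : bilinVal M r = 0 := by simpa [hG] using h1
    have h2' : bilinVal M (f r) = 0 := by
      by_contra h
      exact h2 (f r) (by simpa [hG] using h) (hf r)
    have h3' : bilinVal M (g r) = 0 := by
      by_contra h
      exact h3 (g r) (by simpa [hG] using h) (hg r)
    have h4' : bilinVal M (f (g r)) = 0 := by
      by_contra h
      exact h4 (f (g r)) (by simpa [hG] using h) (by simp [hf (g r), hg r])
    apply hik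
    rw [← bilinVal_flip_sum M i k r]
    change bilinVal M r + bilinVal M (f r) + bilinVal M (g r) + bilinVal M (f (g r)) = 0
    simp [h1', h2', h3', h4']
  have hcard := Finset.card_le_card hcover
  rw [Finset.card_univ] at hcard
  have u1 := Finset.card_union_le ((G ∪ G.image f) ∪ G.image g) (G.image (g ∘ f))
  have u2 := Finset.card_union_le (G ∪ G.image f) (G.image g)
  have u3 := Finset.card_union_le G (G.image f)
  have i1 := Finset.card_image_le (s := G) (f := f)
  have i2 := Finset.card_image_le (s := G) (f := g)
  have i3 := Finset.card_image_le (s := G) (f := g ∘ f)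
  omega

/-- Three independent samples all miss a set of density at least `1/4` with probability at most
`27/64 ≤ 1/2`. -/
lemma two_mul_card_pi_three_le {S : Type} [Fintype S] [DecidableEq S] (P : S → Prop)
    [DecidablePred P] (hP : Fintype.card S ≤ 4 * (Finset.univ.filter P).card) :
    2 * (Finset.univ.filter fun s : Fin 3 → S => ∀ t, ¬ P (s t)).card ≤ Fintype.card S ^ 3 := by
  have hpi : (Finset.univ.filter fun s : Fin 3 → S => ∀ t, ¬ P (s t)) =
      Fintype.piFinset fun _ => Finset.univ.filter fun a => ¬ P a := by
    ext s
    simp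
  rw [hpi, Fintype.card_piFinset_const]
  have hsum := Finset.card_filter_add_card_filter_not (s := (Finset.univ : Finset S)) P
  rw [Finset.card_univ] at hsum
  set b := (Finset.univ.filter fun a => ¬ P a).card
  have hb : 4 * b ≤ 3 * Fintype.card S := by omega
  have := Nat.pow_le_pow_left hb 3
  rw [mul_pow, mul_pow] at this
  omega

end Counting

/-- `MP_n` has a fair Monte Carlo formula of size `O(n²)` using `O(n²)` random
variables: it never accepts when the matrix product is zero, and accepts with
probability at least 1/2 (over uniformly random settings of the random variables)
when the product is nonzero. -/
theorem stmt5 :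
    ∃ C : ℕ, 0 < C ∧
      ∀ n : ℕ, 1 ≤ n →
        ∃ m : ℕ, m ≤ C * n ^ 2 ∧
          ∃ F : BFormula (MPVar n ⊕ Fin m),
            F.size ≤ C * n ^ 2 ∧
            (∀ x : MPVar n → Bool, ¬ MPholds n x →
              ∀ r : Fin m → Bool, F.eval (Sum.elim x r) = false) ∧
            (∀ x : MPVar n → Bool, MPholds n x →
              2 ^ m ≤ 2 * (Finset.univ.filter
                (fun r : Fin m → Bool => F.eval (Sum.elim x r) = true)).card) := by
  refine ⟨12, by norm_num, fun n hn => ?_⟩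
  let e : Fin 3 × (Fin n ⊕ Fin n) ≃ Fin (3 * (n + n)) :=
    Fintype.equivFinOfCardEq (by simp)
  let Q (t : Fin 3) : BFormula (MPVar n ⊕ Fin (3 * (n + n))) :=
    BFormula.bilinear n fun a => e (t, a)
  let F : BFormula (MPVar n ⊕ Fin (3 * (n + n))) :=
    .node Bool.or (Q 0) (.node Bool.or (Q 1) (Q 2))
  have hF : ∀ x r, F.eval (Sum.elim x r) = false ↔
      ∀ t, (Q t).eval (Sum.elim x r) = false := by
    intro x r
    simp [F, BFormula.eval, Fin.forall_fin_succ]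
  let M (x : MPVar n → Bool) : Matrix (Fin n) (Fin n) (ZMod 2) :=
    (Matrix.of fun i j : Fin n => if x (Sum.inl (i, j)) then (1 : ZMod 2) else 0) *
      (Matrix.of fun i j : Fin n => if x (Sum.inr (i, j)) then (1 : ZMod 2) else 0)
  have hQ : ∀ x r t, (Q t).eval (Sum.elim x r) = false ↔
      bilinVal (M x) (fun a => r (e (t, a))) = 0 := by
    intro x r t
    rw [← bitVal_eq_zero_iff, BFormula.bitVal_eval_bilinear]
    rfl
  refine ⟨3 * (n + n), by nlinarith, F, ?_, ?_, ?_⟩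
  · simp only [F, Q, BFormula.size, BFormula.size_bilinear]
    omega
  · intro x hx r
    have hM : M x = 0 := not_not.mp hx
    rw [hF]
    intro t
    rw [hQ, hM]
    simp [bilinVal]
  · intro x hx
    have hcount := two_mul_card_pi_three_le _ (card_le_four_mul_bilinVal_ne_zero (M := M x) hx)
    let E : (Fin (3 * (n + n)) → Bool) ≃ (Fin 3 → Fin n ⊕ Fin n → Bool) :=
      (e.symm.arrowCongr (Equiv.refl Bool)).trans (Equiv.curry _ _ _)
    have hbad : (Finset.univ.filter fun r => ¬ F.eval (Sum.elim x r) = true).card =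
        (Finset.univ.filter fun s : Fin 3 → Fin n ⊕ Fin n → Bool =>
          ∀ t, ¬ bilinVal (M x) (s t) ≠ 0).card := by
      refine Finset.card_equiv E fun r => ?_
      simp only [Finset.mem_filter, Finset.mem_univ, true_and, Bool.not_eq_true, not_not, hF, hQ]
      rfl
    have hsum := Finset.card_filter_add_card_filter_not
      (s := (Finset.univ : Finset (Fin (3 * (n + n)) → Bool)))
      (fun r => F.eval (Sum.elim x r) = true)
    rw [← hbad] at hcount
    have hcard : Fintype.card (Fin n ⊕ Fin n → Bool) ^ 3 = 2 ^ (3 * (n + n)) := by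
      simp [← pow_mul, mul_comm]
    have huniv : (Finset.univ : Finset (Fin (3 * (n + n)) → Bool)).card = 2 ^ (3 * (n + n)) := by
      simp
    omega
end

section
/- There is a constant c > 0 such that for every n ≥ 1, every strong Las Vegas formula computing the matrix product function MP_n (a function of 2n² Boolean variables) has size at least c·n³. -/
open scoped ENNReal

/-- Expected size of a strong Las Vegas formula: a distribution on pairs
(output formula, verifying formula). -/
noncomputable def lvSize {V : Type} (p : PMF (BFormula V × BFormula V)) : ℝ≥0∞ :=
  ∑' q, p q * ((q.1.size + q.2.size : ℕ) : ℝ≥0∞)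

/-- A strong Las Vegas formula computes the (Prop-valued) function `f`: the result
(the value of the output formula when the verifying formula accepts, `?` otherwise)
is never the wrong Boolean value, and `?` appears with probability at most 1/2. -/
def ComputesLVP {V : Type} (p : PMF (BFormula V × BFormula V))
    (f : (V → Bool) → Prop) : Prop :=
  ∀ x : V → Bool,
    (∀ q ∈ p.support, q.2.eval x = true → ((q.1.eval x = true) ↔ f x)) ∧
    (∑' q, (if q.2.eval x = false then p q else 0)) ≤ 1/2

namespace BFormula

/-- Number of leaves labeled by variables from the block `P`. -/
def blockSize {V : Type} (P : V → Prop) [DecidablePred P] : BFormula V → ℕ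
  | var v => if P v then 1 else 0
  | const _ => 0
  | node _ l r => blockSize P l + blockSize P r

theorem sum_blockSize_le_size {V ι : Type} [Fintype ι] (P : ι → V → Prop)
    [∀ i, DecidablePred (P i)] (hP : ∀ v i j, P i v → P j v → i = j) (F : BFormula V) :
    ∑ i, F.blockSize (P i) ≤ F.size := by
  induction F with
  | var v =>
    simp only [blockSize, size, Finset.sum_boole, Nat.cast_id]
    refine Finset.card_le_one.2 fun i hi j hj => ?_
    simp only [Finset.mem_filter, Finset.mem_univ, true_and] at hi hj
    exact hP v i j hi hj
  | const b => simp [blockSize, size]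
  | node g l r ihl ihr =>
    simp only [blockSize, size, Finset.sum_add_distrib]
    omega

theorem eval_eq_of_size_eq_zero {V : Type} (x y : V → Bool) (F : BFormula V)
    (hF : F.size = 0) : F.eval x = F.eval y := by
  induction F with
  | var v => simp [size] at hF
  | const b => rfl
  | node g l r ihl ihr =>
    simp only [size, Nat.add_eq_zero_iff] at hF
    simp only [eval, ihl hF.1, ihr hF.2]

theorem eval_eq_of_blockSize_eq_zero {V Y : Type} (P : V → Prop) [DecidablePred P]
    (a : Y → V → Bool) (ha : ∀ v, ¬ P v → ∀ y y', a y v = a y' v) (F : BFormula V)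
    (hF : F.blockSize P = 0) (y y' : Y) : F.eval (a y) = F.eval (a y') := by
  induction F with
  | var v =>
    refine ha v (fun h => ?_) y y'
    simp [blockSize, h] at hF
  | const b => rfl
  | node g l r ihl ihr =>
    simp only [blockSize, Nat.add_eq_zero_iff] at hF
    simp only [eval, ihl hF.1, ihr hF.2]

/-- The subfunctions on a block which occurs at `s` leaves lie in a set closed under
post-composition, of size at most `2` if `s = 0` and at most `4 ^ (2 * s - 1)` otherwise. -/
theorem exists_subfunctions_closed {V Y Z : Type} [Nonempty Y] (P : V → Prop) [DecidablePred P]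
    (a : Z → Y → V → Bool) (hin : ∀ v, P v → ∀ z z' y, a z y v = a z' y v)
    (hout : ∀ v, ¬ P v → ∀ z y y', a z y v = a z y' v) (F : BFormula V) :
    ∃ S : Finset (Y → Bool), (∀ z, (fun y => F.eval (a z y)) ∈ S) ∧
      (∀ f ∈ S, ∀ φ : Bool → Bool, (fun y => φ (f y)) ∈ S) ∧
      (F.blockSize P = 0 → S.card ≤ 2) ∧
      (F.blockSize P ≠ 0 → 4 * S.card ≤ 16 ^ F.blockSize P) := by
  classical
  have key : ∀ F : BFormula V, F.blockSize P = 0 →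
      ∃ S : Finset (Y → Bool), (∀ z, (fun y => F.eval (a z y)) ∈ S) ∧
      (∀ f ∈ S, ∀ φ : Bool → Bool, (fun y => φ (f y)) ∈ S) ∧
      (F.blockSize P = 0 → S.card ≤ 2) ∧
      (F.blockSize P ≠ 0 → 4 * S.card ≤ 16 ^ F.blockSize P) := by
    intro F hF
    refine ⟨Finset.univ.image fun (b : Bool) (_ : Y) => b, fun z => ?_, ?_, fun _ => ?_,
      fun h => absurd hF h⟩
    · obtain ⟨y₀⟩ := ‹Nonempty Y›
      refine Finset.mem_image.2 ⟨F.eval (a z y₀), Finset.mem_univ _, funext fun y => ?_⟩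
      exact eval_eq_of_blockSize_eq_zero P (a z) (fun v hv => hout v hv z) F hF y₀ y
    · intro f hf φ
      obtain ⟨b, -, rfl⟩ := Finset.mem_image.1 hf
      exact Finset.mem_image.2 ⟨φ b, Finset.mem_univ _, rfl⟩
    · exact Finset.card_image_le.trans (by simp)
  induction F with
  | const b => exact key _ rfl
  | var v =>
    by_cases hv : P v
    · by_cases hZ : Nonempty Z
      · obtain ⟨z₀⟩ := hZ
        refine ⟨Finset.univ.image fun (φ : Bool → Bool) (y : Y) => φ (a z₀ y v), fun z => ?_, ?_,
          fun h => ?_, fun _ => ?_⟩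
        · refine Finset.mem_image.2 ⟨id, Finset.mem_univ _, funext fun y => ?_⟩
          exact hin v hv z₀ z y
        · intro f hf φ
          obtain ⟨ψ, -, rfl⟩ := Finset.mem_image.1 hf
          exact Finset.mem_image.2 ⟨φ ∘ ψ, Finset.mem_univ _, rfl⟩
        · simp [blockSize, hv] at h
        · have : (Finset.univ.image fun (φ : Bool → Bool) (y : Y) => φ (a z₀ y v)).card ≤ 4 :=
            Finset.card_image_le.trans (by simp)
          simp only [blockSize, hv, if_true]
          omega
      · exact ⟨∅, fun z => absurd ⟨z⟩ hZ, by simp, by simp, by simp⟩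
    · exact key _ (by simp [blockSize, hv])
  | node g l r ihl ihr =>
    by_cases hl : l.blockSize P = 0
    · by_cases hr : r.blockSize P = 0
      · exact key _ (by simp [blockSize, hl, hr])
      · obtain ⟨S, hS, hc, h0, h1⟩ := ihr
        refine ⟨S, fun z => ?_, hc, fun h => ?_, fun _ => ?_⟩
        · obtain ⟨y₀⟩ := ‹Nonempty Y›
          convert hc _ (hS z) (g (l.eval (a z y₀))) using 1
          funext y
          simp only [eval]
          rw [eval_eq_of_blockSize_eq_zero P (a z) (fun v hv => hout v hv z) l hl y y₀]
        · simp [blockSize, hr] at h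
        · simpa [blockSize, hl] using h1 hr
    · obtain ⟨S, hS, hc, h0, h1⟩ := ihl
      by_cases hr : r.blockSize P = 0
      · refine ⟨S, fun z => ?_, hc, fun h => ?_, fun _ => ?_⟩
        · obtain ⟨y₀⟩ := ‹Nonempty Y›
          convert hc _ (hS z) (fun b => g b (r.eval (a z y₀))) using 1
          funext y
          simp only [eval]
          rw [eval_eq_of_blockSize_eq_zero P (a z) (fun v hv => hout v hv z) r hr y y₀]
        · simp [blockSize, hl] at h
        · simpa [blockSize, hr] using h1 hl
      · obtain ⟨S', hS', hc', h0', h1'⟩ := ihr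
        refine ⟨((Finset.univ : Finset (Bool → Bool)) ×ˢ (S ×ˢ S')).image
          fun t y => t.1 (g (t.2.1 y) (t.2.2 y)), fun z => ?_, ?_, fun h => ?_, fun _ => ?_⟩
        · exact Finset.mem_image.2 ⟨(id, _, _), Finset.mem_product.2 ⟨Finset.mem_univ _,
            Finset.mem_product.2 ⟨hS z, hS' z⟩⟩, rfl⟩
        · intro f hf φ
          obtain ⟨⟨ψ, f₁, f₂⟩, ht, rfl⟩ := Finset.mem_image.1 hf
          refine Finset.mem_image.2 ⟨(φ ∘ ψ, f₁, f₂), ?_, rfl⟩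
          simp only [Finset.mem_product, Finset.mem_univ, true_and] at ht ⊢
          exact ht
        · simp [blockSize, hl] at h
        · have hcard := Finset.card_image_le
            (s := (Finset.univ : Finset (Bool → Bool)) ×ˢ (S ×ˢ S'))
            (f := fun t y => t.1 (g (t.2.1 y) (t.2.2 y)))
          have h4 : (Finset.univ : Finset (Bool → Bool)).card = 4 := by simp
          rw [Finset.card_product, Finset.card_product, h4] at hcard
          have := Nat.mul_le_mul (h1 hl) (h1' hr)
          simp only [blockSize, pow_add]
          nlinarith

/-- A formula has at most `2 * 16 ^ s` subfunctions on a block which occurs at `s` leaves. -/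
theorem exists_subfunctions {V Y Z : Type} [Nonempty Y] (P : V → Prop) [DecidablePred P]
    (a : Z → Y → V → Bool) (hin : ∀ v, P v → ∀ z z' y, a z y v = a z' y v)
    (hout : ∀ v, ¬ P v → ∀ z y y', a z y v = a z y' v) (F : BFormula V) :
    ∃ S : Finset (Y → Bool), (∀ z, (fun y => F.eval (a z y)) ∈ S) ∧
      S.card ≤ 2 * 16 ^ F.blockSize P := by
  obtain ⟨S, hS, -, h0, h1⟩ := exists_subfunctions_closed P a hin hout F
  refine ⟨S, hS, ?_⟩
  by_cases h : F.blockSize P = 0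
  · simpa [h] using h0 h
  · have := h1 h
    omega

end BFormula

open scoped Matrix

/-- A set of vectors over `GF(2)` is either contained in a subspace of codimension two, or
spans the whole space together with one further vector. -/
theorem four_mul_card_le_or_exists_span_insert_eq_top {m : ℕ} (U : Finset (Fin m → ZMod 2)) :
    4 * U.card ≤ 2 ^ m ∨
      ∃ e, Submodule.span (ZMod 2) (insert e (U : Set (Fin m → ZMod 2))) = ⊤ := by
  classical
  set W := Submodule.span (ZMod 2) (U : Set (Fin m → ZMod 2)) with hW
  have hdim : Module.finrank (ZMod 2) (Fin m → ZMod 2) = m := by simp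
  by_cases htop : W = ⊤
  · refine Or.inr ⟨0, ?_⟩
    rw [Submodule.span_insert_zero, ← hW, htop]
  by_cases hrank : m ≤ Module.finrank (ZMod 2) W + 1
  · right
    obtain ⟨e, -, he⟩ := SetLike.exists_of_lt (lt_top_iff_ne_top.2 htop)
    refine ⟨e, ?_⟩
    have hlt : W < Submodule.span (ZMod 2) (insert e (U : Set (Fin m → ZMod 2))) := by
      refine lt_of_le_of_ne (Submodule.span_mono (Set.subset_insert _ _)) fun h => he ?_
      rw [h]
      exact Submodule.subset_span (Set.mem_insert _ _)
    have hfin := Submodule.finrank_lt_finrank_of_lt hlt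
    refine Submodule.eq_top_of_finrank_eq (le_antisymm (Submodule.finrank_le _) ?_)
    rw [hdim]
    omega
  · left
    have hUW : U.card ≤ Fintype.card W := by
      rw [← Fintype.card_coe U]
      exact Fintype.card_le_of_injective
        (fun u : U => (⟨u.1, Submodule.subset_span u.2⟩ : W))
        fun u v h => Subtype.ext (congrArg (fun w : W => (w : Fin m → ZMod 2)) h)
    rw [Module.card_eq_pow_finrank (K := ZMod 2), ZMod.card] at hUW
    calc 4 * U.card ≤ 2 ^ 2 * 2 ^ Module.finrank (ZMod 2) W := by omega
      _ = 2 ^ (2 + Module.finrank (ZMod 2) W) := (pow_add _ _ _).symm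
      _ ≤ 2 ^ m := Nat.pow_le_pow_right (by norm_num) (by omega)

/-- Matrices that agree on a set of vectors spanning the space are equal. -/
theorem Matrix.eq_of_vecMul_eq_on_span {m : ℕ} {B C : Matrix (Fin m) (Fin m) (ZMod 2)}
    {U : Set (Fin m → ZMod 2)} (hU : Submodule.span (ZMod 2) U = ⊤)
    (h : ∀ u ∈ U, u ᵥ* B = u ᵥ* C) : B = C := by
  have hlin : B.vecMulLinear = C.vecMulLinear := LinearMap.ext_on hU fun u hu => h u hu
  ext i j
  have := congrFun (LinearMap.congr_fun hlin (Pi.single i 1)) j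
  simpa using this

theorem Matrix.card_zmod_two (m : ℕ) :
    Fintype.card (Matrix (Fin m) (Fin m) (ZMod 2)) = 2 ^ (m * m) := by
  rw [← Nat.card_eq_fintype_card, Matrix, Nat.card_eq_fintype_card]
  simp [ZMod.card, pow_mul]

section HardInstances

variable {n m r : ℕ} (ε : Fin n ≃ (Fin m ⊕ Fin m) ⊕ Fin r)

/-- The vector with blocks `u`, `w` and `0`. -/
def blockVec (y : (Fin m → ZMod 2) × (Fin m → ZMod 2)) : (Fin m ⊕ Fin m) ⊕ Fin r → ZMod 2
  | Sum.inl (Sum.inl j) => y.1 j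
  | Sum.inl (Sum.inr j) => y.2 j
  | Sum.inr _ => 0

/-- The matrix whose first block column consists of `B`, the identity and `0`, all other
entries being zero. -/
def blockMat (B : Matrix (Fin m) (Fin m) (ZMod 2)) :
    (Fin m ⊕ Fin m) ⊕ Fin r → (Fin m ⊕ Fin m) ⊕ Fin r → ZMod 2
  | Sum.inl (Sum.inl j), Sum.inl (Sum.inl k) => B j k
  | Sum.inl (Sum.inr j), Sum.inl (Sum.inl k) => if j = k then 1 else 0
  | _, _ => 0

/-- The input whose first matrix has `blockVec y` as row `i` and zeros elsewhere, and whose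
second matrix is `blockMat B`. -/
def hardInput (i : Fin n) (B : Matrix (Fin m) (Fin m) (ZMod 2))
    (y : (Fin m → ZMod 2) × (Fin m → ZMod 2)) : MPVar n → Bool
  | Sum.inl (i', j) => decide (i' = i ∧ blockVec (r := r) y (ε j) = 1)
  | Sum.inr (j, k) => decide (blockMat (r := r) B (ε j) (ε k) = 1)

theorem ZMod.ite_eq_one (a : ZMod 2) : (if a = 1 then (1 : ZMod 2) else 0) = a := by
  revert a
  decide

theorem MPholds_hardInput (i : Fin n) (B : Matrix (Fin m) (Fin m) (ZMod 2))
    (y : (Fin m → ZMod 2) × (Fin m → ZMod 2)) :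
    MPholds n (hardInput ε i B y) ↔ y.1 ᵥ* B + y.2 ≠ 0 := by
  have hsum : ∀ c, ∑ j, blockVec (r := r) y (ε j) * blockMat (r := r) B (ε j) c =
      ∑ j, blockVec (r := r) y j * blockMat (r := r) B j c := fun c =>
    Equiv.sum_comp ε fun j => blockVec y j * blockMat B j c
  have hk : ∀ k, ∑ j, blockVec (r := r) y j * blockMat (r := r) B j (Sum.inl (Sum.inl k)) =
      (y.1 ᵥ* B + y.2) k := fun k => by
    simp [Fintype.sum_sum_type, blockVec, blockMat, Matrix.vecMul, dotProduct]
  unfold MPholds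
  refine not_congr ⟨fun h => ?_, fun h => ?_⟩
  · funext k
    have := congrFun (congrFun h i) (ε.symm (Sum.inl (Sum.inl k)))
    simp only [Matrix.mul_apply, Matrix.of_apply, hardInput, true_and, decide_eq_true_eq,
      ZMod.ite_eq_one, hsum, Equiv.apply_symm_apply, hk] at this
    exact this
  · ext i' k
    by_cases hi : i' = i
    · simp only [Matrix.mul_apply, Matrix.of_apply, hardInput, hi, true_and, decide_eq_true_eq,
        ZMod.ite_eq_one, hsum]
      rcases ε k with (k | k) | k
      · rw [hk, h]
        rfl
      · simp [blockMat]
      · simp [blockMat]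
    · simp [Matrix.mul_apply, hardInput, hi]

/-- The block of the variables in row `i` of the first matrix. -/
def InRow (i : Fin n) : MPVar n → Prop
  | Sum.inl (i', _) => i' = i
  | Sum.inr _ => False

instance (i : Fin n) : DecidablePred (InRow i)
  | Sum.inl (i', _) => inferInstanceAs (Decidable (i' = i))
  | Sum.inr _ => inferInstanceAs (Decidable False)

/-- A Las Vegas formula with few leaves in row `i` gives up on most hard inputs whose product
is zero. -/
theorem card_verified_le (i : Fin n) (q : BFormula (MPVar n) × BFormula (MPVar n))
    (hq : ∀ x, q.2.eval x = true → (q.1.eval x = true ↔ MPholds n x)) :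
    4 * (Finset.univ.filter fun t : Matrix (Fin m) (Fin m) (ZMod 2) × (Fin m → ZMod 2) =>
      q.2.eval (hardInput ε i t.1 (t.2, t.2 ᵥ* t.1)) = true).card ≤
      2 ^ (m * m) * 2 ^ m +
        16 * 16 ^ (q.1.blockSize (InRow i) + q.2.blockSize (InRow i)) * 2 ^ m * 2 ^ m := by
  classical
  have hin : ∀ v, InRow i v → ∀ (B C : Matrix (Fin m) (Fin m) (ZMod 2)) y,
      hardInput ε i B y v = hardInput ε i C y v := by
    rintro (⟨i', j⟩ | ⟨j, k⟩) hv B C y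
    · rfl
    · exact hv.elim
  have hout : ∀ v, ¬ InRow i v → ∀ (B : Matrix (Fin m) (Fin m) (ZMod 2)) y y',
      hardInput ε i B y v = hardInput ε i B y' v := by
    rintro (⟨i', j⟩ | ⟨j, k⟩) hv B y y'
    · have hne : i' ≠ i := hv
      simp [hardInput, hne]
    · rfl
  obtain ⟨S₁, hS₁, hc₁⟩ := BFormula.exists_subfunctions (InRow i) (hardInput ε i) hin hout q.1
  obtain ⟨S₂, hS₂, hc₂⟩ := BFormula.exists_subfunctions (InRow i) (hardInput ε i) hin hout q.2
  set U : Matrix (Fin m) (Fin m) (ZMod 2) → Finset (Fin m → ZMod 2) := fun B =>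
    Finset.univ.filter fun u => q.2.eval (hardInput ε i B (u, u ᵥ* B)) = true with hU
  set bad : Finset (Matrix (Fin m) (Fin m) (ZMod 2)) :=
    Finset.univ.filter fun B => ∃ e, Submodule.span (ZMod 2)
      (insert e (U B : Set (Fin m → ZMod 2))) = ⊤
  have hcardU : ∀ B, (U B).card ≤ 2 ^ m := fun B =>
    (Finset.card_le_univ _).trans (by simp [ZMod.card])
  have hagree : ∀ B C, (fun y => q.1.eval (hardInput ε i B y)) =
      (fun y => q.1.eval (hardInput ε i C y)) → (fun y => q.2.eval (hardInput ε i B y)) =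
      (fun y => q.2.eval (hardInput ε i C y)) → ∀ u ∈ U B, u ᵥ* B = u ᵥ* C := by
    intro B C h₁ h₂ u hu
    have hv : q.2.eval (hardInput ε i B (u, u ᵥ* B)) = true := (Finset.mem_filter.1 hu).2
    have hzero : ¬ MPholds n (hardInput ε i B (u, u ᵥ* B)) := by
      rw [MPholds_hardInput, not_not]
      exact funext fun j => CharTwo.add_self_eq_zero _
    have hzero' : ¬ MPholds n (hardInput ε i C (u, u ᵥ* B)) := by
      rw [← hq _ ((congrFun h₂ (u, u ᵥ* B)).symm.trans hv), ← congrFun h₁ (u, u ᵥ* B), hq _ hv]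
      exact hzero
    rw [MPholds_hardInput, not_not] at hzero'
    exact funext fun j => (CharTwo.add_eq_zero.1 (congrFun hzero' j)).symm
  have hbadcard : bad.card ≤ 2 ^ m * (S₁ ×ˢ S₂).card := by
    refine Finset.card_le_mul_card_image_of_maps_to (f := fun B =>
      ((fun y => q.1.eval (hardInput ε i B y)), (fun y => q.2.eval (hardInput ε i B y))))
      (fun B _ => Finset.mem_product.2 ⟨hS₁ B, hS₂ B⟩) _ fun b _ => ?_
    rcases Finset.eq_empty_or_nonempty (bad.filter fun B =>
      ((fun y => q.1.eval (hardInput ε i B y)), (fun y => q.2.eval (hardInput ε i B y))) = b)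
      with h | ⟨B, hB⟩
    · rw [h]
      simp
    · rw [Finset.mem_filter] at hB
      obtain ⟨e, he⟩ := (Finset.mem_filter.1 hB.1).2
      refine (Finset.card_le_card_of_injOn (t := Finset.univ) (fun C => e ᵥ* C) (by simp) ?_).trans
        (by simp [ZMod.card])
      intro C hC D hD hCD
      have hC' := (Finset.mem_filter.1 hC).2
      have hD' := (Finset.mem_filter.1 hD).2
      refine Matrix.eq_of_vecMul_eq_on_span he fun u hu => ?_
      rcases hu with rfl | hu
      · exact hCD
      · have hBC := hB.2.trans hC'.symm
        have hBD := hB.2.trans hD'.symm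
        rw [Prod.mk.injEq] at hBC hBD
        exact (hagree B C hBC.1 hBC.2 u hu).symm.trans (hagree B D hBD.1 hBD.2 u hu)
  have hS : (S₁ ×ˢ S₂).card ≤
      4 * 16 ^ (q.1.blockSize (InRow i) + q.2.blockSize (InRow i)) := by
    rw [Finset.card_product, pow_add]
    calc S₁.card * S₂.card ≤ _ := Nat.mul_le_mul hc₁ hc₂
      _ = _ := by ring
  have hsplit : (Finset.univ.filter fun t : Matrix (Fin m) (Fin m) (ZMod 2) × (Fin m → ZMod 2) =>
      q.2.eval (hardInput ε i t.1 (t.2, t.2 ᵥ* t.1)) = true).card = ∑ B, (U B).card := by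
    simp only [hU, Finset.card_filter, Fintype.sum_prod_type]
  have hterm : ∀ B, 4 * (U B).card ≤ 2 ^ m + if B ∈ bad then 4 * 2 ^ m else 0 := by
    intro B
    rcases four_mul_card_le_or_exists_span_insert_eq_top (U B) with h | h
    · exact h.trans (Nat.le_add_right _ _)
    · have hB : B ∈ bad := Finset.mem_filter.2 ⟨Finset.mem_univ _, h⟩
      rw [if_pos hB]
      have := hcardU B
      omega
  rw [hsplit, Finset.mul_sum]
  calc ∑ B, 4 * (U B).card ≤ ∑ B, (2 ^ m + if B ∈ bad then 4 * 2 ^ m else 0) :=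
        Finset.sum_le_sum fun B _ => hterm B
    _ = 2 ^ (m * m) * 2 ^ m + bad.card * (4 * 2 ^ m) := by
        rw [Finset.sum_add_distrib]
        simp [Matrix.card_zmod_two]
    _ ≤ 2 ^ (m * m) * 2 ^ m +
        (2 ^ m * (4 * 16 ^ (q.1.blockSize (InRow i) + q.2.blockSize (InRow i)))) *
          (4 * 2 ^ m) := by gcongr; exact hbadcard.trans (Nat.mul_le_mul_left _ hS)
    _ = _ := by ring

/-- The trade-off between the number of hard inputs on which a Las Vegas formula gives up and
its number of leaves in row `i`. -/
theorem card_unverified_add_blockSize_ge (τ : ℕ) (hτ : τ + m + 4 ≤ m * m) (i : Fin n)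
    (q : BFormula (MPVar n) × BFormula (MPVar n))
    (hq : ∀ x, q.2.eval x = true → (q.1.eval x = true ↔ MPholds n x)) :
    5 * τ * (2 ^ (m * m) * 2 ^ m) ≤
      8 * τ * (Finset.univ.filter fun t : Matrix (Fin m) (Fin m) (ZMod 2) × (Fin m → ZMod 2) =>
        q.2.eval (hardInput ε i t.1 (t.2, t.2 ᵥ* t.1)) = false).card +
      32 * (2 ^ (m * m) * 2 ^ m) *
        (q.1.blockSize (InRow i) + q.2.blockSize (InRow i)) := by
  classical
  have hle := card_verified_le ε i q hq
  have hadd := Finset.card_filter_add_card_filter_not (s := Finset.univ)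
    fun t : Matrix (Fin m) (Fin m) (ZMod 2) × (Fin m → ZMod 2) =>
      q.2.eval (hardInput ε i t.1 (t.2, t.2 ᵥ* t.1)) = true
  simp only [Bool.not_eq_true, Finset.card_univ, Fintype.card_prod, Matrix.card_zmod_two,
    ZMod.card, Fintype.card_fin, Fintype.card_fun] at hadd
  set R := (Finset.univ.filter fun t : Matrix (Fin m) (Fin m) (ZMod 2) × (Fin m → ZMod 2) =>
      q.2.eval (hardInput ε i t.1 (t.2, t.2 ᵥ* t.1)) = true).card
  set Q := (Finset.univ.filter fun t : Matrix (Fin m) (Fin m) (ZMod 2) × (Fin m → ZMod 2) =>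
      q.2.eval (hardInput ε i t.1 (t.2, t.2 ᵥ* t.1)) = false).card
  set s := q.1.blockSize (InRow i) + q.2.blockSize (InRow i)
  by_cases hs : 4 * s + 1 ≤ τ
  · have hpow : 2 * (16 * 16 ^ s * 2 ^ m * 2 ^ m) ≤ 2 ^ (m * m) * 2 ^ m := by
      calc 2 * (16 * 16 ^ s * 2 ^ m * 2 ^ m) = 2 ^ (4 * s + 1 + 4 + m) * 2 ^ m := by
            rw [show (16 : ℕ) = 2 ^ 4 by norm_num, ← pow_mul]
            ring
        _ ≤ 2 ^ (m * m) * 2 ^ m :=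
            Nat.mul_le_mul_right _ (Nat.pow_le_pow_right (by norm_num) (by omega))
    have h5 : 5 * (2 ^ (m * m) * 2 ^ m) ≤ 8 * Q := by omega
    calc 5 * τ * (2 ^ (m * m) * 2 ^ m) = τ * (5 * (2 ^ (m * m) * 2 ^ m)) := by ring
      _ ≤ τ * (8 * Q) := Nat.mul_le_mul_left _ h5
      _ = 8 * τ * Q := by ring
      _ ≤ _ := Nat.le_add_right _ _
  · have h5 : 5 * τ ≤ 32 * s := by omega
    calc 5 * τ * (2 ^ (m * m) * 2 ^ m) ≤ 32 * s * (2 ^ (m * m) * 2 ^ m) :=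
          Nat.mul_le_mul_right _ h5
      _ = 32 * (2 ^ (m * m) * 2 ^ m) * s := by ring
      _ ≤ _ := Nat.le_add_left _ _

end HardInstances

/-- The expected number of inputs from a finite family on which the result is `?` is at most
half the size of the family. -/
theorem ComputesLVP.two_mul_tsum_card_le {V Ω : Type} [Fintype Ω]
    {p : PMF (BFormula V × BFormula V)} {f : (V → Bool) → Prop} (hp : ComputesLVP p f)
    (x : Ω → V → Bool) :
    2 * ∑' q, p q * ((Finset.univ.filter fun t => q.2.eval (x t) = false).card : ℝ≥0∞) ≤
      (Fintype.card Ω : ℝ≥0∞) := by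
  have h : ∀ q, p q * ((Finset.univ.filter fun t => q.2.eval (x t) = false).card : ℝ≥0∞) =
      ∑ t, if q.2.eval (x t) = false then p q else 0 := fun q => by
    rw [← Finset.sum_filter, Finset.sum_const, nsmul_eq_mul, mul_comm]
  simp only [h]
  rw [Summable.tsum_finsetSum fun _ _ => ENNReal.summable]
  calc 2 * ∑ t, ∑' q, (if q.2.eval (x t) = false then p q else 0)
      ≤ 2 * ∑ _t : Ω, (1 / 2 : ℝ≥0∞) := by gcongr with t; exact (hp (x t)).2
    _ = (2 * (1 / 2)) * (Fintype.card Ω : ℝ≥0∞) := by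
        rw [Finset.sum_const, Finset.card_univ, nsmul_eq_mul]
        ring
    _ = _ := by
        rw [one_div, ENNReal.mul_inv_cancel (by norm_num) (by norm_num), one_mul]

/-- A pointwise trade-off `a ≤ b * k + d * s` on the support, where `k` counts the inputs of a
finite family with result `?`, holds in expectation. -/
theorem ComputesLVP.two_mul_le_of_forall {V Ω : Type} [Fintype Ω]
    {p : PMF (BFormula V × BFormula V)} {f : (V → Bool) → Prop} (hp : ComputesLVP p f)
    (x : Ω → V → Bool) (s : BFormula V × BFormula V → ℕ) (a b d : ℕ)
    (h : ∀ q ∈ p.support, a ≤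
      b * (Finset.univ.filter fun t => q.2.eval (x t) = false).card + d * s q) :
    (2 * a : ℝ≥0∞) ≤ b * Fintype.card Ω + 2 * d * ∑' q, p q * (s q : ℝ≥0∞) := by
  have hq : ∀ q, p q * (a : ℝ≥0∞) ≤
      b * (p q * ((Finset.univ.filter fun t => q.2.eval (x t) = false).card : ℝ≥0∞)) +
        d * (p q * (s q : ℝ≥0∞)) := by
    intro q
    by_cases h0 : p q = 0
    · simp [h0]
    · have := h q ((PMF.mem_support_iff _ _).2 h0)
      calc p q * (a : ℝ≥0∞) ≤ p q * ((b * (Finset.univ.filter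
            fun t => q.2.eval (x t) = false).card + d * s q : ℕ) : ℝ≥0∞) := by
            gcongr
        _ = _ := by push_cast; ring
  have hsum := ENNReal.tsum_le_tsum hq
  rw [ENNReal.tsum_mul_right, p.tsum_coe, one_mul, ENNReal.tsum_add, ENNReal.tsum_mul_left,
    ENNReal.tsum_mul_left] at hsum
  calc (2 * a : ℝ≥0∞) ≤ 2 * (b * ∑' q, p q *
          ((Finset.univ.filter fun t => q.2.eval (x t) = false).card : ℝ≥0∞) +
        d * ∑' q, p q * (s q : ℝ≥0∞)) := by gcongr
    _ = b * (2 * ∑' q, p q *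
          ((Finset.univ.filter fun t => q.2.eval (x t) = false).card : ℝ≥0∞)) +
        2 * d * ∑' q, p q * (s q : ℝ≥0∞) := by ring
    _ ≤ _ := by gcongr; exact hp.two_mul_tsum_card_le x

/-- A strong Las Vegas formula for a nonconstant function has size at least `1 / 2`. -/
theorem ComputesLVP.one_le_two_mul_lvSize {V : Type} {p : PMF (BFormula V × BFormula V)}
    {f : (V → Bool) → Prop} (hp : ComputesLVP p f) {x y : V → Bool} (hx : f x) (hy : ¬ f y) :
    1 ≤ 2 * lvSize p := by
  have h := hp.two_mul_le_of_forall (fun _ : Unit => x) (fun q => q.1.size + q.2.size) 1 1 1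
    fun q hq => by
      by_cases h0 : q.1.size + q.2.size = 0
      · rw [Nat.add_eq_zero_iff] at h0
        have hv : q.2.eval x = false := by
          by_contra hv
          rw [Bool.not_eq_false] at hv
          have hvy := (BFormula.eval_eq_of_size_eq_zero x y q.2 h0.2).symm.trans hv
          have h1 := ((hp x).1 q hq hv).2 hx
          exact hy (((hp y).1 q hq hvy).1
            ((BFormula.eval_eq_of_size_eq_zero x y q.1 h0.1).symm.trans h1))
        simp [hv]
      · omega
  simp only [Nat.cast_one, mul_one, Fintype.card_unit] at h
  rw [← one_add_one_eq_two] at h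
  rw [← one_add_one_eq_two]
  exact (ENNReal.add_le_add_iff_left ENNReal.one_ne_top).1 h

theorem one_le_two_mul_lvSize_of_computes_MPholds {n : ℕ} (hn : 1 ≤ n)
    {p : PMF (BFormula (MPVar n) × BFormula (MPVar n))} (hp : ComputesLVP p (MPholds n)) :
    1 ≤ 2 * lvSize p := by
  refine hp.one_le_two_mul_lvSize (x := Sum.elim (fun t => decide (t.1 = t.2))
    fun t => decide (t.1 = t.2)) (y := fun _ => false) ?_ ?_
  · have hone : (Matrix.of fun i j : Fin n => if i = j then (1 : ZMod 2) else 0) = 1 := by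
      ext i j
      simp [Matrix.one_apply]
    have : Nonempty (Fin n) := ⟨⟨0, hn⟩⟩
    simp [MPholds, hone]
  · simp only [MPholds, not_not]
    ext i j
    simp [Matrix.mul_apply]

/-- The leaves in a single row of the first matrix contribute quadratically. -/
theorem le_tsum_blockSize_of_computes_MPholds {n m r : ℕ}
    (ε : Fin n ≃ (Fin m ⊕ Fin m) ⊕ Fin r) (τ : ℕ) (hτ : τ + m + 4 ≤ m * m)
    {p : PMF (BFormula (MPVar n) × BFormula (MPVar n))} (hp : ComputesLVP p (MPholds n))
    (i : Fin n) :
    (τ : ℝ≥0∞) ≤ 32 * ∑' q, p q *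
      ((q.1.blockSize (InRow i) + q.2.blockSize (InRow i) : ℕ) : ℝ≥0∞) := by
  have h := hp.two_mul_le_of_forall
    (fun t : Matrix (Fin m) (Fin m) (ZMod 2) × (Fin m → ZMod 2) =>
      hardInput ε i t.1 (t.2, t.2 ᵥ* t.1))
    (fun q => q.1.blockSize (InRow i) + q.2.blockSize (InRow i)) _ _ _
    fun q hq => card_unverified_add_blockSize_ge ε τ hτ i q fun x => (hp x).1 q hq
  have hcard : Fintype.card (Matrix (Fin m) (Fin m) (ZMod 2) × (Fin m → ZMod 2)) =
      2 ^ (m * m) * 2 ^ m := by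
    simp only [Fintype.card_prod, Matrix.card_zmod_two, ZMod.card, Fintype.card_fin,
      Fintype.card_fun]
  rw [hcard] at h
  have hN : 2 ^ (m * m) * 2 ^ m ≠ 0 := by positivity
  generalize 2 ^ (m * m) * 2 ^ m = N at h hN
  generalize (∑' q, p q *
      ((q.1.blockSize (InRow i) + q.2.blockSize (InRow i) : ℕ) : ℝ≥0∞)) = E at h ⊢
  push_cast at h
  have h' : (8 * τ * N : ℝ≥0∞) + 2 * N * τ ≤ 8 * τ * N + 2 * N * (32 * E) := by
    calc (8 * τ * N : ℝ≥0∞) + 2 * N * τ = 2 * (5 * τ * N) := by ring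
      _ ≤ _ := h
      _ = _ := by ring
  have hfin : (8 * τ * N : ℝ≥0∞) ≠ ⊤ := by exact_mod_cast ENNReal.natCast_ne_top (8 * τ * N)
  have h'' := (ENNReal.add_le_add_iff_left hfin).1 h'
  have hN0 : (2 * N : ℝ≥0∞) ≠ 0 := by exact_mod_cast (by omega : 2 * N ≠ 0)
  have hNt : (2 * N : ℝ≥0∞) ≠ ⊤ := by exact_mod_cast ENNReal.natCast_ne_top (2 * N)
  exact (ENNReal.mul_le_mul_iff_right hN0 hNt).1 h''

theorem mul_le_lvSize_of_computes_MPholds {n m r : ℕ} (hn : n = m + m + r)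
    (τ : ℕ) (hτ : τ + m + 4 ≤ m * m)
    {p : PMF (BFormula (MPVar n) × BFormula (MPVar n))} (hp : ComputesLVP p (MPholds n)) :
    ((n * τ : ℕ) : ℝ≥0∞) ≤ 32 * lvSize p := by
  let ε : Fin n ≃ (Fin m ⊕ Fin m) ⊕ Fin r := (finCongr hn).trans
    (finSumFinEquiv.symm.trans (Equiv.sumCongr finSumFinEquiv.symm (Equiv.refl _)))
  have hrow : ∀ v (i j : Fin n), InRow i v → InRow j v → i = j := by
    rintro (⟨i', j'⟩ | t) i j hi hj
    · exact (show i' = i from hi).symm.trans hj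
    · exact hi.elim
  calc ((n * τ : ℕ) : ℝ≥0∞) = ∑ _i : Fin n, (τ : ℝ≥0∞) := by simp
    _ ≤ ∑ i : Fin n, 32 * ∑' q, p q *
        ((q.1.blockSize (InRow i) + q.2.blockSize (InRow i) : ℕ) : ℝ≥0∞) :=
      Finset.sum_le_sum fun i _ => le_tsum_blockSize_of_computes_MPholds ε τ hτ hp i
    _ = 32 * ∑' q, p q * ((∑ i : Fin n,
        (q.1.blockSize (InRow i) + q.2.blockSize (InRow i)) : ℕ) : ℝ≥0∞) := by
      rw [← Finset.mul_sum, ← Summable.tsum_finsetSum fun _ _ => ENNReal.summable]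
      congr 2
      funext q
      rw [Nat.cast_sum, Finset.mul_sum]
    _ ≤ 32 * lvSize p := by
      unfold lvSize
      gcongr with q
      rw [Finset.sum_add_distrib]
      exact Nat.add_le_add (BFormula.sum_blockSize_le_size _ hrow _)
        (BFormula.sum_blockSize_le_size _ hrow _)

/-- Every strong Las Vegas formula computing the matrix product function `MP_n`
has size at least `c·n³`. -/
theorem stmt6 :
    ∃ c : ℝ, 0 < c ∧
      ∀ n : ℕ, 1 ≤ n →
        ∀ p : PMF (BFormula (MPVar n) × BFormula (MPVar n)),
          ComputesLVP p (MPholds n) →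
          ENNReal.ofReal (c * (n : ℝ) ^ 3) ≤ lvSize p := by
  refine ⟨1 / 1000, by norm_num, fun n hn p hp => ?_⟩
  by_cases hsmall : n < 8
  · have h := one_le_two_mul_lvSize_of_computes_MPholds hn hp
    have hn' : (n : ℝ) ≤ 7 := by exact_mod_cast (by omega : n ≤ 7)
    have hc : (n : ℝ) ^ 3 ≤ 7 ^ 3 := by gcongr
    refine (ENNReal.mul_le_mul_iff_right two_ne_zero ENNReal.ofNat_ne_top).1 (le_trans ?_ h)
    rw [← ENNReal.ofReal_ofNat 2, ← ENNReal.ofReal_mul (by norm_num), ← ENNReal.ofReal_one]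
    exact ENNReal.ofReal_le_ofReal (by linarith)
  · obtain ⟨m, r, hmr, hr⟩ : ∃ m r, n = m + m + r ∧ r ≤ 1 := ⟨n / 2, n % 2, by omega, by omega⟩
    have hm : 4 ≤ m := by omega
    obtain ⟨τ, hτ⟩ : ∃ τ, m * m = τ + m + 4 := ⟨m * m - m - 4, by
      have : 4 * m ≤ m * m := Nat.mul_le_mul_right _ hm
      omega⟩
    have h := mul_le_lvSize_of_computes_MPholds hmr τ hτ.ge hp
    refine (ENNReal.mul_le_mul_iff_right (a := 32) (by norm_num) ENNReal.ofNat_ne_top).1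
      (le_trans ?_ h)
    rw [← ENNReal.ofReal_ofNat 32, ← ENNReal.ofReal_mul (by norm_num), ← ENNReal.ofReal_natCast]
    refine ENNReal.ofReal_le_ofReal ?_
    have hmR : (4 : ℝ) ≤ m := by exact_mod_cast hm
    have hτR : (m : ℝ) * m = τ + m + 4 := by exact_mod_cast hτ
    have hnR : (n : ℝ) ≤ 9 / 4 * m := by
      have : 4 * n ≤ 9 * m := by omega
      have : (4 : ℝ) * n ≤ 9 * m := by exact_mod_cast this
      linarith
    have hsq : (n : ℝ) ^ 2 ≤ (9 / 4 * m) ^ 2 := by gcongr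
    have hτn : (n : ℝ) ^ 2 * (32 / 1000) ≤ τ := by nlinarith
    push_cast
    calc (32 : ℝ) * (1 / 1000 * (n : ℝ) ^ 3) = (n : ℝ) * ((n : ℝ) ^ 2 * (32 / 1000)) := by ring
      _ ≤ (n : ℝ) * (τ : ℝ) := by gcongr
end

section
/- For n ≥ 1 define g_n on four n×n matrices T⁽¹⁾,T⁽²⁾,T⁽³⁾,T⁽⁴⁾ over GF(2) (4n² Boolean variables) by g_n = MP_n(T⁽¹⁾,T⁽²⁾) XOR (1 − MP_n(T⁽³⁾,T⁽⁴⁾)). There are constants C, c > 0 such that for every n: (a) g_n is computed with bounded error by a fair probabilistic formula of size at most C·n²; and (b) every strong Monte Carlo formula computing g_n has size at least c·n³. (Hence there is a size gap of order √N between Monte Carlo formulas and bounded-error probabilistic formulas, where N = 4n² is the input length.) -/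
open scoped ENNReal

/-- Expected size of a strong probabilistic formula. -/
noncomputable def pmfSize {V : Type} (p : PMF (BFormula V)) : ℝ≥0∞ :=
  ∑' F, p F * (F.size : ℝ≥0∞)

/-- The function `g_n = MP_n(T¹,T²) XOR (1 − MP_n(T³,T⁴))` on four `n×n` matrices
over GF(2); it holds iff the two matrix-product predicates agree. -/
def MPXO (n : ℕ) (x : (MPVar n ⊕ MPVar n) → Bool) : Prop :=
  MPholds n (fun v => x (Sum.inl v)) ↔ MPholds n (fun v => x (Sum.inr v))

instance (n : ℕ) (x : MPVar n → Bool) : Decidable (MPholds n x) := by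
  unfold MPholds; infer_instance

instance (n : ℕ) (x : (MPVar n ⊕ MPVar n) → Bool) : Decidable (MPXO n x) := by
  unfold MPXO; infer_instance

theorem two_mul_card_ker_le {G H : Type*} [AddGroup G] [Fintype G] [AddGroup H] [DecidableEq H]
    (f : G →+ H) (hf : f ≠ 0) :
    2 * (Finset.univ.filter fun g => f g = 0).card ≤ Fintype.card G := by
  obtain ⟨a, ha⟩ : ∃ a, f a ≠ 0 := by
    by_contra! h
    exact hf (AddMonoidHom.ext h)
  have hle : (Finset.univ.filter fun g => f g = 0).card ≤
      (Finset.univ.filter fun g => ¬ f g = 0).card := by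
    refine Finset.card_le_card_of_injOn (· + a) ?_ (fun _ _ _ _ h => add_right_cancel h)
    intro g hg
    simp_all
  have := Finset.card_filter_add_card_filter_not (s := (Finset.univ : Finset G)) (fun g => f g = 0)
  rw [Finset.card_univ] at this
  omega

/-- A nonzero bilinear form over GF(2) vanishes on at most three quarters of all pairs. -/
theorem four_mul_card_bilin_zero_le {n : ℕ} (M : Matrix (Fin n) (Fin n) (ZMod 2)) (hM : M ≠ 0) :
    4 * (Finset.univ.filter fun p : (Fin n → ZMod 2) × (Fin n → ZMod 2) =>
      p.1 ⬝ᵥ M.mulVec p.2 = 0).card ≤ 3 * 4 ^ n := by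
  have hG : Fintype.card (Fin n → ZMod 2) = 2 ^ n := by simp [ZMod.card]
  have hker : 2 * (Finset.univ.filter fun v : Fin n → ZMod 2 => M.mulVec v = 0).card ≤ 2 ^ n := by
    rw [← hG]
    refine two_mul_card_ker_le M.mulVecLin.toAddMonoidHom ?_
    intro h
    refine hM (Matrix.ext_of_mulVec_single fun i => ?_)
    rw [Matrix.zero_mulVec]
    exact DFunLike.congr_fun h (Pi.single i 1)
  have hrow (w : Fin n → ZMod 2) (hw : w ≠ 0) :
      2 * (Finset.univ.filter fun u : Fin n → ZMod 2 => u ⬝ᵥ w = 0).card ≤ 2 ^ n := by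
    rw [← hG]
    refine two_mul_card_ker_le
      (AddMonoidHom.mk' (fun u : Fin n → ZMod 2 => u ⬝ᵥ w) fun a b => add_dotProduct a b w) ?_
    intro h
    refine hw (funext fun i => ?_)
    simpa using DFunLike.congr_fun h (Pi.single i 1)
  have hsum : (Finset.univ.filter fun p : (Fin n → ZMod 2) × (Fin n → ZMod 2) =>
      p.1 ⬝ᵥ M.mulVec p.2 = 0).card =
      ∑ v : Fin n → ZMod 2,
        (Finset.univ.filter fun u : Fin n → ZMod 2 => u ⬝ᵥ M.mulVec v = 0).card := by
    simp only [Finset.card_filter]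
    rw [Fintype.sum_prod_type_right]
  have hbound (v : Fin n → ZMod 2) :
      2 * (Finset.univ.filter fun u : Fin n → ZMod 2 => u ⬝ᵥ M.mulVec v = 0).card ≤
        2 ^ n + 2 ^ n * if M.mulVec v = 0 then 1 else 0 := by
    split_ifs with h
    · have := Finset.card_le_univ
        (Finset.univ.filter fun u : Fin n → ZMod 2 => u ⬝ᵥ M.mulVec v = 0)
      rw [hG] at this
      omega
    · simpa using hrow _ h
  have htot : 2 * (Finset.univ.filter fun p : (Fin n → ZMod 2) × (Fin n → ZMod 2) =>
      p.1 ⬝ᵥ M.mulVec p.2 = 0).card ≤ 2 ^ n * 2 ^ n +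
        2 ^ n * (Finset.univ.filter fun v : Fin n → ZMod 2 => M.mulVec v = 0).card := by
    rw [hsum, Finset.mul_sum]
    refine (Finset.sum_le_sum fun v _ => hbound v).trans_eq ?_
    rw [Finset.sum_add_distrib, ← Finset.mul_sum, ← Finset.card_filter]
    simp [ZMod.card]
  have h4 : (4 : ℕ) ^ n = 2 ^ n * 2 ^ n := by rw [← mul_pow]; norm_num
  rw [h4]
  nlinarith

/-- The element of GF(2) encoded by a bit. -/
def toGF2 (b : Bool) : ZMod 2 := if b then 1 else 0

theorem toGF2_injective : Function.Injective toGF2 := by decide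

theorem toGF2_xor (a b : Bool) : toGF2 (xor a b) = toGF2 a + toGF2 b := by
  revert a b; decide

theorem toGF2_and (a b : Bool) : toGF2 (and a b) = toGF2 a * toGF2 b := by
  revert a b; decide

namespace BFormula

variable {V : Type}

/-- The formula combining the members of a list by `g`, starting from the constant `b`. -/
def fold (g : Bool → Bool → Bool) (b : Bool) (l : List (BFormula V)) : BFormula V :=
  l.foldr (node g) (const b)

theorem size_fold (g : Bool → Bool → Bool) (b : Bool) (l : List (BFormula V)) :
    (fold g b l).size = (l.map size).sum := by
  induction l with
  | nil => rfl
  | cons a l ih => simpa [fold, size] using ih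

theorem toGF2_eval_fold_xor (x : V → Bool) (l : List (BFormula V)) :
    toGF2 ((fold xor false l).eval x) = (l.map fun F => toGF2 (F.eval x)).sum := by
  induction l with
  | nil => rfl
  | cons a l ih =>
    have : (fold xor false (a :: l)).eval x = xor (a.eval x) ((fold xor false l).eval x) := rfl
    rw [this, toGF2_xor, ih, List.map_cons, List.sum_cons]

theorem eval_fold_or (x : V → Bool) (l : List (BFormula V)) :
    (fold or false l).eval x = true ↔ ∃ F ∈ l, F.eval x = true := by
  induction l with
  | nil => simp [fold, eval]
  | cons a l ih =>
    have : (fold or false (a :: l)).eval x = or (a.eval x) ((fold or false l).eval x) := rfl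
    rw [this, Bool.or_eq_true, ih]
    simp

/-- The formula for the inner product over GF(2) of two vectors of formulas. -/
def dot {n : ℕ} (a b : Fin n → BFormula V) : BFormula V :=
  fold xor false (List.ofFn fun i => node and (a i) (b i))

theorem size_dot {n : ℕ} (a b : Fin n → BFormula V) :
    (dot a b).size = ∑ i, ((a i).size + (b i).size) := by
  rw [dot, size_fold, List.map_ofFn, List.sum_ofFn]
  rfl

theorem toGF2_eval_dot {n : ℕ} (x : V → Bool) (a b : Fin n → BFormula V) :
    toGF2 ((dot a b).eval x) =
      (fun i => toGF2 ((a i).eval x)) ⬝ᵥ fun i => toGF2 ((b i).eval x) := by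
  rw [dot, toGF2_eval_fold_xor, List.map_ofFn, List.sum_ofFn]
  exact Finset.sum_congr rfl fun i _ => toGF2_and _ _

end BFormula

section ProbabilisticFormula

open BFormula

/-- The first matrix encoded by an assignment. -/
def leftMatrix {n : ℕ} (x : MPVar n → Bool) : Matrix (Fin n) (Fin n) (ZMod 2) :=
  Matrix.of fun i j => toGF2 (x (Sum.inl (i, j)))

/-- The second matrix encoded by an assignment. -/
def rightMatrix {n : ℕ} (x : MPVar n → Bool) : Matrix (Fin n) (Fin n) (ZMod 2) :=
  Matrix.of fun i j => toGF2 (x (Sum.inr (i, j)))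

theorem MPholds_iff {n : ℕ} (x : MPVar n → Bool) :
    MPholds n x ↔ leftMatrix x * rightMatrix x ≠ 0 := Iff.rfl

/-- The formula `uᵀ A B v` for the matrices `A`, `B` with entries `z` and vectors `u`, `v`. -/
def bilinFormula {V : Type} {n : ℕ} (z : MPVar n → V) (u v : Fin n → V) : BFormula V :=
  dot (fun k => dot (fun i => var (u i)) fun i => var (z (Sum.inl (i, k))))
    fun k => dot (fun j => var (z (Sum.inr (k, j)))) fun j => var (v j)

theorem size_bilinFormula {V : Type} {n : ℕ} (z : MPVar n → V) (u v : Fin n → V) :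
    (bilinFormula z u v).size = 4 * n ^ 2 := by
  simp [bilinFormula, size_dot, size]
  ring

theorem toGF2_eval_bilinFormula {V : Type} {n : ℕ} (x : V → Bool) (z : MPVar n → V)
    (u v : Fin n → V) :
    toGF2 ((bilinFormula z u v).eval x) = (fun i => toGF2 (x (u i))) ⬝ᵥ
      (leftMatrix (fun w => x (z w)) * rightMatrix (fun w => x (z w))).mulVec
        fun i => toGF2 (x (v i)) := by
  rw [bilinFormula, toGF2_eval_dot, ← Matrix.mulVec_mulVec, Matrix.dotProduct_mulVec]
  congr 1
  · funext k
    rw [toGF2_eval_dot]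
    rfl
  · funext k
    rw [toGF2_eval_dot]
    rfl

/-- Seven repetitions of the random bilinear test, with the random vectors of the repetition `t`
read off the variables `r (t, ·)`. -/
def testFormula {V : Type} {n : ℕ} (z : MPVar n → V) (r : Fin 7 × (Fin n ⊕ Fin n) → V) :
    BFormula V :=
  fold or false (List.ofFn fun t : Fin 7 =>
    bilinFormula z (fun i => r (t, Sum.inl i)) fun i => r (t, Sum.inr i))

theorem size_testFormula {V : Type} {n : ℕ} (z : MPVar n → V) (r : Fin 7 × (Fin n ⊕ Fin n) → V) :
    (testFormula z r).size = 28 * n ^ 2 := by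
  rw [testFormula, size_fold, List.map_ofFn, List.sum_ofFn]
  simp only [Function.comp_apply, size_bilinFormula]
  simp
  ring

/-- The random test errs on at most `(3/4)^7` of the random strings. -/
theorem card_testFormula_error_le {W : Type} {n m : ℕ} (z : MPVar n → W)
    (e : Fin 7 × (Fin n ⊕ Fin n) ≃ Fin m) (x : W → Bool) :
    4 ^ 7 * (Finset.univ.filter fun r : Fin m → Bool =>
      ¬ ((testFormula (V := W ⊕ Fin m) (fun w => Sum.inl (z w)) (fun i => Sum.inr (e i))).eval
        (Sum.elim x r) = true ↔ MPholds n fun w => x (z w))).card ≤ 3 ^ 7 * 2 ^ m := by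
  set M := leftMatrix (fun w => x (z w)) * rightMatrix (fun w => x (z w)) with hM
  have hm : m = 14 * n := by
    have := Fintype.card_congr e
    simp at this
    omega
  let φ : (Fin m → Bool) → Fin 7 → (Fin n → ZMod 2) × (Fin n → ZMod 2) := fun r t =>
    (fun i => toGF2 (r (e (t, Sum.inl i))), fun i => toGF2 (r (e (t, Sum.inr i))))
  have hφ : Function.Injective φ := by
    intro r s h
    funext a
    obtain ⟨⟨t, i⟩, rfl⟩ := e.surjective a
    have ht := congrFun h t
    rcases i with i | i
    · exact toGF2_injective (congrFun (congrArg Prod.fst ht) i)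
    · exact toGF2_injective (congrFun (congrArg Prod.snd ht) i)
  have heval (r : Fin m → Bool) :
      (testFormula (V := W ⊕ Fin m) (fun w => Sum.inl (z w)) (fun i => Sum.inr (e i))).eval
        (Sum.elim x r) = true ↔ ∃ t, (φ r t).1 ⬝ᵥ M.mulVec (φ r t).2 ≠ 0 := by
    have hbit (b : Bool) : b = true ↔ toGF2 b ≠ 0 := by revert b; decide
    rw [testFormula, eval_fold_or]
    simp only [List.mem_ofFn, exists_exists_eq_and]
    refine exists_congr fun t => ?_
    rw [hbit, toGF2_eval_bilinFormula]
    rfl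
  by_cases h0 : M = 0
  · rw [Finset.filter_false_of_mem]
    · simp
    · intro r _
      rw [heval, MPholds_iff, ← hM, h0]
      simp
  · set S := Finset.univ.filter fun p : (Fin n → ZMod 2) × (Fin n → ZMod 2) =>
      p.1 ⬝ᵥ M.mulVec p.2 = 0
    have hS : 4 * S.card ≤ 3 * 4 ^ n := four_mul_card_bilin_zero_le M h0
    have hle : (Finset.univ.filter fun r : Fin m → Bool =>
        ¬ ((testFormula (V := W ⊕ Fin m) (fun w => Sum.inl (z w)) (fun i => Sum.inr (e i))).eval
          (Sum.elim x r) = true ↔ MPholds n fun w => x (z w))).card ≤ S.card ^ 7 := by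
      have : (Fintype.piFinset fun _ : Fin 7 => S).card = S.card ^ 7 := by simp
      rw [← this]
      refine Finset.card_le_card_of_injOn φ ?_ hφ.injOn
      intro r hr
      have hr := (Finset.mem_filter.1 hr).2
      rw [heval, MPholds_iff, ← hM] at hr
      simp only [Finset.mem_coe, Fintype.mem_piFinset, S, Finset.mem_filter, Finset.mem_univ,
        true_and]
      by_contra! h
      exact hr (iff_of_true h h0)
    calc _ ≤ 4 ^ 7 * S.card ^ 7 := Nat.mul_le_mul_left _ hle
      _ = (4 * S.card) ^ 7 := (mul_pow _ _ _).symm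
      _ ≤ (3 * 4 ^ n) ^ 7 := Nat.pow_le_pow_left hS 7
      _ = 3 ^ 7 * 2 ^ m := by
        rw [mul_pow, hm, ← pow_mul, show 4 = 2 ^ 2 by rfl, ← pow_mul]
        congr 2
        ring

theorem exists_fair_probabilistic_formula (n : ℕ) (hn : 1 ≤ n) :
    ∃ m : ℕ, m ≤ 56 * n ^ 2 ∧
      ∃ F : BFormula ((MPVar n ⊕ MPVar n) ⊕ Fin m),
        F.size ≤ 56 * n ^ 2 ∧
        ∀ x : (MPVar n ⊕ MPVar n) → Bool,
          2 * 2 ^ m ≤ 3 * (Finset.univ.filter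
            (fun r : Fin m → Bool =>
              ((F.eval (Sum.elim x r) = true) ↔ MPXO n x))).card := by
  let e := Fintype.equivFin (Fin 7 × (Fin n ⊕ Fin n))
  let T (z : MPVar n → MPVar n ⊕ MPVar n) :
      BFormula ((MPVar n ⊕ MPVar n) ⊕ Fin (Fintype.card (Fin 7 × (Fin n ⊕ Fin n)))) :=
    testFormula (fun w => Sum.inl (z w)) (fun i => Sum.inr (e i))
  refine ⟨_, ?_, node (fun a b => a == b) (T Sum.inl) (T Sum.inr), ?_, fun x => ?_⟩
  · simp
    nlinarith
  · simp only [size, T, size_testFormula]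
    omega
  · have hl := card_testFormula_error_le Sum.inl e x
    have hr := card_testFormula_error_le Sum.inr e x
    have hsub := (Finset.card_le_card (s := Finset.univ.filter fun r =>
        ¬ ((node (fun a b => a == b) (T Sum.inl) (T Sum.inr)).eval (Sum.elim x r) = true ↔
          MPXO n x)) (t := (Finset.univ.filter fun r =>
        ¬ ((T Sum.inl).eval (Sum.elim x r) = true ↔ MPholds n fun w => x (Sum.inl w))) ∪
        (Finset.univ.filter fun r =>
        ¬ ((T Sum.inr).eval (Sum.elim x r) = true ↔ MPholds n fun w => x (Sum.inr w)))) (by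
      intro r hr
      simp only [Finset.mem_union, Finset.mem_filter, Finset.mem_univ, true_and] at hr ⊢
      by_contra! h
      apply hr
      simp only [eval, MPXO, ← h.1, ← h.2]
      exact beq_iff_eq.trans Bool.eq_iff_iff)).trans
      (Finset.card_union_le _ _)
    have htot := Finset.card_filter_add_card_filter_not
      (s := (Finset.univ : Finset (Fin (Fintype.card (Fin 7 × (Fin n ⊕ Fin n))) → Bool)))
      (fun r => (node (fun a b => a == b) (T Sum.inl) (T Sum.inr)).eval (Sum.elim x r) = true ↔
          MPXO n x)
    rw [Finset.card_univ, Fintype.card_fun, Fintype.card_bool, Fintype.card_fin] at htot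
    simp only [T] at *
    omega

end ProbabilisticFormula

/-- The number of leaves labeled by variables satisfying `P`. -/
def BFormula.leafCount {V : Type} (P : V → Prop) [DecidablePred P] : BFormula V → ℕ
  | var v => if P v then 1 else 0
  | const _ => 0
  | node _ l r => leafCount P l + leafCount P r

section LowerBound

open BFormula

theorem sum_leafCount_le_size {V ι : Type} [Fintype ι] [DecidableEq ι] (c : V → Option ι)
    (F : BFormula V) : ∑ j, F.leafCount (fun v => c v = some j) ≤ F.size := by
  induction F with
  | var v =>
    simp only [leafCount, size]
    rw [← Finset.card_filter, Finset.card_le_one]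
    intro a ha b hb
    exact Option.some_injective _ ((Finset.mem_filter.1 ha).2.symm.trans (Finset.mem_filter.1 hb).2)
  | const b => simp [leafCount, size]
  | node g l r hl hr =>
    simp only [leafCount, size, Finset.sum_add_distrib]
    omega

section Restriction

variable {V X Y : Type} (P : V → Prop) [DecidablePred P] (e : X → Y → V → Bool)

theorem eval_eq_of_leafCount_eq_zero (hY : ∀ v, ¬ P v → ∀ x y y', e x y v = e x y' v)
    (F : BFormula V) (hF : F.leafCount P = 0) (x : X) (y y' : Y) :
    F.eval (e x y) = F.eval (e x y') := by
  induction F with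
  | var v => exact hY v (by simpa [leafCount] using hF) x y y'
  | const b => rfl
  | node g l r hl hr =>
    simp only [leafCount, Nat.add_eq_zero_iff] at hF
    simp only [eval, hl hF.1, hr hF.2]

variable [Nonempty Y] [Nonempty X]

/-- Nechiporuk's count of the restrictions of a formula, up to composition with unary gates. -/
theorem exists_finset_restrictions_of_leafCount_ne_zero
    (hX : ∀ v, P v → ∀ x x' y, e x y v = e x' y v)
    (hY : ∀ v, ¬ P v → ∀ x y y', e x y v = e x y' v)
    (F : BFormula V) (hF : F.leafCount P ≠ 0) :
    ∃ S : Finset (Y → Bool),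
      (∀ (h : Bool → Bool) x, (fun y => h (F.eval (e x y))) ∈ S) ∧
      4 * S.card ≤ 16 ^ F.leafCount P := by
  classical
  obtain ⟨y₀⟩ := ‹Nonempty Y›
  obtain ⟨x₀⟩ := ‹Nonempty X›
  induction F with
  | var v =>
    have hv : P v := by by_contra hv; simp [leafCount, hv] at hF
    refine ⟨Finset.univ.image fun (h : Bool → Bool) y => h (e x₀ y v), fun h x => ?_, ?_⟩
    · refine Finset.mem_image.2 ⟨h, Finset.mem_univ _, funext fun y => ?_⟩
      rw [eval, hX v hv x₀ x]
    · have : (Finset.univ.image fun (h : Bool → Bool) (y : Y) => h (e x₀ y v)).card ≤ 4 :=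
        Finset.card_image_le
      simp only [leafCount, hv, if_true]
      omega
  | const b => simp [leafCount] at hF
  | node g l r hl hr =>
    by_cases l0 : l.leafCount P = 0
    · have r0 : r.leafCount P ≠ 0 := by simpa [leafCount, l0] using hF
      obtain ⟨S, hS, hc⟩ := hr r0
      refine ⟨S, fun h x => ?_, by simpa [leafCount, l0] using hc⟩
      convert hS (fun b => h (g (l.eval (e x y₀)) b)) x using 2 with y
      rw [eval, eval_eq_of_leafCount_eq_zero P e hY l l0 x y y₀]
    by_cases r0 : r.leafCount P = 0
    · obtain ⟨S, hS, hc⟩ := hl l0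
      refine ⟨S, fun h x => ?_, by simpa [leafCount, r0] using hc⟩
      convert hS (fun b => h (g b (r.eval (e x y₀)))) x using 2 with y
      rw [eval, eval_eq_of_leafCount_eq_zero P e hY r r0 x y y₀]
    obtain ⟨S, hS, hSc⟩ := hl l0
    obtain ⟨T, hT, hTc⟩ := hr r0
    refine ⟨((Finset.univ : Finset (Bool → Bool)) ×ˢ S ×ˢ T).image
      fun p y => p.1 (g (p.2.1 y) (p.2.2 y)), fun h x => ?_, ?_⟩
    · exact Finset.mem_image.2 ⟨(h, fun y => l.eval (e x y), fun y => r.eval (e x y)),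
        by simpa using ⟨hS id x, hT id x⟩, rfl⟩
    · have hcard : (((Finset.univ : Finset (Bool → Bool)) ×ˢ S ×ˢ T).image
          fun p y => p.1 (g (p.2.1 y) (p.2.2 y))).card ≤ 4 * (S.card * T.card) :=
        Finset.card_image_le.trans (by simp)
      calc _ ≤ 4 * (4 * (S.card * T.card)) := Nat.mul_le_mul_left _ hcard
        _ = (4 * S.card) * (4 * T.card) := by ring
        _ ≤ 16 ^ l.leafCount P * 16 ^ r.leafCount P := Nat.mul_le_mul hSc hTc
        _ = _ := by rw [leafCount, pow_add]

theorem exists_finset_restrictions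
    (hX : ∀ v, P v → ∀ x x' y, e x y v = e x' y v)
    (hY : ∀ v, ¬ P v → ∀ x y y', e x y v = e x y' v) (F : BFormula V) :
    ∃ S : Finset (Y → Bool), (∀ x, (fun y => F.eval (e x y)) ∈ S) ∧
      S.card ≤ 2 * 16 ^ F.leafCount P := by
  classical
  by_cases hF : F.leafCount P = 0
  · obtain ⟨y₀⟩ := ‹Nonempty Y›
    refine ⟨Finset.univ.image fun (b : Bool) (_ : Y) => b, fun x => ?_, ?_⟩
    · exact Finset.mem_image.2 ⟨F.eval (e x y₀), Finset.mem_univ _,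
        funext fun y => eval_eq_of_leafCount_eq_zero P e hY F hF x y₀ y⟩
    · exact Finset.card_image_le.trans (by simp [hF])
  · obtain ⟨S, hS, hc⟩ := exists_finset_restrictions_of_leafCount_ne_zero P e hX hY F hF
    exact ⟨S, fun x => hS id x, by omega⟩

end Restriction

/-- A set of vectors and the set of vectors orthogonal to it have at most `2^k` pairs. -/
theorem card_mul_card_orthogonal_le {k : ℕ} (A : Finset (Fin k → ZMod 2)) :
    A.card * (Finset.univ.filter fun y : Fin k → ZMod 2 => ∀ u ∈ A, y ⬝ᵥ u = 0).card ≤ 2 ^ k := by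
  classical
  let E := dotProductEquiv (ZMod 2) (Fin k)
  let U : Submodule (ZMod 2) (Fin k → ZMod 2) := Submodule.span _ (A : Set (Fin k → ZMod 2))
  have hA : A.card ≤ 2 ^ Module.finrank (ZMod 2) U := by
    have h := Module.natCard_eq_pow_finrank (K := ZMod 2) (V := U)
    rw [Nat.card_zmod] at h
    rw [← h, ← Set.ncard_coe_finset, ← SetLike.coe_sort_coe, Nat.card_coe_set_eq]
    exact Set.ncard_le_ncard Submodule.subset_span (Set.toFinite _)
  have hO : (Finset.univ.filter fun y : Fin k → ZMod 2 => ∀ u ∈ A, y ⬝ᵥ u = 0).card ≤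
      2 ^ Module.finrank (ZMod 2) U.dualAnnihilator := by
    have h := Module.natCard_eq_pow_finrank (K := ZMod 2) (V := U.dualAnnihilator)
    rw [Nat.card_zmod] at h
    rw [← h, ← Set.ncard_coe_finset, ← SetLike.coe_sort_coe, Nat.card_coe_set_eq]
    have : Finite (Module.Dual (ZMod 2) (Fin k → ZMod 2)) := Finite.of_equiv _ E.toEquiv
    refine Set.ncard_le_ncard_of_injOn E ?_ E.injective.injOn (Set.toFinite _)
    intro y hy
    have hy : ∀ u ∈ A, y ⬝ᵥ u = 0 := by simpa using hy
    refine (Submodule.mem_dualAnnihilator _).2 fun u hu => ?_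
    have hle : U ≤ LinearMap.ker (E y) := Submodule.span_le.2 hy
    exact hle hu
  have hfin := Subspace.finrank_add_finrank_dualAnnihilator_eq U
  rw [Module.finrank_fin_fun] at hfin
  calc _ ≤ _ := Nat.mul_le_mul hA hO
    _ = 2 ^ k := by rw [← pow_add, hfin]

theorem card_matrix_zmod_two (k : ℕ) :
    Fintype.card (Matrix (Fin k) (Fin k) (ZMod 2)) = 2 ^ (k * k) := by
  rw [← Fintype.card_congr (Matrix.of (m := Fin k) (n := Fin k) (α := ZMod 2))]
  simp [ZMod.card, pow_mul]

/-- Few matrices vanish on more than an eighth of all vectors. -/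
theorem card_matrices_vanishing_le {k : ℕ} (A : Finset (Fin k → ZMod 2)) (hA : 2 ^ k < 8 * A.card) :
    (Finset.univ.filter fun M : Matrix (Fin k) (Fin k) (ZMod 2) =>
      ∀ u ∈ A, M.mulVec u = 0).card ≤ 8 ^ k := by
  set O := Finset.univ.filter fun y : Fin k → ZMod 2 => ∀ u ∈ A, y ⬝ᵥ u = 0
  have hO : O.card ≤ 8 := by
    have : A.card * O.card ≤ 2 ^ k := card_mul_card_orthogonal_le A
    by_contra! h
    nlinarith
  calc _ ≤ (Fintype.piFinset fun _ : Fin k => O).card := by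
        refine Finset.card_le_card_of_injOn (fun M i => M i) ?_ (fun _ _ _ _ h => h)
        intro M hM
        have hM := (Finset.mem_filter.1 hM).2
        simp only [Finset.mem_coe, Fintype.mem_piFinset, O, Finset.mem_filter, Finset.mem_univ,
          true_and]
        exact fun i u hu => congrFun (hM u hu) i
    _ = O.card ^ k := by simp
    _ ≤ 8 ^ k := Nat.pow_le_pow_left hO k

/-- The one-way communication bound: a protocol with few messages `acc M` that accepts `(M, (u, w))`
only if `M u + w = 0` accepts only few of the pairs `(M, (u, -M u))`. -/
theorem card_accepted_le {k : ℕ}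
    (acc : Matrix (Fin k) (Fin k) (ZMod 2) → (Fin k → ZMod 2) × (Fin k → ZMod 2) → Bool)
    (S : Finset ((Fin k → ZMod 2) × (Fin k → ZMod 2) → Bool)) (hS : ∀ M, acc M ∈ S)
    (hacc : ∀ M p, acc M p = true → M.mulVec p.1 + p.2 = 0) :
    8 * (Finset.univ.filter
      fun p : Matrix (Fin k) (Fin k) (ZMod 2) × (Fin k → ZMod 2) =>
        acc p.1 (p.2, -p.1.mulVec p.2) = true).card ≤
      2 ^ (k * k) * 2 ^ k + 8 * (8 ^ k * S.card * 2 ^ k) := by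
  let A (M : Matrix (Fin k) (Fin k) (ZMod 2)) : Finset (Fin k → ZMod 2) :=
    Finset.univ.filter fun u => acc M (u, -M.mulVec u) = true
  let H := Finset.univ.filter fun M : Matrix (Fin k) (Fin k) (ZMod 2) => 2 ^ k < 8 * (A M).card
  have hH : H.card ≤ 8 ^ k * S.card := by
    refine Finset.card_le_mul_card_image_of_maps_to (f := acc) (fun M _ => hS M) _ fun b _ => ?_
    rcases (H.filter fun M => acc M = b).eq_empty_or_nonempty with h | ⟨M₀, hM₀⟩
    · simp [h]
    · rw [Finset.mem_filter, Finset.mem_filter] at hM₀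
      refine le_trans ?_ (card_matrices_vanishing_le (A M₀) hM₀.1.2)
      refine Finset.card_le_card_of_injOn (· - M₀) ?_ (fun _ _ _ _ h => sub_left_injective h)
      intro M hM
      simp only [Finset.coe_filter, Set.mem_ofPred_eq, Finset.mem_univ, true_and] at hM ⊢
      intro u hu
      have hu : acc M₀ (u, -M₀.mulVec u) = true := (Finset.mem_filter.1 hu).2
      rw [hM₀.2, ← hM.2] at hu
      rw [Matrix.sub_mulVec, sub_eq_add_neg]
      exact hacc _ _ hu
  have hU : Fintype.card (Fin k → ZMod 2) = 2 ^ k := by simp [ZMod.card]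
  have hbound (M : Matrix (Fin k) (Fin k) (ZMod 2)) :
      8 * (A M).card ≤ 2 ^ k + 8 * 2 ^ k * if 2 ^ k < 8 * (A M).card then 1 else 0 := by
    split_ifs with h
    · have := (A M).card_le_univ
      rw [hU] at this
      omega
    · omega
  have hsum : (Finset.univ.filter
      fun p : Matrix (Fin k) (Fin k) (ZMod 2) × (Fin k → ZMod 2) =>
        acc p.1 (p.2, -p.1.mulVec p.2) = true).card = ∑ M, (A M).card := by
    simp only [A, Finset.card_filter]
    rw [Fintype.sum_prod_type]
  calc _ = ∑ M, 8 * (A M).card := by rw [hsum, Finset.mul_sum]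
    _ ≤ ∑ M, (2 ^ k + 8 * 2 ^ k * if 2 ^ k < 8 * (A M).card then 1 else 0) :=
      Finset.sum_le_sum fun M _ => hbound M
    _ = 2 ^ (k * k) * 2 ^ k + 8 * 2 ^ k * H.card := by
      rw [Finset.sum_add_distrib, ← Finset.mul_sum, ← Finset.card_filter, Finset.sum_const,
        Finset.card_univ, card_matrix_zmod_two, smul_eq_mul]
    _ ≤ _ := by nlinarith [Nat.mul_le_mul_left (8 * 2 ^ k) hH]

/-- The assignment encoding two matrices in the first half, and zero matrices in the second. -/
def encodePair {n : ℕ} (A B : Matrix (Fin n) (Fin n) (ZMod 2)) : MPVar n ⊕ MPVar n → Bool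
  | Sum.inl (Sum.inl (i, j)) => decide (A i j ≠ 0)
  | Sum.inl (Sum.inr (i, j)) => decide (B i j ≠ 0)
  | Sum.inr _ => false

theorem MPXO_encodePair {n : ℕ} (A B : Matrix (Fin n) (Fin n) (ZMod 2)) :
    MPXO n (encodePair A B) ↔ A * B = 0 := by
  have h (a : ZMod 2) : (if decide (a ≠ 0) = true then (1 : ZMod 2) else 0) = a := by
    revert a; decide
  have hA : (Matrix.of fun i j => if encodePair A B (Sum.inl (Sum.inl (i, j))) then (1 : ZMod 2)
    else 0) = A := Matrix.ext fun i j => h (A i j)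
  have hB : (Matrix.of fun i j => if encodePair A B (Sum.inl (Sum.inr (i, j))) then (1 : ZMod 2)
    else 0) = B := Matrix.ext fun i j => h (B i j)
  have h0 : ¬ MPholds n fun v => encodePair A B (Sum.inr v) := by
    rw [MPholds, not_not]
    ext i j
    simp [encodePair, Matrix.mul_apply]
  rw [MPXO, iff_false_right h0, MPholds, hA, hB, not_not]

/-- The matrix with block `[M I]` in the coordinates given by `σ`. -/
def kernelMatrix {n k r : ℕ} (σ : Fin n ≃ (Fin k ⊕ Fin k) ⊕ Fin r)
    (M : Matrix (Fin k) (Fin k) (ZMod 2)) : Matrix (Fin n) (Fin n) (ZMod 2) :=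
  (Matrix.fromBlocks (Matrix.fromBlocks M 1 0 0) 0 0 0).submatrix σ σ

/-- The matrix whose column `j` is `(u, w, 0)` in the coordinates given by `σ`. -/
def columnMatrix {n k r : ℕ} (σ : Fin n ≃ (Fin k ⊕ Fin k) ⊕ Fin r) (j : Fin n)
    (p : (Fin k → ZMod 2) × (Fin k → ZMod 2)) : Matrix (Fin n) (Fin n) (ZMod 2) :=
  Matrix.of fun i j' => if j' = j then Sum.elim (Sum.elim p.1 p.2) 0 (σ i) else 0

theorem kernelMatrix_mul_columnMatrix_eq_zero_iff {n k r : ℕ}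
    (σ : Fin n ≃ (Fin k ⊕ Fin k) ⊕ Fin r) (j : Fin n) (M : Matrix (Fin k) (Fin k) (ZMod 2))
    (p : (Fin k → ZMod 2) × (Fin k → ZMod 2)) :
    kernelMatrix σ M * columnMatrix σ j p = 0 ↔ M.mulVec p.1 + p.2 = 0 := by
  have h : ∀ i j', (kernelMatrix σ M * columnMatrix σ j p) i j' =
      if j' = j then (Sum.elim (Sum.elim (M.mulVec p.1 + p.2) 0) 0 : _ → ZMod 2) (σ i) else 0 := by
    intro i j'
    have hv : (Matrix.fromBlocks (Matrix.fromBlocks M 1 (0 : Matrix (Fin k) (Fin k) (ZMod 2)) 0) 0 0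
        (0 : Matrix (Fin r) (Fin r) (ZMod 2))).mulVec (Sum.elim (Sum.elim p.1 p.2) 0) =
        Sum.elim (Sum.elim (M.mulVec p.1 + p.2) 0) 0 := by
      simp [Matrix.fromBlocks_mulVec, Function.comp_def]
    rw [← hv]
    split_ifs with hj
    · simp only [Matrix.mul_apply, kernelMatrix, columnMatrix, Matrix.of_apply, hj, if_true,
        Matrix.submatrix_apply]
      exact σ.sum_comp fun a => Matrix.fromBlocks (Matrix.fromBlocks M 1 0 0) 0 0
        (0 : Matrix (Fin r) (Fin r) (ZMod 2)) (σ i) a * Sum.elim (Sum.elim p.1 p.2) 0 a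
    · simp [Matrix.mul_apply, columnMatrix, hj]
  constructor
  · intro h0
    funext a
    have := h (σ.symm (Sum.inl (Sum.inl a))) j
    simpa [h0] using this.symm
  · intro h0
    ext i j'
    rw [h, h0]
    rcases σ i with (a | a) | a <;> simp

/-- The variables of column `j` of the second matrix are labeled by `j`. -/
def columnLabel {n : ℕ} : MPVar n ⊕ MPVar n → Option (Fin n)
  | Sum.inl (Sum.inr (_, j)) => some j
  | _ => none

/-- A one-sided formula with few leaves in column `j` accepts few of the hard inputs. -/
theorem card_accepted_encodePair_le {n k r : ℕ} (hk : 8 ≤ k)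
    (σ : Fin n ≃ (Fin k ⊕ Fin k) ⊕ Fin r) (j : Fin n) (F : BFormula (MPVar n ⊕ MPVar n))
    (hF : ∀ x, ¬ MPXO n x → F.eval x = false) :
    4 * k ^ 2 * (Finset.univ.filter
      fun p : Matrix (Fin k) (Fin k) (ZMod 2) × (Fin k → ZMod 2) =>
        F.eval (encodePair (kernelMatrix σ p.1)
          (columnMatrix σ j (p.2, -p.1.mulVec p.2))) = true).card ≤
      Fintype.card (Matrix (Fin k) (Fin k) (ZMod 2) × (Fin k → ZMod 2)) *
        (k ^ 2 + 32 * F.leafCount fun v => columnLabel v = some j) := by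
  set s := F.leafCount fun v => columnLabel v = some j
  set Z := Finset.univ.filter
      fun p : Matrix (Fin k) (Fin k) (ZMod 2) × (Fin k → ZMod 2) =>
        F.eval (encodePair (kernelMatrix σ p.1)
          (columnMatrix σ j (p.2, -p.1.mulVec p.2))) = true
  by_cases hs : k ^ 2 ≤ 8 * s
  · have := Z.card_le_univ
    nlinarith [Nat.mul_le_mul hs this]
  let e (M : Matrix (Fin k) (Fin k) (ZMod 2)) (p : (Fin k → ZMod 2) × (Fin k → ZMod 2)) :=
    encodePair (kernelMatrix σ M) (columnMatrix σ j p)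
  obtain ⟨S, hS, hSc⟩ := exists_finset_restrictions (fun v => columnLabel v = some j) e
    (by rintro ((⟨a, b⟩ | ⟨a, b⟩) | v) hv <;> simp_all [columnLabel, e, encodePair])
    (by rintro ((⟨a, b⟩ | ⟨a, b⟩) | v) hv <;>
          simp_all [columnLabel, e, encodePair, columnMatrix]) F
  have hacc := card_accepted_le (fun M p => F.eval (e M p)) S hS (by
    intro M p h
    rw [← kernelMatrix_mul_columnMatrix_eq_zero_iff σ j, ← MPXO_encodePair]
    by_contra hM
    rw [hF _ hM] at h
    exact Bool.false_ne_true h)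
  have hcard : Fintype.card (Matrix (Fin k) (Fin k) (ZMod 2) × (Fin k → ZMod 2)) =
      2 ^ (k * k) * 2 ^ k := by
    simp [card_matrix_zmod_two, ZMod.card]
  have hmsg : 8 * (8 ^ k * S.card) ≤ 2 ^ (k * k) := by
    calc _ ≤ 8 * (8 ^ k * (2 * 16 ^ s)) := by gcongr
      _ = 2 ^ (4 + 3 * k + 4 * s) := by
        rw [pow_add, pow_add, pow_mul, pow_mul]
        norm_num
        ring
      _ ≤ 2 ^ (k * k) := Nat.pow_le_pow_right (by norm_num) (by nlinarith)
  have h4 : 4 * Z.card ≤ 2 ^ (k * k) * 2 ^ k := by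
    have : 8 * Z.card ≤ 2 ^ (k * k) * 2 ^ k + 8 * (8 ^ k * S.card * 2 ^ k) := hacc
    nlinarith [Nat.mul_le_mul_right (2 ^ k) hmsg]
  rw [hcard]
  nlinarith [Nat.mul_le_mul_left (k ^ 2) h4]

/-- Averaging a counting bound for every formula in the support over a Monte Carlo formula. -/
theorem le_expectation_of_card_accepted_le {V Z : Type} [Fintype Z] [Nonempty Z]
    (p : PMF (BFormula V)) (x : Z → V → Bool) (s : BFormula V → ℕ) (t : ℕ)
    (hp : ∀ z, 1 / 2 ≤ ∑' F, (if F.eval (x z) = true then p F else 0))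
    (hs : ∀ F ∈ p.support, 4 * t * (Finset.univ.filter fun z => F.eval (x z) = true).card ≤
      Fintype.card Z * (t + 32 * s F)) :
    (t : ℝ≥0∞) ≤ 32 * ∑' F, p F * (s F : ℝ≥0∞) := by
  set N : ℝ≥0∞ := (Fintype.card Z : ℝ≥0∞) with hN
  have hN0 : N ≠ 0 := by simp [hN]
  have hNt : N ≠ ⊤ := ENNReal.natCast_ne_top _
  have h1 : N * (1 / 2) ≤ ∑' F, p F *
      ((Finset.univ.filter fun z => F.eval (x z) = true).card : ℝ≥0∞) := by
    calc N * (1 / 2) = ∑ _z : Z, (1 / 2 : ℝ≥0∞) := by simp [hN]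
      _ ≤ ∑ z, ∑' F, (if F.eval (x z) = true then p F else 0) := Finset.sum_le_sum fun z _ => hp z
      _ = ∑' F, ∑ z, (if F.eval (x z) = true then p F else 0) :=
        (Summable.tsum_finsetSum fun _ _ => ENNReal.summable).symm
      _ = _ := by
        refine tsum_congr fun F => ?_
        rw [← Finset.sum_filter, Finset.sum_const, nsmul_eq_mul, mul_comm]
  have h2 : 4 * t * ∑' F, p F *
      ((Finset.univ.filter fun z => F.eval (x z) = true).card : ℝ≥0∞) ≤
      N * (t + 32 * ∑' F, p F * (s F : ℝ≥0∞)) := by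
    calc _ = ∑' F, p F * ((4 * t *
          (Finset.univ.filter fun z => F.eval (x z) = true).card : ℕ) : ℝ≥0∞) := by
          rw [← ENNReal.tsum_mul_left]
          refine tsum_congr fun F => ?_
          push_cast
          ring
      _ ≤ ∑' F, p F * ((Fintype.card Z * (t + 32 * s F) : ℕ) : ℝ≥0∞) := by
          refine ENNReal.tsum_le_tsum fun F => ?_
          by_cases hF : F ∈ p.support
          · exact mul_le_mul_right (Nat.cast_le.2 (hs F hF)) _
          · rw [(p.apply_eq_zero_iff F).2 hF, zero_mul, zero_mul]
      _ = ∑' F, (N * t * p F + N * 32 * (p F * (s F : ℝ≥0∞))) := by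
          refine tsum_congr fun F => ?_
          push_cast
          ring
      _ = _ := by
          rw [ENNReal.tsum_add, ENNReal.tsum_mul_left, ENNReal.tsum_mul_left, p.tsum_coe]
          ring
  have h3 : N * (t + t) ≤ N * (t + 32 * ∑' F, p F * (s F : ℝ≥0∞)) := by
    refine le_trans (le_of_eq ?_) ((mul_le_mul_right h1 (4 * (t : ℝ≥0∞))).trans h2)
    rw [one_div, show (4 : ℝ≥0∞) = 2 * 2 by norm_num,
      show 2 * 2 * (t : ℝ≥0∞) * (N * 2⁻¹) = N * (2 * t) * (2 * 2⁻¹) by ring,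
      ENNReal.mul_inv_cancel (by simp) (by simp)]
    ring
  have h4 := (ENNReal.mul_le_mul_iff_right hN0 hNt).1 h3
  exact (ENNReal.add_le_add_iff_left (ENNReal.natCast_ne_top t)).1 h4

theorem eval_eq_of_size_eq_zero {V : Type} (F : BFormula V) (hF : F.size = 0) (x y : V → Bool) :
    F.eval x = F.eval y := by
  induction F with
  | var v => simp [size] at hF
  | const b => rfl
  | node g l r hl hr =>
    simp only [size, Nat.add_eq_zero_iff] at hF
    simp only [eval, hl hF.1, hr hF.2]

/-- A Monte Carlo formula for a nonconstant function has size at least `1/2`. -/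
theorem half_le_pmfSize {V : Type} (p : PMF (BFormula V)) (x y : V → Bool)
    (hx : ∀ F ∈ p.support, F.eval x = false)
    (hy : 1 / 2 ≤ ∑' F, (if F.eval y = true then p F else 0)) : 1 / 2 ≤ pmfSize p := by
  refine hy.trans (ENNReal.tsum_le_tsum fun F => ?_)
  split_ifs with h
  · by_cases hF : F ∈ p.support
    · have hs : F.size ≠ 0 := by
        intro hs
        rw [eval_eq_of_size_eq_zero F hs y x, hx F hF] at h
        exact Bool.false_ne_true h
      exact le_mul_of_one_le_right' (by exact_mod_cast Nat.one_le_iff_ne_zero.2 hs)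
    · rw [(p.apply_eq_zero_iff F).2 hF, zero_mul]
  · exact zero_le

theorem cube_le_pmfSize (n : ℕ) (hn : 1 ≤ n) (p : PMF (BFormula (MPVar n ⊕ MPVar n)))
    (h0 : ∀ x, ¬ MPXO n x → ∀ F ∈ p.support, F.eval x = false)
    (h1 : ∀ x, MPXO n x → 1 / 2 ≤ ∑' F, (if F.eval x = true then p F else 0)) :
    (n : ℝ≥0∞) ^ 3 ≤ 10000 * pmfSize p := by
  rcases lt_or_ge n 16 with hlt | hge
  · have hhalf : 1 / 2 ≤ pmfSize p := by
      refine half_le_pmfSize p (encodePair 1 1) (encodePair 0 0) (h0 _ ?_) (h1 _ ?_)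
      · have : Nonempty (Fin n) := ⟨⟨0, hn⟩⟩
        rw [MPXO_encodePair]
        simp
      · rw [MPXO_encodePair]
        simp
    have hn3 : (n : ℝ≥0∞) ^ 3 ≤ 5000 := by
      have : n ^ 3 ≤ 15 ^ 3 := Nat.pow_le_pow_left (by omega) 3
      exact_mod_cast this.trans (by norm_num)
    calc _ ≤ (5000 : ℝ≥0∞) := hn3
      _ = 10000 * (1 / 2) := by
        rw [one_div, show (10000 : ℝ≥0∞) = 5000 * 2 by norm_num, mul_assoc,
          ENNReal.mul_inv_cancel (by simp) (by simp), mul_one]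
      _ ≤ _ := mul_le_mul_right hhalf _
  · set k := n / 2 with hk
    have σ : Fin n ≃ (Fin k ⊕ Fin k) ⊕ Fin (n - 2 * k) := Fintype.equivOfCardEq (by simp; omega)
    have hcol (j : Fin n) : ((k ^ 2 : ℕ) : ℝ≥0∞) ≤
        32 * ∑' F, p F * ((F.leafCount fun v => columnLabel v = some j : ℕ) : ℝ≥0∞) := by
      refine le_expectation_of_card_accepted_le p
        (fun z : Matrix (Fin k) (Fin k) (ZMod 2) × (Fin k → ZMod 2) =>
          encodePair (kernelMatrix σ z.1) (columnMatrix σ j (z.2, -z.1.mulVec z.2))) _ _ ?_ ?_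
      · intro z
        refine h1 _ ((MPXO_encodePair _ _).2 ?_)
        rw [kernelMatrix_mul_columnMatrix_eq_zero_iff]
        simp
      · exact fun F hF =>
          card_accepted_encodePair_le (by omega) σ j F fun x hx => h0 x hx F hF
    have htot : (n : ℝ≥0∞) * ((k ^ 2 : ℕ) : ℝ≥0∞) ≤ 32 * pmfSize p := by
      calc _ = ∑ _j : Fin n, ((k ^ 2 : ℕ) : ℝ≥0∞) := by simp
        _ ≤ ∑ j : Fin n, 32 *
            ∑' F, p F * ((F.leafCount fun v => columnLabel v = some j : ℕ) : ℝ≥0∞) :=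
          Finset.sum_le_sum fun j _ => hcol j
        _ = 32 * ∑' F, p F *
            ((∑ j, F.leafCount fun v => columnLabel v = some j : ℕ) : ℝ≥0∞) := by
          rw [← Finset.mul_sum, ← Summable.tsum_finsetSum fun _ _ => ENNReal.summable]
          simp only [Nat.cast_sum, Finset.mul_sum]
        _ ≤ 32 * pmfSize p := by
          refine mul_le_mul_right (ENNReal.tsum_le_tsum fun F => mul_le_mul_right ?_ _) _
          exact_mod_cast sum_leafCount_le_size columnLabel F
    have hnk : n ^ 3 ≤ 9 * (n * k ^ 2) := by
      have : n ≤ 3 * k := by omega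
      nlinarith [Nat.mul_le_mul_left n (Nat.mul_le_mul this this)]
    calc (n : ℝ≥0∞) ^ 3 ≤ 9 * (n * ((k ^ 2 : ℕ) : ℝ≥0∞)) := by exact_mod_cast hnk
      _ ≤ 9 * (32 * pmfSize p) := mul_le_mul_right htot _
      _ = 288 * pmfSize p := by rw [← mul_assoc]; norm_num
      _ ≤ _ := mul_le_mul_left (by norm_num) _

end LowerBound

/-- (a) `g_n` has a fair probabilistic bounded-error formula of size `O(n²)`;
(b) every strong Monte Carlo formula for `g_n` has size at least `c·n³`. -/
theorem stmt7 :
    ∃ C : ℕ, 0 < C ∧ ∃ c : ℝ, 0 < c ∧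
      ∀ n : ℕ, 1 ≤ n →
        (∃ m : ℕ, m ≤ C * n ^ 2 ∧
          ∃ F : BFormula ((MPVar n ⊕ MPVar n) ⊕ Fin m),
            F.size ≤ C * n ^ 2 ∧
            ∀ x : (MPVar n ⊕ MPVar n) → Bool,
              2 * 2 ^ m ≤ 3 * (Finset.univ.filter
                (fun r : Fin m → Bool =>
                  ((F.eval (Sum.elim x r) = true) ↔ MPXO n x))).card) ∧
        (∀ p : PMF (BFormula (MPVar n ⊕ MPVar n)),
          (∀ x, ¬ MPXO n x → ∀ F ∈ p.support, F.eval x = false) →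
          (∀ x, MPXO n x → 1/2 ≤ ∑' F, (if F.eval x = true then p F else 0)) →
          ENNReal.ofReal (c * (n : ℝ) ^ 3) ≤ pmfSize p) := by
  refine ⟨56, by norm_num, 1 / 10000, by norm_num, fun n hn =>
    ⟨exists_fair_probabilistic_formula n hn, fun p h0 h1 => ?_⟩⟩
  have h := cube_le_pmfSize n hn p h0 h1
  rw [one_div, inv_mul_eq_div, ENNReal.ofReal_div_of_pos (by norm_num)]
  refine ENNReal.div_le_of_le_mul' ?_
  rw [ENNReal.ofReal_pow (Nat.cast_nonneg n), ENNReal.ofReal_natCast]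
  simpa using h
end

section
/- Let g : A × B → {0,1} be a total function on finite sets A and B, and let row(g) be the number of distinct functions among {g(a,·) : a ∈ A}. (a) Every exact quantum one-way protocol of cost m for g satisfies m ≥ log₂ row(g); moreover an exact quantum one-way protocol of cost ⌈log₂ row(g)⌉ exists, so the exact quantum one-way communication complexity of g equals ⌈log₂ row(g)⌉, which equals the deterministic one-way communication complexity D(g). (b) For every 0 ≤ ε < 1, every quantum Las Vegas one-way protocol of cost m for g with give-up probability ε satisfies m ≥ (1 − ε)·log₂ row(g). -/
open scoped ComplexOrder

/-- `ρ` is a density matrix: positive semidefinite with trace 1. -/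
def IsDensity {d : ℕ} (ρ : Matrix (Fin d) (Fin d) ℂ) : Prop :=
  ρ.PosSemidef ∧ ρ.trace = 1

/-- `E` is a POVM element: `E` and `I − E` are positive semidefinite. -/
def IsPOVMElem {d : ℕ} (E : Matrix (Fin d) (Fin d) ℂ) : Prop :=
  E.PosSemidef ∧ (1 - E).PosSemidef

/-- Acceptance probability `tr(E·ρ)` (a real number). -/
noncomputable def accProb {d : ℕ} (E ρ : Matrix (Fin d) (Fin d) ℂ) : ℝ :=
  (E * ρ).trace.re

/-- The binary entropy function `H(ε) = −ε·log₂ ε − (1−ε)·log₂(1−ε)`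
(with `H(0) = 0`, automatic since `Real.logb 2 0 = 0`). -/
noncomputable def binEnt (e : ℝ) : ℝ :=
  -(e * Real.logb 2 e) - (1 - e) * Real.logb 2 (1 - e)

/-- `(ρ, E)` is a quantum one-way protocol of cost `m` computing `g` with error
`ε`: Alice sends the `m`-qubit state `ρ a`, Bob measures with the POVM element
`E b`, accepting with probability `tr(E b · ρ a)`. -/
def QOneWay {A B : Type} (g : A → B → Bool) (m : ℕ) (ε : ℝ)
    (ρ : A → Matrix (Fin (2 ^ m)) (Fin (2 ^ m)) ℂ)
    (E : B → Matrix (Fin (2 ^ m)) (Fin (2 ^ m)) ℂ) : Prop :=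
  (∀ a, IsDensity (ρ a)) ∧ (∀ b, IsPOVMElem (E b)) ∧
  ∀ a b, if g a b then 1 - ε ≤ accProb (E b) (ρ a) else accProb (E b) (ρ a) ≤ ε
/-- Number of distinct rows of the communication matrix of `g`. -/
noncomputable def rowCount {A B : Type} [Fintype A] [Fintype B] (g : A → B → Bool) : ℕ :=
  (Finset.univ.image (fun a : A => g a)).card

/-- Deterministic one-way communication complexity. -/
noncomputable def Dcc {A B : Type} (g : A → B → Bool) : ℕ :=
  sInf {c : ℕ | ∃ M : A → Fin (2 ^ c), ∃ o : Fin (2 ^ c) → B → Bool, ∀ a b, o (M a) b = g a b}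

/-- `(ρ, E)` is an exact quantum one-way protocol of cost `m` for `g`. -/
def QExact {A B : Type} (g : A → B → Bool) (m : ℕ)
    (ρ : A → Matrix (Fin (2 ^ m)) (Fin (2 ^ m)) ℂ)
    (E : B → Matrix (Fin (2 ^ m)) (Fin (2 ^ m)) ℂ) : Prop :=
  (∀ a, IsDensity (ρ a)) ∧ (∀ b, IsPOVMElem (E b)) ∧
  ∀ a b, (E b * ρ a).trace = if g a b then 1 else 0

/-- `(ρ, E0, E1, Eg)` is a quantum Las Vegas one-way protocol of cost `m` for `g`
with give-up probability `ε`: the wrong answer has probability 0 and the give-up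
outcome probability at most `ε`. -/
def QLasVegas {A B : Type} (g : A → B → Bool) (m : ℕ) (ε : ℝ)
    (ρ : A → Matrix (Fin (2 ^ m)) (Fin (2 ^ m)) ℂ)
    (E0 E1 Eg : B → Matrix (Fin (2 ^ m)) (Fin (2 ^ m)) ℂ) : Prop :=
  (∀ a, IsDensity (ρ a)) ∧
  (∀ b, (E0 b).PosSemidef ∧ (E1 b).PosSemidef ∧ (Eg b).PosSemidef ∧
    E0 b + E1 b + Eg b = 1) ∧
  ∀ a b, ((if g a b then E0 b else E1 b) * ρ a).trace = 0 ∧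
    ((Eg b * ρ a).trace.re ≤ ε)


section MatrixLog

open scoped MatrixOrder Matrix.Norms.L2Operator Matrix

variable {n : Type} [Fintype n] [DecidableEq n]

lemma re_trace_mul_nonneg {X Y : Matrix n n ℂ} (hX : 0 ≤ X) (hY : 0 ≤ Y) :
    0 ≤ (X * Y).trace.re := by
  have h := (Matrix.nonneg_iff_posSemidef.1 hX).conjTranspose_mul_mul_same (CFC.sqrt Y)
  have hs : (CFC.sqrt Y)ᴴ = CFC.sqrt Y := (Matrix.nonneg_iff_posSemidef.1 (CFC.sqrt_nonneg Y)).isHermitian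
  have h2 := h.trace_nonneg
  rw [hs, Matrix.trace_mul_comm, ← mul_assoc, CFC.sqrt_mul_sqrt_self Y hY,
    Matrix.trace_mul_comm] at h2
  exact (Complex.le_def.1 h2).1

lemma re_trace_mul_le {X Y Z : Matrix n n ℂ} (hX : 0 ≤ X) (h : Y ≤ Z) :
    (X * Y).trace.re ≤ (X * Z).trace.re := by
  have := re_trace_mul_nonneg hX (sub_nonneg.2 h)
  rw [mul_sub, Matrix.trace_sub, Complex.sub_re] at this
  linarith

lemma exp_diagonal_log {w : n → ℝ} (hw : ∀ i, 0 < w i) :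
    NormedSpace.exp (Matrix.diagonal fun i => ((Real.log (w i) : ℝ) : ℂ)) =
      Matrix.diagonal fun i => (w i : ℂ) := by
  rw [Matrix.exp_diagonal]
  congr 1
  ext i
  rw [Pi.coe_exp, ← Complex.exp_eq_exp_ℂ, ← Complex.ofReal_exp, Real.exp_log (hw i)]

lemma log_diagonal_mul {X : Matrix n n ℂ} (hX : IsStrictlyPositive X) {w : n → ℝ}
    (hw : ∀ i, 0 < w i) (hc : Commute X (Matrix.diagonal fun i => ((Real.log (w i) : ℝ) : ℂ))) :
    CFC.log (Matrix.diagonal (fun i => (w i : ℂ)) * X) =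
      CFC.log X + Matrix.diagonal fun i => ((Real.log (w i) : ℝ) : ℂ) := by
  have hc' : Commute (CFC.log X) (Matrix.diagonal fun i => ((Real.log (w i) : ℝ) : ℂ)) :=
    hc.cfc_real _
  have hsa : IsSelfAdjoint (Matrix.diagonal fun i => ((Real.log (w i) : ℝ) : ℂ)) := by
    rw [IsSelfAdjoint, Matrix.star_eq_conjTranspose, Matrix.diagonal_conjTranspose]
    congr 1
    ext i
    simp
  rw [← CFC.log_exp (CFC.log X + Matrix.diagonal fun i => ((Real.log (w i) : ℝ) : ℂ))
    (IsSelfAdjoint.log.add hsa), add_comm, Matrix.exp_add_of_commute _ _ hc'.symm,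
    exp_diagonal_log hw, CFC.exp_log X hX]

lemma log_conj_involution {X U : Matrix n n ℂ} (hX : IsStrictlyPositive X) (hU : U * U = 1)
    (hUs : Uᴴ = U) : CFC.log (U * X * U) = U * CFC.log X * U := by
  let u : (Matrix n n ℂ)ˣ := ⟨U, U, hU, hU⟩
  have hsa : IsSelfAdjoint (U * CFC.log X * U) := by
    have h : IsSelfAdjoint (CFC.log X) := IsSelfAdjoint.log
    simpa [Matrix.star_eq_conjTranspose, hUs] using h.conjugate U
  have h := Matrix.exp_units_conj u (CFC.log X)
  rw [CFC.exp_log X hX] at h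
  rw [← CFC.log_exp (U * CFC.log X * U) hsa]
  exact congrArg CFC.log h.symm

lemma isStrictlyPositive_add_smul_one {X : Matrix n n ℂ} (hX : 0 ≤ X) {δ : ℝ} (hδ : 0 < δ) :
    IsStrictlyPositive (X + δ • (1 : Matrix n n ℂ)) := by
  rw [Matrix.isStrictlyPositive_iff_posDef]
  exact Matrix.PosDef.posSemidef_add (Matrix.nonneg_iff_posSemidef.1 hX) (Matrix.PosDef.one.smul hδ)

lemma commute_diagonal_of_support {X : Matrix n n ℂ} {v : n → ℂ}
    (h : ∀ i j, X i j ≠ 0 → v i = v j) : Commute X (Matrix.diagonal v) := by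
  ext i j
  rw [Matrix.mul_diagonal, Matrix.diagonal_mul]
  by_cases hx : X i j = 0
  · simp [hx]
  · rw [h i j hx, mul_comm]

lemma le_diagonal_mul {X : Matrix n n ℂ} (hX : 0 ≤ X) {w : n → ℝ} (hw : ∀ i, 1 ≤ w i)
    (h : ∀ i j, X i j ≠ 0 → w i = w j) : X ≤ Matrix.diagonal (fun i => (w i : ℂ)) * X := by
  have h1 : (0 : Matrix n n ℂ) ≤ Matrix.diagonal fun i => ((w i : ℂ) - 1) := by
    refine (Matrix.PosSemidef.diagonal fun i => ?_).nonneg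
    have := hw i
    rw [Pi.zero_apply, sub_nonneg]
    rw [← Complex.ofReal_one, Complex.real_le_real]
    exact this
  have h2 : Commute (Matrix.diagonal fun i => ((w i : ℂ) - 1)) X :=
    (commute_diagonal_of_support fun i j hij => by rw [h i j hij]).symm
  have h3 := Commute.mul_nonneg h1 hX h2
  rw [← sub_nonneg]
  convert h3 using 1
  ext i j
  simp [Matrix.diagonal_mul, sub_mul]

/-- Pinching a positive matrix `A + M` by a diagonal symmetry `U` that fixes `A` changes
`tr X log (X + δ)` by at most `∑ Mᵢᵢ log wᵢ`, if the pinching `N` of `M` satisfies `M ≤ w N`. -/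
lemma re_trace_mul_log_le_of_pinching {A M N U : Matrix n n ℂ} (hA : 0 ≤ A) (hM : 0 ≤ M)
    (hU : U * U = 1) (hUs : Uᴴ = U) (hAU : U * A * U = A)
    (hN : N = (2⁻¹ : ℝ) • (M + U * M * U)) {w : n → ℝ} (hw : ∀ i, 1 ≤ w i)
    (hAw : ∀ i j, A i j ≠ 0 → w i = w j) (hNw : ∀ i j, N i j ≠ 0 → w i = w j)
    (hMN : M ≤ Matrix.diagonal (fun i => (w i : ℂ)) * N) {δ : ℝ} (hδ : 0 < δ) :
    ((A + M) * CFC.log (A + M + δ • (1 : Matrix n n ℂ))).trace.re ≤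
      ((A + N) * CFC.log (A + N + δ • (1 : Matrix n n ℂ))).trace.re +
        ∑ i, (M i i).re * Real.log (w i) := by
  have hUMU : 0 ≤ U * M * U := by
    have := (Matrix.nonneg_iff_posSemidef.1 hM).conjTranspose_mul_mul_same U
    rw [hUs] at this
    exact this.nonneg
  have hN0 : 0 ≤ N := by
    rw [hN]
    exact smul_nonneg (by norm_num) (add_nonneg hM hUMU)
  set X := A + M + δ • (1 : Matrix n n ℂ) with hX
  set Y := A + N + δ • (1 : Matrix n n ℂ) with hY
  have hXp : IsStrictlyPositive X := isStrictlyPositive_add_smul_one (add_nonneg hA hM) hδ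
  have hYp : IsStrictlyPositive Y := isStrictlyPositive_add_smul_one (add_nonneg hA hN0) hδ
  have hUXU : U * X * U = A + U * M * U + δ • (1 : Matrix n n ℂ) := by
    rw [hX, mul_add, mul_add, add_mul, add_mul, hAU]
    simp [hU]
  have hUXUp : IsStrictlyPositive (U * X * U) := by
    rw [hUXU]
    exact isStrictlyPositive_add_smul_one (add_nonneg hA hUMU) hδ
  have hYX : Y = (2⁻¹ : ℝ) • X + (2⁻¹ : ℝ) • (U * X * U) := by
    rw [hUXU, hY, hX, hN]
    module
  have hUNU : U * N * U = N := by
    have : U * (U * M * U) * U = M := by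
      calc U * (U * M * U) * U = (U * U) * M * (U * U) := by noncomm_ring
        _ = M := by rw [hU, one_mul, mul_one]
    rw [hN, mul_smul_comm, smul_mul_assoc, mul_add, add_mul, this, add_comm]
  have hUYU : U * Y * U = Y := by
    rw [hY, mul_add, mul_add, add_mul, add_mul, hAU, hUNU]
    simp [hU]
  have hconc : (2⁻¹ : ℝ) • CFC.log X + (2⁻¹ : ℝ) • (U * CFC.log X * U) ≤ CFC.log Y := by
    rw [hYX, ← log_conj_involution hXp hU hUs]
    exact CFC.concaveOn_log.2 hXp hUXUp (by norm_num) (by norm_num) (by norm_num)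
  have hUL : U * CFC.log Y * U = CFC.log Y := by
    rw [← log_conj_involution hYp hU hUs, hUYU]
  have hconj : ∀ Z L : Matrix n n ℂ, (Z * (U * L * U)).trace = (U * Z * U * L).trace := by
    intro Z L
    rw [Matrix.trace_mul_comm, ← Matrix.trace_mul_comm L]
    simp only [mul_assoc]
    rw [Matrix.trace_mul_comm]
    simp only [mul_assoc]
  have hAle : (A * CFC.log X).trace.re ≤ (A * CFC.log Y).trace.re := by
    have h := re_trace_mul_le hA hconc
    rw [mul_add, mul_smul_comm, mul_smul_comm, Matrix.trace_add, Matrix.trace_smul,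
      Matrix.trace_smul, hconj, hAU, ← add_smul] at h
    norm_num at h
    exact h
  have hYw : ∀ i j, Y i j ≠ 0 → w i = w j := by
    intro i j hij
    by_contra hne
    apply hij
    have h1 : A i j = 0 := by
      by_contra h
      exact hne (hAw i j h)
    have h2 : N i j = 0 := by
      by_contra h
      exact hne (hNw i j h)
    have h3 : i ≠ j := fun h => hne (by rw [h])
    simp [hY, h1, h2, h3]
  have hXY : X ≤ Matrix.diagonal (fun i => (w i : ℂ)) * Y := by
    rw [hX, hY, mul_add, mul_add]
    refine add_le_add (add_le_add (le_diagonal_mul hA hw hAw) hMN) (le_diagonal_mul ?_ hw ?_)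
    · exact smul_nonneg hδ.le zero_le_one
    · intro i j hij
      by_cases h : i = j
      · rw [h]
      · simp [h] at hij
  have hlog : CFC.log X ≤
      CFC.log Y + Matrix.diagonal fun i => ((Real.log (w i) : ℝ) : ℂ) := by
    rw [← log_diagonal_mul hYp (fun i => one_pos.trans_le (hw i))
      (commute_diagonal_of_support fun i j hij => by rw [hYw i j hij])]
    exact CFC.log_le_log hXY hXp
  have hMle := re_trace_mul_le hM hlog
  have hMY : (M * CFC.log Y).trace = (N * CFC.log Y).trace := by
    have h : (U * M * U * CFC.log Y).trace = (M * CFC.log Y).trace := by rw [← hconj, hUL]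
    rw [hN, smul_mul_assoc, Matrix.trace_smul, add_mul, Matrix.trace_add, h, ← two_smul ℝ,
      smul_smul]
    norm_num
  have hdiag : (M * Matrix.diagonal fun i => ((Real.log (w i) : ℝ) : ℂ)).trace.re =
      ∑ i, (M i i).re * Real.log (w i) := by
    simp [Matrix.trace, Matrix.mul_diagonal]
  rw [mul_add, Matrix.trace_add, Complex.add_re, hMY, hdiag] at hMle
  rw [add_mul, add_mul, Matrix.trace_add, Matrix.trace_add, Complex.add_re, Complex.add_re]
  linarith

/-- A positive matrix of trace `r` and rank at most `d` satisfies
`tr X log (X + δ) ≥ r log (r / d)`. -/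
lemma mul_log_div_le_re_trace_mul_log {X : Matrix n n ℂ} (hX : 0 ≤ X) {r : ℝ} (hr : 0 < r)
    (htr : X.trace = (r : ℂ)) {d : ℕ} (hd : 0 < d) (hrank : X.rank ≤ d) {δ : ℝ} (hδ : 0 < δ) :
    r * Real.log (r / d) ≤ (X * CFC.log (X + δ • (1 : Matrix n n ℂ))).trace.re := by
  have hH : X.IsHermitian := (Matrix.nonneg_iff_posSemidef.1 hX).isHermitian
  have hsa : IsSelfAdjoint X := hH
  have hev : ∀ i, 0 ≤ hH.eigenvalues i := (Matrix.nonneg_iff_posSemidef.1 hX).eigenvalues_nonneg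
  have hspec : ∀ x ∈ spectrum ℝ X, 0 ≤ x := fun x hx => spectrum_nonneg_of_nonneg hX hx
  have hcont : ContinuousOn (fun x : ℝ => Real.log (x + δ)) (spectrum ℝ X) :=
    ContinuousOn.log (by fun_prop) fun x hx => by linarith [hspec x hx]
  have hlog : CFC.log (X + δ • (1 : Matrix n n ℂ)) = cfc (fun x : ℝ => Real.log (x + δ)) X := by
    have h1 : X + δ • (1 : Matrix n n ℂ) = cfc (fun x : ℝ => x + δ) X := by
      rw [cfc_add_const δ (fun x => x) X, cfc_id' ℝ X, Algebra.algebraMap_eq_smul_one]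
    have h2 : ContinuousOn Real.log ((fun x : ℝ => x + δ) '' spectrum ℝ X) := by
      refine ContinuousOn.log continuousOn_id ?_
      rintro _ ⟨x, hx, rfl⟩
      exact (add_pos_of_nonneg_of_pos (hspec x hx) hδ).ne'
    rw [h1, CFC.log, ← cfc_comp' Real.log (fun x : ℝ => x + δ) X h2]
  have hmul : X * CFC.log (X + δ • (1 : Matrix n n ℂ)) =
      cfc (fun x : ℝ => x * Real.log (x + δ)) X := by
    rw [hlog, cfc_mul (fun x : ℝ => x) (fun x => Real.log (x + δ)) X continuousOn_id hcont,
      cfc_id' ℝ X]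
  have htrace : (X * CFC.log (X + δ • (1 : Matrix n n ℂ))).trace.re =
      ∑ i, hH.eigenvalues i * Real.log (hH.eigenvalues i + δ) := by
    rw [hmul, hH.cfc_eq, Matrix.IsHermitian.cfc, Unitary.conjStarAlgAut_apply,
      Matrix.trace_mul_comm, ← mul_assoc]
    simp [Matrix.trace]
  have hsum : ∑ i, hH.eigenvalues i = r := by
    have := hH.trace_eq_sum_eigenvalues
    rw [htr] at this
    have h := congrArg Complex.re this
    simpa using h.symm
  have hd' : (0 : ℝ) < d := by exact_mod_cast hd
  have hc : 0 < r / d := div_pos hr hd'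
  have hterm : ∀ i, hH.eigenvalues i * Real.log (r / d) + hH.eigenvalues i -
      (if hH.eigenvalues i ≠ 0 then r / d else 0) ≤
      hH.eigenvalues i * Real.log (hH.eigenvalues i + δ) := by
    intro i
    rcases (hev i).eq_or_lt with h | h
    · simp [← h]
    · set x := hH.eigenvalues i
      have h1 : Real.log (r / d / (x + δ)) ≤ r / d / (x + δ) - 1 :=
        Real.log_le_sub_one_of_pos (by positivity)
      rw [Real.log_div hc.ne' (by positivity)] at h1
      have h2 : x * (r / d / (x + δ)) ≤ r / d := by
        rw [← mul_div_assoc, div_le_iff₀ (by positivity)]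
        nlinarith
      rw [if_pos h.ne']
      nlinarith
  have hcard : ∑ i, (if hH.eigenvalues i ≠ 0 then r / d else 0) ≤ r := by
    rw [← Finset.sum_filter, Finset.sum_const, nsmul_eq_mul, ← Fintype.card_subtype,
      ← hH.rank_eq_card_non_zero_eigs]
    calc (X.rank : ℝ) * (r / d) ≤ d * (r / d) := by gcongr
      _ = r := by field_simp
  rw [htrace]
  refine le_trans ?_ (Finset.sum_le_sum fun i _ => hterm i)
  rw [Finset.sum_sub_distrib, Finset.sum_add_distrib, ← Finset.sum_mul, hsum]
  linarith

end MatrixLog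

section RowPinching

set_option linter.unusedSectionVars false

open scoped MatrixOrder Matrix.Norms.L2Operator Matrix

variable {A B k : Type} [Fintype A] [DecidableEq A] [DecidableEq B] [Fintype k] [DecidableEq k]

/-- The pinching of a matrix to the blocks of rows of `g` that agree on `S`. -/
def rowPinch (g : A → B → Bool) (S : Finset B) (X : Matrix (k × A) (k × A) ℂ) :
    Matrix (k × A) (k × A) ℂ :=
  Matrix.of fun p q => if ∀ b ∈ S, g p.2 b = g q.2 b then X p q else 0

/-- The number of rows of `g` that agree with row `a` on `S`. -/
def cellCard (g : A → B → Bool) (S : Finset B) (a : A) : ℕ :=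
  (Finset.univ.filter fun a' => ∀ b ∈ S, g a b = g a' b).card

/-- The diagonal sign matrix recording the column `b` of `g`. -/
def columnSign (k : Type) [DecidableEq k] (g : A → B → Bool) (b : B) :
    Matrix (k × A) (k × A) ℂ :=
  Matrix.diagonal fun p => if g p.2 b then 1 else -1

lemma columnSign_mul_self (g : A → B → Bool) (b : B) :
    columnSign k g b * columnSign k g b = 1 := by
  rw [columnSign, Matrix.diagonal_mul_diagonal, ← Matrix.diagonal_one]
  congr 1
  ext p
  split_ifs <;> simp

lemma columnSign_conjTranspose (g : A → B → Bool) (b : B) :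
    (columnSign k g b)ᴴ = columnSign k g b := by
  rw [columnSign, Matrix.diagonal_conjTranspose]
  congr 1
  ext p
  by_cases h : g p.2 b <;> simp [h]

lemma columnSign_conj_apply (g : A → B → Bool) (b : B) (X : Matrix (k × A) (k × A) ℂ)
    (p q : k × A) : (columnSign k g b * X * columnSign k g b) p q =
      if g p.2 b = g q.2 b then X p q else -X p q := by
  rw [columnSign, Matrix.mul_diagonal, Matrix.diagonal_mul]
  cases g p.2 b <;> cases g q.2 b <;> simp

lemma rowPinch_add (g : A → B → Bool) (S : Finset B) (X Y : Matrix (k × A) (k × A) ℂ) :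
    rowPinch g S (X + Y) = rowPinch g S X + rowPinch g S Y := by
  ext p q
  simp only [rowPinch, Matrix.of_apply, Matrix.add_apply]
  split_ifs <;> simp

lemma rowPinch_empty (g : A → B → Bool) (X : Matrix (k × A) (k × A) ℂ) :
    rowPinch g ∅ X = X := by
  ext p q
  simp [rowPinch]

lemma rowPinch_insert (g : A → B → Bool) (S : Finset B) (b : B)
    (X : Matrix (k × A) (k × A) ℂ) :
    rowPinch g (insert b S) X = (2⁻¹ : ℝ) •
      (rowPinch g S X + columnSign k g b * rowPinch g S X * columnSign k g b) := by
  ext p q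
  rw [Matrix.smul_apply, Matrix.add_apply, columnSign_conj_apply]
  simp only [rowPinch, Matrix.of_apply, Finset.forall_mem_insert]
  by_cases h1 : g p.2 b = g q.2 b <;> by_cases h2 : ∀ b ∈ S, g p.2 b = g q.2 b
  · rw [if_pos ⟨h1, h2⟩, if_pos h1, if_pos h2, ← two_smul ℝ, smul_smul]
    norm_num
  all_goals simp [h1, h2]

lemma rowPinch_nonneg (g : A → B → Bool) (S : Finset B) {X : Matrix (k × A) (k × A) ℂ}
    (hX : 0 ≤ X) : 0 ≤ rowPinch g S X := by
  induction S using Finset.induction_on with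
  | empty => rwa [rowPinch_empty]
  | insert b S _ ih =>
    rw [rowPinch_insert]
    have h := (Matrix.nonneg_iff_posSemidef.1 ih).conjTranspose_mul_mul_same (columnSign k g b)
    rw [columnSign_conjTranspose] at h
    exact smul_nonneg (by norm_num) (add_nonneg ih (Matrix.nonneg_iff_posSemidef.2 h))

lemma cellCard_pos (g : A → B → Bool) (S : Finset B) (a : A) : 0 < cellCard g S a :=
  Finset.card_pos.2 ⟨a, by simp⟩

lemma cellCard_insert_le (g : A → B → Bool) (S : Finset B) (b : B) (a : A) :
    cellCard g (insert b S) a ≤ cellCard g S a := by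
  refine Finset.card_le_card fun a' ha' => ?_
  simp only [Finset.mem_filter, Finset.mem_univ, true_and, Finset.forall_mem_insert] at ha' ⊢
  exact ha'.2

lemma cellCard_congr {g : A → B → Bool} {S : Finset B} {a a' : A}
    (h : ∀ b ∈ S, g a b = g a' b) : cellCard g S a = cellCard g S a' := by
  unfold cellCard
  congr 1
  ext c
  simp only [Finset.mem_filter, Finset.mem_univ, true_and]
  exact forall₂_congr fun b hb => by rw [h b hb]

lemma cellCard_eq_add {g : A → B → Bool} {S : Finset B} {b : B} {a a' : A}
    (h : ∀ b ∈ S, g a b = g a' b) (hb : g a b ≠ g a' b) :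
    cellCard g S a = cellCard g (insert b S) a + cellCard g (insert b S) a' := by
  unfold cellCard
  rw [← Finset.card_union_of_disjoint]
  · congr 1
    ext c
    simp only [Finset.mem_filter, Finset.mem_univ, true_and, Finset.mem_union,
      Finset.forall_mem_insert]
    have h1 : (∀ b ∈ S, g a' b = g c b) ↔ ∀ b ∈ S, g a b = g c b :=
      forall₂_congr fun b hb => by rw [h b hb]
    rw [h1]
    revert hb
    cases g a b <;> cases g a' b <;> cases g c b <;> simp
  · rw [Finset.disjoint_left]
    intro c hc hc'
    simp only [Finset.mem_filter, Finset.mem_univ, true_and, Finset.forall_mem_insert] at hc hc'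
    exact hb (hc.1.trans hc'.1.symm)

/-- The factor by which the cell of row `a` shrinks when `b` is added to `S`. -/
noncomputable def cellRatio (g : A → B → Bool) (S : Finset B) (b : B) (a : A) : ℝ :=
  cellCard g S a / cellCard g (insert b S) a

lemma one_le_cellRatio (g : A → B → Bool) (S : Finset B) (b : B) (a : A) :
    1 ≤ cellRatio g S b a := by
  rw [cellRatio, one_le_div (by exact_mod_cast cellCard_pos g _ a)]
  exact_mod_cast cellCard_insert_le g S b a

lemma cellRatio_congr {g : A → B → Bool} {S : Finset B} {b : B} {a a' : A}
    (h : ∀ c ∈ insert b S, g a c = g a' c) : cellRatio g S b a = cellRatio g S b a' := by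
  rw [cellRatio, cellRatio, cellCard_congr h,
    cellCard_congr fun c hc => h c (Finset.mem_insert_of_mem hc)]

lemma cellRatio_sub_one_mul {g : A → B → Bool} {S : Finset B} {b : B} {a a' : A}
    (h : ∀ c ∈ S, g a c = g a' c) (hb : g a b ≠ g a' b) :
    (cellRatio g S b a - 1) * (cellRatio g S b a' - 1) = 1 := by
  have h1 : (0 : ℝ) < cellCard g (insert b S) a := by exact_mod_cast cellCard_pos g _ a
  have h2 : (0 : ℝ) < cellCard g (insert b S) a' := by exact_mod_cast cellCard_pos g _ a'
  have h3 := cellCard_eq_add h hb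
  have h4 := cellCard_congr h
  rw [cellRatio, cellRatio, ← h4, h3]
  push_cast
  field_simp
  ring

lemma rowPinch_le_cellRatio_mul (g : A → B → Bool) (S : Finset B) (b : B)
    {X : Matrix (k × A) (k × A) ℂ} (hX : 0 ≤ X) :
    rowPinch g S X ≤ Matrix.diagonal (fun p : k × A => (cellRatio g S b p.2 : ℂ)) *
      rowPinch g (insert b S) X := by
  let r : k × A → ℝ := fun p =>
    (if g p.2 b then 1 else -1) * √(cellRatio g S b p.2 - 1)
  have h := (Matrix.nonneg_iff_posSemidef.1 (rowPinch_nonneg g S hX)).conjTranspose_mul_mul_same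
    (Matrix.diagonal fun p => (r p : ℂ))
  rw [Matrix.le_iff]
  convert h using 1
  ext p q
  rw [Matrix.diagonal_conjTranspose, Matrix.mul_diagonal, Matrix.diagonal_mul, Matrix.sub_apply,
    Matrix.diagonal_mul]
  have hs : ∀ a, √(cellRatio g S b a - 1) * √(cellRatio g S b a - 1) = cellRatio g S b a - 1 :=
    fun a => Real.mul_self_sqrt (sub_nonneg.2 (one_le_cellRatio g S b a))
  simp only [rowPinch, Matrix.of_apply, Finset.forall_mem_insert, Pi.star_apply,
    Complex.star_def, Complex.conj_ofReal]
  by_cases h2 : ∀ b ∈ S, g p.2 b = g q.2 b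
  · by_cases h1 : g p.2 b = g q.2 b
    · have hr : r p * r q = cellRatio g S b p.2 - 1 := by
        have : cellRatio g S b p.2 = cellRatio g S b q.2 :=
          cellRatio_congr (by simpa [Finset.forall_mem_insert] using ⟨h1, h2⟩)
        simp only [r]
        rw [← this, ← h1]
        cases g p.2 b <;> simp [hs]
      rw [if_pos ⟨h1, h2⟩, if_pos h2, mul_right_comm, ← Complex.ofReal_mul, hr]
      push_cast
      ring
    · have hr : r p * r q = -1 := by
        have h3 : √(cellRatio g S b p.2 - 1) * √(cellRatio g S b q.2 - 1) = 1 := by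
          rw [← Real.sqrt_mul (sub_nonneg.2 (one_le_cellRatio g S b p.2)),
            cellRatio_sub_one_mul h2 h1, Real.sqrt_one]
        simp only [r]
        revert h1
        cases g p.2 b <;> cases g q.2 b <;> simp [h3]
      rw [if_neg fun h => h1 h.1, if_pos h2, mul_right_comm, ← Complex.ofReal_mul, hr]
      push_cast
      ring
  · rw [if_neg fun h => h2 h.2, if_neg h2]
    ring

/-- If `X = Y + Z` with `Y` supported on pairs of rows that agree in column `b`, then refining the
pinching by `b` decreases `tr X log (X + δ)` by at most `∑ Zₚₚ log (cellRatio)`. -/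
lemma re_trace_rowPinch_mul_log_le (g : A → B → Bool) (S : Finset B) (b : B)
    {X Y Z : Matrix (k × A) (k × A) ℂ} (hXYZ : X = Y + Z) (hY : 0 ≤ Y) (hZ : 0 ≤ Z)
    (hYb : ∀ p q, g p.2 b ≠ g q.2 b → Y p q = 0) {δ : ℝ} (hδ : 0 < δ) :
    (rowPinch g S X * CFC.log (rowPinch g S X + δ • (1 : Matrix (k × A) (k × A) ℂ))).trace.re ≤
      (rowPinch g (insert b S) X *
        CFC.log (rowPinch g (insert b S) X + δ • (1 : Matrix (k × A) (k × A) ℂ))).trace.re +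
      ∑ p : k × A, (Z p p).re * Real.log (cellRatio g S b p.2) := by
  have hpY : rowPinch g (insert b S) Y = rowPinch g S Y := by
    ext p q
    simp only [rowPinch, Matrix.of_apply, Finset.forall_mem_insert]
    by_cases h : g p.2 b = g q.2 b
    · simp [h]
    · simp [hYb p q h]
  have hsupp : ∀ (W : Matrix (k × A) (k × A) ℂ) (p q : k × A),
      rowPinch g (insert b S) W p q ≠ 0 → cellRatio g S b p.2 = cellRatio g S b q.2 := by
    intro W p q h
    refine cellRatio_congr ?_
    by_contra hne
    exact h (by simp only [rowPinch, Matrix.of_apply, if_neg hne])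
  have hdiag : ∀ p, (rowPinch g S Z p p).re = (Z p p).re := fun p => by simp [rowPinch]
  have hYconj : columnSign k g b * rowPinch g S Y * columnSign k g b = rowPinch g S Y := by
    ext p q
    rw [columnSign_conj_apply]
    by_cases h : g p.2 b = g q.2 b
    · rw [if_pos h]
    · simp [rowPinch, hYb p q h]
  rw [hXYZ, rowPinch_add, rowPinch_add, hpY]
  simp only [← hdiag]
  exact re_trace_mul_log_le_of_pinching (rowPinch_nonneg g S hY) (rowPinch_nonneg g S hZ)
    (columnSign_mul_self g b) (columnSign_conjTranspose g b) hYconj (rowPinch_insert g S b Z)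
    (fun p => one_le_cellRatio g S b p.2) (fun p q h => hsupp Y p q (by rwa [hpY])) (hsupp Z)
    (rowPinch_le_cellRatio_mul g S b hZ) hδ

/-- Chain rule: refining by all columns of `S` decreases `tr X log (X + δ)` by at most `ε` times
the total logarithmic shrinkage of the cells. -/
lemma re_trace_mul_log_le_rowPinch (g : A → B → Bool) {X : Matrix (k × A) (k × A) ℂ}
    {Y Z : B → Matrix (k × A) (k × A) ℂ} (hXYZ : ∀ b, X = Y b + Z b) (hY : ∀ b, 0 ≤ Y b)
    (hZ : ∀ b, 0 ≤ Z b) (hYb : ∀ b p q, g p.2 b ≠ g q.2 b → Y b p q = 0) {ε : ℝ}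
    (hε : ∀ b a, ∑ i : k, (Z b (i, a) (i, a)).re ≤ ε) {δ : ℝ} (hδ : 0 < δ) (S : Finset B) :
    (X * CFC.log (X + δ • (1 : Matrix (k × A) (k × A) ℂ))).trace.re ≤
      (rowPinch g S X *
        CFC.log (rowPinch g S X + δ • (1 : Matrix (k × A) (k × A) ℂ))).trace.re +
      ε * ∑ a : A, (Real.log (cellCard g ∅ a) - Real.log (cellCard g S a)) := by
  induction S using Finset.induction_on with
  | empty => simp [rowPinch_empty]
  | insert b S _ ih =>
    have h1 := re_trace_rowPinch_mul_log_le g S b (hXYZ b) (hY b) (hZ b) (hYb b) hδ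
    have h2 : ∑ p : k × A, (Z b p p).re * Real.log (cellRatio g S b p.2) ≤
        ε * ∑ a : A, (Real.log (cellCard g S a) - Real.log (cellCard g (insert b S) a)) := by
      rw [Fintype.sum_prod_type_right, Finset.mul_sum]
      refine Finset.sum_le_sum fun a _ => ?_
      dsimp only
      rw [← Finset.sum_mul, ← Real.log_div (by exact_mod_cast (cellCard_pos g S a).ne')
        (by exact_mod_cast (cellCard_pos g _ a).ne')]
      exact mul_le_mul_of_nonneg_right (hε b a) (Real.log_nonneg (one_le_cellRatio g S b a))
    refine ih.trans ?_
    have h3 : ε * ∑ a : A, (Real.log (cellCard g ∅ a) - Real.log (cellCard g (insert b S) a)) =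
        ε * ∑ a : A, (Real.log (cellCard g ∅ a) - Real.log (cellCard g S a)) +
        ε * ∑ a : A, (Real.log (cellCard g S a) - Real.log (cellCard g (insert b S) a)) := by
      rw [← mul_add, ← Finset.sum_add_distrib]
      congr 1
      exact Finset.sum_congr rfl fun a _ => by ring
    linarith

end RowPinching

section LasVegas

open scoped MatrixOrder Matrix.Norms.L2Operator Matrix

lemma IsDensity.le_one {d : ℕ} {ρ : Matrix (Fin d) (Fin d) ℂ} (h : IsDensity ρ) : ρ ≤ 1 := by
  have hH := h.1.isHermitian
  have hsum : ∑ i, hH.eigenvalues i = 1 := by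
    have h1 := hH.trace_eq_sum_eigenvalues
    rw [h.2] at h1
    have h2 := congrArg Complex.re h1
    simpa using h2.symm
  have hsa : IsSelfAdjoint ρ := hH
  rw [← map_one (algebraMap ℝ (Matrix (Fin d) (Fin d) ℂ))]
  refine le_algebraMap_of_spectrum_le (fun x hx => ?_) hsa
  rw [hH.spectrum_real_eq_range_eigenvalues] at hx
  obtain ⟨i, rfl⟩ := hx
  rw [← hsum]
  exact Finset.single_le_sum (fun j _ => h.1.eigenvalues_nonneg j) (Finset.mem_univ i)

lemma mul_sqrt_eq_zero {n : Type} [Fintype n] [DecidableEq n] {E ρ : Matrix n n ℂ} (hE : 0 ≤ E)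
    (hρ : 0 ≤ ρ) (h : (E * ρ).trace = 0) : E * CFC.sqrt ρ = 0 := by
  have hs : (CFC.sqrt ρ)ᴴ = CFC.sqrt ρ :=
    (Matrix.nonneg_iff_posSemidef.1 (CFC.sqrt_nonneg ρ)).isHermitian
  have hF : (CFC.sqrt E)ᴴ = CFC.sqrt E :=
    (Matrix.nonneg_iff_posSemidef.1 (CFC.sqrt_nonneg E)).isHermitian
  have h1 : CFC.sqrt E * CFC.sqrt ρ = 0 := by
    rw [← Matrix.trace_conjTranspose_mul_self_eq_zero_iff, Matrix.conjTranspose_mul, hs, hF]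
    calc (CFC.sqrt ρ * CFC.sqrt E * (CFC.sqrt E * CFC.sqrt ρ)).trace
        = (CFC.sqrt ρ * (CFC.sqrt E * CFC.sqrt E) * CFC.sqrt ρ).trace := by
          simp only [mul_assoc]
      _ = (E * (CFC.sqrt ρ * CFC.sqrt ρ)).trace := by
          rw [CFC.sqrt_mul_sqrt_self E hE, mul_assoc, Matrix.trace_mul_comm, mul_assoc]
      _ = 0 := by rw [CFC.sqrt_mul_sqrt_self ρ hρ, h]
  calc E * CFC.sqrt ρ = CFC.sqrt E * (CFC.sqrt E * CFC.sqrt ρ) := by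
        rw [← mul_assoc, CFC.sqrt_mul_sqrt_self E hE]
    _ = 0 := by rw [h1, mul_zero]

lemma QLasVegas.log_card_le_of_injective {A B : Type} [Fintype A] [Fintype B] [Nonempty A]
    {g : A → B → Bool} (hg : Function.Injective g) {m : ℕ} {ε : ℝ}
    {ρ : A → Matrix (Fin (2 ^ m)) (Fin (2 ^ m)) ℂ}
    {E0 E1 Eg : B → Matrix (Fin (2 ^ m)) (Fin (2 ^ m)) ℂ} (h : QLasVegas g m ε ρ E0 E1 Eg) :
    (1 - ε) * Real.log (Fintype.card A) ≤ Real.log ((2 ^ m : ℕ) : ℝ) := by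
  classical
  obtain ⟨hρ, hE, hgE⟩ := h
  have hρ0 : ∀ a, 0 ≤ ρ a := fun a => Matrix.nonneg_iff_posSemidef.2 (hρ a).1
  have hE0 : ∀ b, 0 ≤ E0 b := fun b => Matrix.nonneg_iff_posSemidef.2 (hE b).1
  have hE1 : ∀ b, 0 ≤ E1 b := fun b => Matrix.nonneg_iff_posSemidef.2 (hE b).2.1
  have hEg : ∀ b, 0 ≤ Eg b := fun b => Matrix.nonneg_iff_posSemidef.2 (hE b).2.2.1
  let s : A → Matrix (Fin (2 ^ m)) (Fin (2 ^ m)) ℂ := fun a => CFC.sqrt (ρ a)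
  have hs : ∀ a, (s a)ᴴ = s a := fun a =>
    (Matrix.nonneg_iff_posSemidef.1 (CFC.sqrt_nonneg (ρ a))).isHermitian
  have hss : ∀ a, s a * s a = ρ a := fun a => CFC.sqrt_mul_sqrt_self (ρ a) (hρ0 a)
  let V : Matrix (Fin (2 ^ m)) (Fin (2 ^ m) × A) ℂ := Matrix.of fun i p => s p.2 i p.1
  have hV : ∀ (E : Matrix (Fin (2 ^ m)) (Fin (2 ^ m)) ℂ) (p q : Fin (2 ^ m) × A),
      (Vᴴ * E * V) p q = (s p.2 * E * s q.2) p.1 q.1 := by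
    intro E p q
    conv_rhs => rw [← hs p.2]
    rfl
  have hVE : ∀ E : Matrix (Fin (2 ^ m)) (Fin (2 ^ m)) ℂ, 0 ≤ E → 0 ≤ Vᴴ * E * V := fun E h =>
    Matrix.nonneg_iff_posSemidef.2
      ((Matrix.nonneg_iff_posSemidef.1 h).conjTranspose_mul_mul_same V)
  have hright : ∀ E : Matrix (Fin (2 ^ m)) (Fin (2 ^ m)) ℂ, 0 ≤ E → ∀ a,
      (E * ρ a).trace = 0 → E * s a = 0 := fun E h a h0 => mul_sqrt_eq_zero h (hρ0 a) h0
  have hleft : ∀ E : Matrix (Fin (2 ^ m)) (Fin (2 ^ m)) ℂ, 0 ≤ E → ∀ a,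
      (E * ρ a).trace = 0 → s a * E = 0 := by
    intro E h a h0
    have h1 := congrArg Matrix.conjTranspose (hright E h a h0)
    rwa [Matrix.conjTranspose_mul, hs, (Matrix.nonneg_iff_posSemidef.1 h).isHermitian.eq,
      Matrix.conjTranspose_zero] at h1
  have htr : ∀ (E : Matrix (Fin (2 ^ m)) (Fin (2 ^ m)) ℂ) a,
      ∑ i, (Vᴴ * E * V) (i, a) (i, a) = (E * ρ a).trace := by
    intro E a
    simp only [hV]
    rw [← hss a, ← mul_assoc, Matrix.trace_mul_comm, ← mul_assoc]
    rfl
  set X := Vᴴ * V with hX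
  have hX1 : X = Vᴴ * (1 : Matrix (Fin (2 ^ m)) (Fin (2 ^ m)) ℂ) * V := by rw [Matrix.mul_one]
  have hX0 : 0 ≤ X := by
    rw [hX1]
    exact hVE 1 zero_le_one
  have hsplit : ∀ b, X = Vᴴ * (E0 b + E1 b) * V + Vᴴ * Eg b * V := by
    intro b
    rw [hX1, ← (hE b).2.2.2]
    simp only [Matrix.mul_add, Matrix.add_mul]
  have hYb : ∀ b (p q : Fin (2 ^ m) × A), g p.2 b ≠ g q.2 b →
      (Vᴴ * (E0 b + E1 b) * V) p q = 0 := by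
    intro b p q hpq
    rw [hV]
    suffices s p.2 * (E0 b + E1 b) * s q.2 = 0 by rw [this]; rfl
    have hp := (hgE p.2 b).1
    have hq := (hgE q.2 b).1
    by_cases h1 : g p.2 b = true
    · have h2 : ¬ g q.2 b = true := fun h2 => hpq (h1.trans h2.symm)
      rw [if_pos h1] at hp
      rw [if_neg h2] at hq
      rw [mul_add, hleft _ (hE0 b) _ hp, zero_add, mul_assoc, hright _ (hE1 b) _ hq, mul_zero]
    · have h2 : g q.2 b = true := by
        revert hpq h1
        cases g p.2 b <;> cases g q.2 b <;> simp
      rw [if_neg h1] at hp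
      rw [if_pos h2] at hq
      rw [mul_add, hleft _ (hE1 b) _ hp, add_zero, mul_assoc, hright _ (hE0 b) _ hq, mul_zero]
  have hεb : ∀ b a, ∑ i, ((Vᴴ * Eg b * V) (i, a) (i, a)).re ≤ ε := by
    intro b a
    rw [← Complex.re_sum, htr]
    exact (hgE a b).2
  have hcard : (0 : ℝ) < Fintype.card A := by exact_mod_cast Fintype.card_pos
  have hXtr : X.trace = ((Fintype.card A : ℝ) : ℂ) := by
    rw [Matrix.trace, Fintype.sum_prod_type_right]
    simp only [Matrix.diag_apply]
    rw [hX1]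
    simp only [htr, one_mul, (hρ _).2]
    simp
  have hrank : X.rank ≤ 2 ^ m := by
    refine (Matrix.rank_mul_le_right _ _).trans ?_
    simpa using Matrix.rank_le_card_height V
  have hpinch : rowPinch g Finset.univ X = Matrix.blockDiagonal ρ := by
    ext ⟨i, a⟩ ⟨j, a'⟩
    rw [Matrix.blockDiagonal_apply, rowPinch, Matrix.of_apply]
    by_cases haa : a = a'
    · subst haa
      rw [if_pos (fun _ _ => rfl), if_pos rfl, hX1, hV, mul_one, hss]
    · rw [if_neg haa, if_neg fun hall => haa (hg (funext fun b => hall b (Finset.mem_univ b)))]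
  have hblock0 : 0 ≤ Matrix.blockDiagonal ρ := by
    rw [← hpinch]
    exact rowPinch_nonneg g _ hX0
  have hblock1 : Matrix.blockDiagonal ρ ≤ 1 := by
    have h1 : (1 : Matrix (Fin (2 ^ m) × A) (Fin (2 ^ m) × A) ℂ) - Matrix.blockDiagonal ρ =
        (Matrix.blockDiagonal fun a => CFC.sqrt (1 - ρ a))ᴴ *
          Matrix.blockDiagonal fun a => CFC.sqrt (1 - ρ a) := by
      rw [Matrix.blockDiagonal_conjTranspose, ← Matrix.blockDiagonal_mul,
        ← Matrix.blockDiagonal_one, ← Matrix.blockDiagonal_sub]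
      congr 1
      ext1 a
      rw [(Matrix.nonneg_iff_posSemidef.1 (CFC.sqrt_nonneg (1 - ρ a))).isHermitian.eq,
        CFC.sqrt_mul_sqrt_self _ (sub_nonneg.2 (hρ a).le_one)]
      rfl
    rw [Matrix.le_iff, h1]
    exact Matrix.posSemidef_conjTranspose_mul_self _
  have hblocktr : (Matrix.blockDiagonal ρ).trace.re = Fintype.card A := by
    rw [Matrix.trace_blockDiagonal]
    simp [(hρ _).2]
  have hempty : ∀ a, cellCard g ∅ a = Fintype.card A := fun a => by
    simp [cellCard, Finset.card_univ]
  have huniv : ∀ a, cellCard g Finset.univ a = 1 := by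
    intro a
    rw [cellCard, Finset.card_eq_one]
    refine ⟨a, ?_⟩
    ext a'
    simp only [Finset.mem_filter, Finset.mem_univ, true_and, Finset.mem_singleton, forall_const]
    exact ⟨fun h => (hg (funext h)).symm, fun h b => by rw [h]⟩
  have hd : (0 : ℝ) < ((2 ^ m : ℕ) : ℝ) := by positivity
  refine le_of_forall_pos_le_add fun δ hδ => ?_
  have hlow := mul_log_div_le_re_trace_mul_log hX0 hcard hXtr (Nat.two_pow_pos m) hrank hδ
  have hup := re_trace_mul_log_le_rowPinch g hsplit
    (fun b => hVE _ (add_nonneg (hE0 b) (hE1 b))) (fun b => hVE _ (hEg b)) hYb hεb hδ Finset.univ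
  have hlog : CFC.log (Matrix.blockDiagonal ρ +
      δ • (1 : Matrix (Fin (2 ^ m) × A) (Fin (2 ^ m) × A) ℂ)) ≤ Real.log (1 + δ) • 1 := by
    have h1 := CFC.log_algebraMap (A := Matrix (Fin (2 ^ m) × A) (Fin (2 ^ m) × A) ℂ) (r := 1 + δ)
    rw [Algebra.algebraMap_eq_smul_one, Algebra.algebraMap_eq_smul_one, add_smul, one_smul] at h1
    rw [← h1]
    exact CFC.log_le_log (add_le_add_left hblock1 _) (isStrictlyPositive_add_smul_one hblock0 hδ)
  have hfin := re_trace_mul_le hblock0 hlog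
  rw [mul_smul_comm, mul_one, Matrix.trace_smul, Complex.smul_re, hblocktr, smul_eq_mul] at hfin
  rw [hpinch] at hup
  simp only [hempty, huniv, Nat.cast_one, Real.log_one, sub_zero, Finset.sum_const,
    Finset.card_univ, nsmul_eq_mul] at hup
  rw [Real.log_div hcard.ne' hd.ne'] at hlow
  have hδlog : Real.log (1 + δ) ≤ δ := by
    have := Real.log_le_sub_one_of_pos (show 0 < 1 + δ by linarith)
    linarith
  have hchain : (Fintype.card A : ℝ) *
      (Real.log (Fintype.card A) - Real.log ((2 ^ m : ℕ) : ℝ)) ≤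
      Fintype.card A * (Real.log (1 + δ) + ε * Real.log (Fintype.card A)) := by
    linarith
  have := le_of_mul_le_mul_left hchain hcard
  linarith

end LasVegas

section Deterministic

set_option linter.unusedSectionVars false

variable {A B : Type} [Fintype A] [Fintype B] {g : A → B → Bool}

lemma QLasVegas.logb_rowCount_le {m : ℕ} {ε : ℝ}
    {ρ : A → Matrix (Fin (2 ^ m)) (Fin (2 ^ m)) ℂ}
    {E0 E1 Eg : B → Matrix (Fin (2 ^ m)) (Fin (2 ^ m)) ℂ} (h : QLasVegas g m ε ρ E0 E1 Eg) :
    (1 - ε) * Real.logb 2 (rowCount g) ≤ m := by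
  classical
  let R := {r // r ∈ Finset.univ.image fun a : A => g a}
  have hR : rowCount g = Fintype.card R := by
    rw [Fintype.card_coe, rowCount]
  have hrep : ∀ r : R, ∃ a, g a = r.1 := fun r => by
    obtain ⟨a, _, ha⟩ := Finset.mem_image.1 r.2
    exact ⟨a, ha⟩
  choose rep hrep using hrep
  rw [hR]
  cases isEmpty_or_nonempty R with
  | inl _ => simp
  | inr _ =>
    have hinj : Function.Injective fun r => g (rep r) := fun r r' hrr =>
      Subtype.ext (by simpa only [hrep] using hrr)
    have hLV : QLasVegas (fun r => g (rep r)) m ε (fun r => ρ (rep r)) E0 E1 Eg :=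
      ⟨fun r => h.1 (rep r), h.2.1, fun r b => h.2.2 (rep r) b⟩
    have hb := hLV.log_card_le_of_injective hinj
    have hlog2 : 0 < Real.log 2 := Real.log_pos one_lt_two
    rw [Real.logb, ← mul_div_assoc, div_le_iff₀ hlog2]
    simpa using hb

lemma QExact.qLasVegas {m : ℕ} {ρ : A → Matrix (Fin (2 ^ m)) (Fin (2 ^ m)) ℂ}
    {E : B → Matrix (Fin (2 ^ m)) (Fin (2 ^ m)) ℂ} (h : QExact g m ρ E) :
    QLasVegas g m 0 ρ (fun b => 1 - E b) E fun _ => 0 := by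
  refine ⟨h.1, fun b => ⟨(h.2.1 b).2, (h.2.1 b).1, Matrix.PosSemidef.zero, by rw [add_zero, sub_add_cancel]⟩,
    fun a b => ⟨?_, by simp⟩⟩
  have h1 := h.2.2 a b
  split_ifs at h1 ⊢
  · rw [Matrix.sub_mul, Matrix.one_mul, Matrix.trace_sub, h1, (h.1 a).2, sub_self]
  · exact h1

lemma QExact.logb_rowCount_le {m : ℕ} {ρ : A → Matrix (Fin (2 ^ m)) (Fin (2 ^ m)) ℂ}
    {E : B → Matrix (Fin (2 ^ m)) (Fin (2 ^ m)) ℂ} (h : QExact g m ρ E) :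
    Real.logb 2 (rowCount g) ≤ m := by
  simpa using h.qLasVegas.logb_rowCount_le

lemma QExact.clog_rowCount_le {m : ℕ} {ρ : A → Matrix (Fin (2 ^ m)) (Fin (2 ^ m)) ℂ}
    {E : B → Matrix (Fin (2 ^ m)) (Fin (2 ^ m)) ℂ} (h : QExact g m ρ E) :
    Nat.clog 2 (rowCount g) ≤ m := by
  refine Nat.clog_le_of_le_pow ?_
  rcases Nat.eq_zero_or_pos (rowCount g) with h0 | h0
  · rw [h0]
    exact Nat.zero_le _
  · have h1 := h.logb_rowCount_le
    rw [Real.logb_le_iff_le_rpow one_lt_two (by exact_mod_cast h0), Real.rpow_natCast] at h1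
    exact_mod_cast h1

lemma exists_qExact_of_deterministic {c : ℕ} {M : A → Fin (2 ^ c)} {o : Fin (2 ^ c) → B → Bool}
    (h : ∀ a b, o (M a) b = g a b) : ∃ ρ E, QExact g c ρ E := by
  refine ⟨fun a => Matrix.diagonal (Pi.single (M a) 1),
    fun b => Matrix.diagonal fun i => if o i b then 1 else 0, fun a => ⟨?_, ?_⟩,
    fun b => ⟨?_, ?_⟩, fun a b => ?_⟩
  · refine Matrix.PosSemidef.diagonal ?_
    exact Pi.single_nonneg.2 zero_le_one
  · simp [Matrix.trace_diagonal]
  · refine Matrix.PosSemidef.diagonal fun i => ?_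
    dsimp only
    split_ifs <;> simp
  · rw [← Matrix.diagonal_one, Matrix.diagonal_sub]
    refine Matrix.PosSemidef.diagonal fun i => ?_
    dsimp only
    split_ifs <;> simp
  · rw [Matrix.diagonal_mul_diagonal, Matrix.trace_diagonal, Finset.sum_eq_single (M a)]
    · simp [h]
    · intro i _ hi
      simp [Pi.single_eq_of_ne hi]
    · simp

lemma exists_deterministic_clog (g : A → B → Bool) :
    ∃ M : A → Fin (2 ^ Nat.clog 2 (rowCount g)),
      ∃ o : Fin (2 ^ Nat.clog 2 (rowCount g)) → B → Bool, ∀ a b, o (M a) b = g a b := by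
  classical
  let R := {r // r ∈ Finset.univ.image fun a : A => g a}
  have hR : Fintype.card R = rowCount g := by
    rw [Fintype.card_coe, rowCount]
  have hle : Fintype.card R ≤ Fintype.card (Fin (2 ^ Nat.clog 2 (rowCount g))) := by
    rw [hR, Fintype.card_fin]
    exact Nat.le_pow_clog one_lt_two _
  obtain ⟨f⟩ := Function.Embedding.nonempty_of_card_le hle
  let row : A → R := fun a => ⟨g a, Finset.mem_image_of_mem _ (Finset.mem_univ a)⟩
  refine ⟨fun a => f (row a), fun i b => decide (∃ r : R, f r = i ∧ r.1 b = true), fun a b => ?_⟩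
  rw [Bool.eq_iff_iff, decide_eq_true_iff]
  constructor
  · rintro ⟨r, hr, hb⟩
    rw [f.injective hr] at hb
    exact hb
  · exact fun hb => ⟨row a, rfl, hb⟩

lemma dcc_eq_clog (g : A → B → Bool) : Dcc g = Nat.clog 2 (rowCount g) := by
  refine le_antisymm (Nat.sInf_le (exists_deterministic_clog g)) ?_
  refine le_csInf ⟨_, exists_deterministic_clog g⟩ ?_
  rintro c ⟨M, o, h⟩
  obtain ⟨ρ, E, hQ⟩ := exists_qExact_of_deterministic h
  exact hQ.clog_rowCount_le

lemma exists_qExact_clog (g : A → B → Bool) : ∃ ρ E, QExact g (Nat.clog 2 (rowCount g)) ρ E := by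
  obtain ⟨M, o, h⟩ := exists_deterministic_clog g
  exact exists_qExact_of_deterministic h

lemma sInf_qExact_eq_clog (g : A → B → Bool) :
    sInf {m : ℕ | ∃ ρ E, QExact g m ρ E} = Nat.clog 2 (rowCount g) := by
  refine le_antisymm (Nat.sInf_le (exists_qExact_clog g)) ?_
  refine le_csInf ⟨_, exists_qExact_clog g⟩ ?_
  rintro m ⟨ρ, E, hQ⟩
  exact hQ.clog_rowCount_le

end Deterministic

/-- (a) Every exact quantum one-way protocol for a total function `g` has cost at
least `log₂ row(g)`; a protocol of cost `⌈log₂ row(g)⌉` exists, so the exact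
quantum one-way complexity equals `⌈log₂ row(g)⌉ = D(g)`. (b) Every quantum Las
Vegas one-way protocol with give-up probability `ε` has cost at least
`(1 − ε)·log₂ row(g)`. -/
theorem stmt14 {A B : Type} [Fintype A] [Fintype B] (g : A → B → Bool) :
    (∀ (m : ℕ) (ρ : A → Matrix (Fin (2 ^ m)) (Fin (2 ^ m)) ℂ)
        (E : B → Matrix (Fin (2 ^ m)) (Fin (2 ^ m)) ℂ),
      QExact g m ρ E → Real.logb 2 (rowCount g) ≤ m) ∧
    (∃ (ρ : A → Matrix (Fin (2 ^ Nat.clog 2 (rowCount g))) (Fin (2 ^ Nat.clog 2 (rowCount g))) ℂ)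
        (E : B → Matrix (Fin (2 ^ Nat.clog 2 (rowCount g))) (Fin (2 ^ Nat.clog 2 (rowCount g))) ℂ),
      QExact g (Nat.clog 2 (rowCount g)) ρ E) ∧
    (sInf {m : ℕ | ∃ ρ E, QExact g m ρ E} = Nat.clog 2 (rowCount g)) ∧
    (Nat.clog 2 (rowCount g) = Dcc g) ∧
    (∀ ε : ℝ, 0 ≤ ε → ε < 1 →
      ∀ (m : ℕ) (ρ : A → Matrix (Fin (2 ^ m)) (Fin (2 ^ m)) ℂ)
        (E0 E1 Eg : B → Matrix (Fin (2 ^ m)) (Fin (2 ^ m)) ℂ),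
        QLasVegas g m ε ρ E0 E1 Eg →
        (1 - ε) * Real.logb 2 (rowCount g) ≤ m) := by
  exact ⟨fun _ _ _ h => h.logb_rowCount_le, exists_qExact_clog g, sInf_qExact_eq_clog g,
    (dcc_eq_clog g).symm, fun _ _ _ _ _ _ _ _ h => h.logb_rowCount_le⟩
end

section
/- There exist a constant c > 0 and integers n₀, s₀ such that for all n ≥ n₀ and all integers s with s₀ ≤ s and 20s ≤ n: every nondeterministic Boolean formula with s nondeterministic bits computing the language AD_{n,20s} has size at least c·n²·s·log₂ n. -/
/-- The number encoded in binary by the bits `b`. -/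
def binVal (m : ℕ) (b : Fin m → Bool) : ℕ :=
  ∑ i : Fin m, if b i then 2 ^ (i : ℕ) else 0

/-- Input variables of `AD_{n,s}`: `n+1` blocks of `s` numbers, each given by
`B = ⌈log₂(n³+1)⌉` bits. -/
abbrev ADVar (n s : ℕ) : Type := Fin (n + 1) × Fin s × Fin (Nat.clog 2 (n ^ 3 + 1))

/-- The number encoded in the `t`-th slot of the `i`-th block. -/
def adVal (n s : ℕ) (x : ADVar n s → Bool) (i : Fin (n + 1)) (t : Fin s) : ℕ :=
  binVal (Nat.clog 2 (n ^ 3 + 1)) (fun b => x (i, t, b))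

/-- Membership in the language `AD_{n,s}`: every block encodes `s` strictly
increasing numbers from `{1,…,n³}` (hence an `s`-element subset `x_i` of
`{1,…,n³}`), and some set `x_i` intersects at least `s` of the other sets. -/
def ADProp (n s : ℕ) (x : ADVar n s → Bool) : Prop :=
  (∀ i t, 1 ≤ adVal n s x i t ∧ adVal n s x i t ≤ n ^ 3) ∧
  (∀ i, ∀ t t' : Fin s, t < t' → adVal n s x i t < adVal n s x i t') ∧
  ∃ i : Fin (n + 1), s ≤ (Finset.univ.filter (fun j : Fin (n + 1) =>
    j ≠ i ∧ ∃ t t' : Fin s, adVal n s x i t = adVal n s x j t')).card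

namespace BFormula

/-- Number of leaves labeled by a variable satisfying `p`. -/
def leafCount_s16 {V : Type} (p : V → Prop) [DecidablePred p] : BFormula V → ℕ
  | var v => if p v then 1 else 0
  | const _ => 0
  | node _ l r => leafCount_s16 p l + leafCount_s16 p r

theorem sum_leafCount_le_size {V ι : Type} [DecidableEq ι] (S : Finset ι)
    (c : V → Option ι) (F : BFormula V) :
    ∑ i ∈ S, F.leafCount_s16 (fun v => c v = some i) ≤ F.size := by
  induction F with
  | var v =>
    simp only [leafCount_s16, size, Finset.sum_boole, Nat.cast_id]
    refine Finset.card_le_one.2 fun a ha b hb => ?_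
    simp only [Finset.mem_filter] at ha hb
    exact Option.some_injective _ (ha.2.symm.trans hb.2)
  | const b => simp [leafCount_s16, size]
  | node g l r hl hr =>
    simp only [leafCount_s16, size, Finset.sum_add_distrib]
    exact add_le_add hl hr

theorem eval_eq_of_leafCount_eq_zero {V : Type} (p : V → Prop) [DecidablePred p]
    {x y : V → Bool} (h : ∀ v, ¬ p v → x v = y v) (F : BFormula V)
    (hF : F.leafCount_s16 p = 0) : F.eval x = F.eval y := by
  induction F with
  | var v =>
    have hv : ¬ p v := fun hv => by simp [leafCount_s16, hv] at hF
    exact h v hv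
  | const b => rfl
  | node g l r hl hr =>
    simp only [leafCount_s16, Nat.add_eq_zero_iff] at hF
    simp only [eval, hl hF.1, hr hF.2]

/-- Nechiporuk's bound on the number of subfunctions of a formula: `E z` fixes the variables
outside `p` according to `z`, while the variables in `p` are read off the free argument. -/
theorem exists_subfunctions_card_le {V Z Ω : Type} (p : V → Prop) [DecidablePred p]
    (E : Z → Ω → V → Bool) (hout : ∀ v, ¬ p v → ∀ z y y', E z y v = E z y' v)
    (hin : ∀ v, p v → ∀ z z' y, E z y v = E z' y v) (F : BFormula V) :
    ∃ C : Finset (Ω → Bool), (∀ z (h : Bool → Bool), (fun y => h (F.eval (E z y))) ∈ C) ∧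
      (F.leafCount_s16 p = 0 → C.card ≤ 2) ∧
      (0 < F.leafCount_s16 p → 16 * C.card ≤ 16 ^ (2 * F.leafCount_s16 p)) := by
  classical
  have hconst : ∀ F : BFormula V, F.leafCount_s16 p = 0 → ∃ C : Finset (Ω → Bool),
      (∀ z (h : Bool → Bool), (fun y => h (F.eval (E z y))) ∈ C) ∧ C.card ≤ 2 := by
    intro F hF
    refine ⟨Finset.univ.image fun (b : Bool) (_ : Ω) => b, fun z h => ?_,
      Finset.card_image_le⟩
    simp only [Finset.mem_image, Finset.mem_univ, true_and]
    rcases isEmpty_or_nonempty Ω with hΩ | ⟨⟨y₀⟩⟩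
    · exact ⟨true, Subsingleton.elim _ _⟩
    · refine ⟨h (F.eval (E z y₀)), funext fun y => ?_⟩
      rw [eval_eq_of_leafCount_eq_zero p (fun v hv => hout v hv z y₀ y) F hF]
  induction F with
  | var v =>
    by_cases hv : p v
    · rcases isEmpty_or_nonempty Z with hZ | ⟨⟨z₀⟩⟩
      · exact ⟨∅, fun z => isEmptyElim z, by simp, by simp⟩
      refine ⟨Finset.univ.image fun (h : Bool → Bool) y => h (E z₀ y v), fun z h => ?_, ?_, ?_⟩
      · simp only [Finset.mem_image, Finset.mem_univ, true_and]
        exact ⟨h, funext fun y => by rw [eval, hin v hv z₀ z y]⟩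
      · simp [leafCount_s16, hv]
      · intro _
        have := Finset.card_image_le (s := (Finset.univ : Finset (Bool → Bool)))
          (f := fun h (y : Ω) => h (E z₀ y v))
        simp only [Finset.card_univ, Fintype.card_fun, Fintype.card_bool] at this
        simp only [leafCount_s16, hv, if_true]
        omega
    · have h0 : (var v).leafCount_s16 p = 0 := by simp [leafCount_s16, hv]
      obtain ⟨C, hC, hcard⟩ := hconst _ h0
      exact ⟨C, hC, fun _ => hcard, fun h => by omega⟩
  | const b =>
    obtain ⟨C, hC, hcard⟩ := hconst (const b) rfl
    exact ⟨C, hC, fun _ => hcard, fun h => by simp [leafCount_s16] at h⟩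
  | node g l r hl hr =>
    obtain ⟨Cl, hCl, hl0, hl1⟩ := hl
    obtain ⟨Cr, hCr, hr0, hr1⟩ := hr
    rcases Nat.eq_zero_or_pos (l.leafCount_s16 p) with h0 | hlpos
    · rcases isEmpty_or_nonempty Ω with hΩ | ⟨⟨y₀⟩⟩
      · refine ⟨Cr, fun z h => ?_, ?_, ?_⟩
        · convert hCr z h
        · simpa [leafCount_s16, h0] using hr0
        · simpa [leafCount_s16, h0] using hr1
      refine ⟨Cr, fun z h => ?_, ?_, ?_⟩
      · convert hCr z (fun b => h (g (l.eval (E z y₀)) b)) using 3 with y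
        rw [eval, eval_eq_of_leafCount_eq_zero p (fun v hv => hout v hv z y₀ y) l h0]
      · simpa [leafCount_s16, h0] using hr0
      · simpa [leafCount_s16, h0] using hr1
    rcases Nat.eq_zero_or_pos (r.leafCount_s16 p) with h0 | hrpos
    · rcases isEmpty_or_nonempty Ω with hΩ | ⟨⟨y₀⟩⟩
      · refine ⟨Cl, fun z h => ?_, ?_, ?_⟩
        · convert hCl z h
        · simpa [leafCount_s16, h0] using hl0
        · simpa [leafCount_s16, h0] using hl1
      refine ⟨Cl, fun z h => ?_, ?_, ?_⟩
      · convert hCl z (fun b => h (g b (r.eval (E z y₀)))) using 3 with y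
        rw [eval, eval_eq_of_leafCount_eq_zero p (fun v hv => hout v hv z y₀ y) r h0]
      · simpa [leafCount_s16, h0] using hl0
      · simpa [leafCount_s16, h0] using hl1
    refine ⟨((Finset.univ : Finset (Bool → Bool → Bool)) ×ˢ (Cl ×ˢ Cr)).image
      fun q y => q.1 (q.2.1 y) (q.2.2 y), fun z h => ?_, ?_, fun _ => ?_⟩
    · refine Finset.mem_image.2 ⟨(fun b b' => h (g b b'), fun y => l.eval (E z y),
        fun y => r.eval (E z y)), ?_, rfl⟩
      exact Finset.mem_product.2 ⟨Finset.mem_univ _,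
        Finset.mem_product.2 ⟨hCl z id, hCr z id⟩⟩
    · simp only [leafCount_s16]
      omega
    · have h1 := hl1 hlpos
      have h2 := hr1 hrpos
      calc _ ≤ 16 * (16 * (Cl.card * Cr.card)) := by
            gcongr
            refine Finset.card_image_le.trans ?_
            simp [Finset.card_product]
        _ = (16 * Cl.card) * (16 * Cr.card) := by ring
        _ ≤ 16 ^ (2 * l.leafCount_s16 p) * 16 ^ (2 * r.leafCount_s16 p) := Nat.mul_le_mul h1 h2
        _ = _ := by rw [← pow_add, leafCount_s16, mul_add]

end BFormula

theorem binVal_testBit (m v : ℕ) (hv : v < 2 ^ m) :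
    binVal m (fun b => v.testBit b) = v := by
  induction m generalizing v with
  | zero =>
    obtain rfl : v = 0 := by simpa using hv
    simp [binVal]
  | succ m ih =>
    have h := ih (v / 2) (by rw [pow_succ] at hv; omega)
    unfold binVal at h ⊢
    rw [Fin.sum_univ_succ]
    have h2 : ∀ i : Fin m, (if v.testBit (i.succ : ℕ) then 2 ^ (i.succ : ℕ) else 0)
        = 2 * (if (v / 2).testBit (i : ℕ) then 2 ^ (i : ℕ) else 0) := by
      intro i
      simp only [Fin.val_succ, Nat.testBit_succ, pow_succ]
      split_ifs <;> ring
    simp only [h2, ← Finset.mul_sum, h]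
    simp only [Fin.val_zero, Nat.testBit_zero, pow_zero, decide_eq_true_eq]
    split_ifs <;> omega

/-- The input whose slots hold the (binary encodings of the) numbers `X`. -/
def adInput (n k : ℕ) (X : Fin (n + 1) → Fin k → ℕ) : ADVar n k → Bool :=
  fun v => (X v.1 v.2.1).testBit v.2.2

theorem adVal_adInput {n k : ℕ} {X : Fin (n + 1) → Fin k → ℕ} {i : Fin (n + 1)} {t : Fin k}
    (h : X i t ≤ n ^ 3) : adVal n k (adInput n k X) i t = X i t :=
  binVal_testBit _ _ (lt_of_lt_of_le (Nat.lt_succ_of_le h) (Nat.le_pow_clog one_lt_two _))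

theorem mul_add_lt_mul_add {m i i' q q' : ℕ} (hi : i < i') (hq : q < m) :
    i * m + q < i' * m + q' := by
  have : (i + 1) * m ≤ i' * m := Nat.mul_le_mul_right _ hi
  rw [add_mul] at this
  omega

theorem mul_add_inj {m i i' q q' : ℕ} (hq : q < m) (hq' : q' < m)
    (h : i * m + q = i' * m + q') : i = i' ∧ q = q' := by
  have hi : i = i' := by
    rcases lt_trichotomy i i' with hi | hi | hi
    · exact absurd h (mul_add_lt_mul_add hi hq).ne
    · exact hi
    · exact absurd h (mul_add_lt_mul_add hi hq').ne'
  subst hi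
  exact ⟨rfl, by omega⟩

/-- The interval of `n` consecutive numbers reserved for slot `t` of block `j` contains
the number `slotVal a j t` selected by `a`. -/
def slotVal {n k : ℕ} (a : Fin n × Fin k → Fin n) (j : Fin n) (t : Fin k) : ℕ :=
  (j * k + t) * n + a (j, t) + 1

section slotVal

variable {n k : ℕ}

theorem slotVal_pos (a : Fin n × Fin k → Fin n) (j : Fin n) (t : Fin k) : 1 ≤ slotVal a j t :=
  Nat.le_add_left _ _

theorem slotVal_le (hk : k ≤ n) (a : Fin n × Fin k → Fin n) (j : Fin n) (t : Fin k) :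
    slotVal a j t ≤ n ^ 3 := by
  have h1 : (j : ℕ) * k + t < n * k + 0 := mul_add_lt_mul_add j.2 t.2
  have h2 : ((j : ℕ) * k + t) * n + a (j, t) < (n * k + 0) * n + 0 :=
    mul_add_lt_mul_add h1 (a (j, t)).2
  have h3 : (n * k + 0) * n + 0 ≤ n ^ 3 := by
    calc (n * k + 0) * n + 0 = n * k * n := by ring
      _ ≤ n * n * n := by gcongr
      _ = n ^ 3 := by ring
  unfold slotVal
  omega

theorem slotVal_lt_of_block_lt (a : Fin n × Fin k → Fin n) {j j' : Fin n} (h : j < j')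
    (t t' : Fin k) : slotVal a j t < slotVal a j' t' :=
  Nat.succ_lt_succ (mul_add_lt_mul_add (mul_add_lt_mul_add h t.2) (a (j, t)).2)

theorem slotVal_lt_of_slot_lt (a : Fin n × Fin k → Fin n) (j : Fin n) {t t' : Fin k}
    (h : t < t') : slotVal a j t < slotVal a j t' :=
  Nat.succ_lt_succ (mul_add_lt_mul_add (Nat.add_lt_add_left h _) (a (j, t)).2)

theorem slotVal_inj {a a' : Fin n × Fin k → Fin n} {j j' : Fin n} {t t' : Fin k}
    (h : slotVal a j t = slotVal a' j' t') : j = j' ∧ t = t' ∧ a (j, t) = a' (j', t') := by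
  obtain ⟨h1, h2⟩ := mul_add_inj (a (j, t)).2 (a' (j', t')).2 (Nat.succ_injective h)
  obtain ⟨h3, h4⟩ := mul_add_inj t.2 t'.2 h1
  exact ⟨Fin.ext h3, Fin.ext h4, Fin.ext h2⟩

end slotVal

/-- The `q`-th block of the `i`-th of `k` groups of `n / k` consecutive blocks. -/
def groupBlock {n k : ℕ} (i : Fin k) (q : Fin (n / k)) : Fin n :=
  ⟨i * (n / k) + q, by
    have h1 : (i : ℕ) * (n / k) + q < k * (n / k) + 0 := mul_add_lt_mul_add i.2 q.2
    have h2 := Nat.mul_div_le n k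
    omega⟩

theorem groupBlock_lt {n k : ℕ} {i i' : Fin k} (h : i < i') (q q' : Fin (n / k)) :
    groupBlock i q < groupBlock i' q' :=
  Fin.lt_def.2 (mul_add_lt_mul_add h q.2)

theorem groupBlock_inj {n k : ℕ} {i i' : Fin k} {q q' : Fin (n / k)}
    (h : groupBlock i q = groupBlock i' q') : i = i' ∧ q = q' := by
  obtain ⟨h1, h2⟩ := mul_add_inj q.2 q'.2 (Fin.ext_iff.1 h)
  exact ⟨Fin.ext h1, Fin.ext h2⟩

/-- The transversal picking the slot `p i` from each group `i`. -/
def transversal {n k : ℕ} (a : Fin n × Fin k → Fin n) (p : Fin k → Fin (n / k) × Fin k) :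
    Fin k → ℕ :=
  fun i => slotVal a (groupBlock i (p i).1) (p i).2

/-- The input with block `i₀` equal to `y` and all other slots given by `slotVal a`. -/
def blockInput {n k : ℕ} (i₀ : Fin (n + 1)) (a : Fin n × Fin k → Fin n) (y : Fin k → ℕ) :
    ADVar n k → Bool :=
  adInput n k (Fin.insertNth (α := fun _ => Fin k → ℕ) i₀ y (slotVal a))

section blockInput

variable {n k : ℕ} {i₀ : Fin (n + 1)} {a : Fin n × Fin k → Fin n}

theorem adVal_blockInput_same {y : Fin k → ℕ} (t : Fin k) (hy : y t ≤ n ^ 3) :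
    adVal n k (blockInput i₀ a y) i₀ t = y t := by
  rw [blockInput, adVal_adInput] <;> simp [hy]

theorem adVal_blockInput_succAbove (hk : k ≤ n) {y : Fin k → ℕ} (j : Fin n) (t : Fin k) :
    adVal n k (blockInput i₀ a y) (i₀.succAbove j) t = slotVal a j t := by
  rw [blockInput, adVal_adInput] <;> simp [slotVal_le hk]

theorem adProp_transversal (hk : k ≤ n) (p : Fin k → Fin (n / k) × Fin k) :
    ADProp n k (blockInput i₀ a (transversal a p)) := by
  have hsame : ∀ t, adVal n k (blockInput i₀ a (transversal a p)) i₀ t = transversal a p t :=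
    fun t => adVal_blockInput_same t (slotVal_le hk _ _ _)
  have hother := fun j t =>
    adVal_blockInput_succAbove (i₀ := i₀) (a := a) hk (y := transversal a p) j t
  refine ⟨fun i t => ?_, fun i t t' htt => ?_, i₀, ?_⟩
  · rcases Fin.eq_self_or_eq_succAbove i₀ i with rfl | ⟨j, rfl⟩
    · rw [hsame]
      exact ⟨slotVal_pos _ _ _, slotVal_le hk _ _ _⟩
    · rw [hother]
      exact ⟨slotVal_pos _ _ _, slotVal_le hk _ _ _⟩
  · rcases Fin.eq_self_or_eq_succAbove i₀ i with rfl | ⟨j, rfl⟩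
    · rw [hsame, hsame]
      exact slotVal_lt_of_block_lt _ (groupBlock_lt htt _ _) _ _
    · rw [hother, hother]
      exact slotVal_lt_of_slot_lt _ _ htt
  · have hinj : Function.Injective fun t : Fin k => i₀.succAbove (groupBlock t (p t).1) :=
      fun t t' h => (groupBlock_inj (Fin.succAbove_right_injective h)).1
    calc k = (Finset.univ.image fun t : Fin k => i₀.succAbove (groupBlock t (p t).1)).card := by
          rw [Finset.card_image_of_injective _ hinj, Finset.card_univ, Fintype.card_fin]
      _ ≤ _ := Finset.card_le_card fun i hi => by
          obtain ⟨t, -, rfl⟩ := Finset.mem_image.1 hi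
          refine Finset.mem_filter.2 ⟨Finset.mem_univ _, Fin.succAbove_ne _ _, t, (p t).2, ?_⟩
          rw [hsame, hother, transversal]

theorem exists_slotVal_eq_of_adProp (hk : k ≤ n) (hk2 : 2 ≤ k) {y : Fin k → ℕ}
    (hy : ∀ t, y t ≤ n ^ 3) (h : ADProp n k (blockInput i₀ a y)) (t : Fin k) :
    ∃ j t', y t = slotVal a j t' := by
  obtain ⟨-, -, i, hi⟩ := h
  rcases Fin.eq_self_or_eq_succAbove i₀ i with rfl | ⟨j, rfl⟩
  · set J := Finset.univ.filter fun j : Fin n => ∃ t t' : Fin k, y t = slotVal a j t' with hJ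
    have hcard : k ≤ J.card := by
      refine hi.trans (le_trans (Finset.card_le_card fun x hx => ?_)
        (Finset.card_image_le (s := J) (f := i.succAbove)))
      obtain ⟨-, hxi, t, t', htt⟩ := Finset.mem_filter.1 hx
      rcases Fin.eq_self_or_eq_succAbove i x with rfl | ⟨j, rfl⟩
      · exact absurd rfl hxi
      · rw [adVal_blockInput_same t (hy t), adVal_blockInput_succAbove hk] at htt
        exact Finset.mem_image.2 ⟨j, Finset.mem_filter.2 ⟨Finset.mem_univ _, t, t', htt⟩, rfl⟩
    have hτ : ∀ j : J, ∃ t t' : Fin k, y t = slotVal a j t' :=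
      fun j => (Finset.mem_filter.1 j.2).2
    choose τ τ' hττ using hτ
    have hinj : Function.Injective τ := fun j j' hjj => by
      have := hττ j
      rw [hjj, hττ j'] at this
      exact Subtype.ext (slotVal_inj this).1.symm
    have hsurj : Function.Surjective τ := by
      refine ((Fintype.bijective_iff_injective_and_card τ).2 ⟨hinj, ?_⟩).2
      refine le_antisymm (Fintype.card_le_of_injective τ hinj) ?_
      simpa using hcard
    obtain ⟨j, rfl⟩ := hsurj t
    exact ⟨j, τ' j, hττ j⟩
  · exfalso
    have hsub := Finset.card_le_card (t := {i₀}) (s := Finset.univ.filter fun x =>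
      x ≠ i₀.succAbove j ∧ ∃ t t' : Fin k, adVal n k (blockInput i₀ a y) (i₀.succAbove j) t
        = adVal n k (blockInput i₀ a y) x t') fun x hx => by
      obtain ⟨-, hxi, t, t', htt⟩ := Finset.mem_filter.1 hx
      rcases Fin.eq_self_or_eq_succAbove i₀ x with rfl | ⟨j', rfl⟩
      · exact Finset.mem_singleton_self _
      · rw [adVal_blockInput_succAbove hk, adVal_blockInput_succAbove hk] at htt
        exact absurd (by rw [(slotVal_inj htt).1]) hxi
    rw [Finset.card_singleton] at hsub
    omega

end blockInput

/-- A dense subset of a product has large projections to most of the factors. -/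
theorem mul_card_le_sum_card_proj {k s : ℕ} {Γ : Type} [Fintype Γ] [DecidableEq Γ]
    (P : Finset (Fin k → Γ)) (hpos : 0 < Fintype.card Γ)
    (hP : Fintype.card Γ ^ k ≤ 2 ^ s * P.card) :
    (k - s) * Fintype.card Γ ≤ 2 * ∑ i, (P.image fun p => p i).card := by
  set M := Fintype.card Γ
  set D : Fin k → Finset Γ := fun i => P.image fun p => p i with hD
  have hPD : P.card ≤ ∏ i, (D i).card := by
    rw [← Fintype.card_piFinset]
    exact Finset.card_le_card fun p hp => Fintype.mem_piFinset.2 fun i =>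
      Finset.mem_image_of_mem _ hp
  set bad := Finset.univ.filter fun i => 2 * (D i).card < M with hbad
  have hle : ∀ i, (D i).card ≤ M := fun i => Finset.card_le_univ _
  have h1 : 2 ^ bad.card * ∏ i, (D i).card ≤ M ^ k := by
    calc 2 ^ bad.card * ∏ i, (D i).card
        = ∏ i, ((if 2 * (D i).card < M then 2 else 1) * (D i).card) := by
          rw [Finset.prod_mul_distrib, ← Finset.prod_filter, Finset.prod_const]
      _ ≤ ∏ _i : Fin k, M := by
          refine Finset.prod_le_prod' fun i _ => ?_
          split_ifs with h
          · exact h.le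
          · simpa using hle i
      _ = M ^ k := by simp
  have hprod : 0 < ∏ i, (D i).card := by
    refine lt_of_lt_of_le ?_ hPD
    have : 0 < M ^ k := Nat.pow_pos hpos
    exact Nat.pos_of_mul_pos_left (lt_of_lt_of_le this hP)
  have h2 : 2 ^ bad.card ≤ 2 ^ s :=
    Nat.le_of_mul_le_mul_right (h1.trans (hP.trans (Nat.mul_le_mul_left _ hPD))) hprod
  have h3 : bad.card ≤ s := (Nat.pow_le_pow_iff_right one_lt_two).1 h2
  have h4 : badᶜ.card = k - bad.card := by rw [Finset.card_compl, Fintype.card_fin]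
  calc (k - s) * M ≤ badᶜ.card * M := Nat.mul_le_mul_right _ (by omega)
    _ = ∑ _i ∈ badᶜ, M := by simp
    _ ≤ ∑ i ∈ badᶜ, 2 * (D i).card := Finset.sum_le_sum fun i hi => by
        simpa [hbad] using hi
    _ ≤ ∑ i, 2 * (D i).card := Finset.sum_le_sum_of_subset (Finset.subset_univ _)
    _ = _ := by rw [Finset.mul_sum]

theorem card_filter_eqOn {α β : Type} [Fintype α] [DecidableEq α] [Fintype β] [DecidableEq β]
    (D : Finset α) (a : α → β) :
    (Finset.univ.filter fun a' : α → β => ∀ x ∈ D, a' x = a x).card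
      = Fintype.card β ^ (Fintype.card α - D.card) := by
  have h : (Finset.univ.filter fun a' : α → β => ∀ x ∈ D, a' x = a x)
      = Fintype.piFinset fun x => if x ∈ D then {a x} else Finset.univ := by
    ext a'
    simp only [Finset.mem_filter, Finset.mem_univ, true_and, Fintype.mem_piFinset]
    refine forall_congr' fun x => ?_
    split_ifs with hx <;> simp [hx]
  rw [h, Fintype.card_piFinset, ← Finset.card_compl, ← Finset.prod_const,
    ← Finset.prod_subset (Finset.subset_univ Dᶜ)]
  · exact Finset.prod_congr rfl fun x hx => by simp [Finset.mem_compl.1 hx]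
  · intro x _ hx
    simp [not_not.1 (mt Finset.mem_compl.2 hx)]

theorem exists_dense_fiber {α : Type} [Fintype α] {s : ℕ} (R : α → (Fin s → Bool) → Prop)
    (h : ∀ p, ∃ w, R p w) :
    ∃ w, ∃ P : Finset α, (∀ p ∈ P, R p w) ∧ Fintype.card α ≤ 2 ^ s * P.card := by
  classical
  choose w hw using h
  by_contra! hcon
  have hlt : ∀ v : Fin s → Bool, 2 ^ s * (Finset.univ.filter fun p => w p = v).card
      < Fintype.card α := fun v => hcon v _ fun p hp => by
    rw [← (Finset.mem_filter.1 hp).2]; exact hw p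
  have hsum : Fintype.card α = ∑ v : Fin s → Bool, (Finset.univ.filter fun p => w p = v).card :=
    Finset.card_eq_sum_card_fiberwise fun p _ => Finset.mem_univ (w p)
  have h1 : ∑ v : Fin s → Bool, 2 ^ s * (Finset.univ.filter fun p => w p = v).card
      < ∑ _v : Fin s → Bool, Fintype.card α :=
    Finset.sum_lt_sum_of_nonempty Finset.univ_nonempty fun v _ => hlt v
  rw [← Finset.mul_sum, ← hsum] at h1
  simp at h1

/-- The block containing an input variable, if any. -/
def varBlock {n k s : ℕ} : ADVar n k ⊕ Fin s → Option (Fin (n + 1)) :=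
  Sum.elim (fun v => some v.1) fun _ => none

/-- A formula with `s` nondeterministic bits for `AD_{n,20s}` reads each block often. -/
theorem pow_le_two_mul_pow_leafCount {n k s : ℕ} (hs : 1 ≤ s) (hk : k = 20 * s) (hn : k ≤ n)
    (G : BFormula (ADVar n k ⊕ Fin s))
    (hG : ∀ x : ADVar n k → Bool,
      ADProp n k x ↔ ∃ w : Fin s → Bool, G.eval (Sum.elim x w) = true)
    (i₀ : Fin (n + 1)) :
    n ^ (4 * s * n) ≤ 2 * 16 ^ (2 * G.leafCount_s16 fun v => varBlock v = some i₀) := by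
  classical
  let E : (Fin n × Fin k → Fin n) × (Fin s → Bool) → (Fin k → ℕ) → ADVar n k ⊕ Fin s → Bool :=
    fun z y => Sum.elim (blockInput i₀ z.1 y) z.2
  obtain ⟨C, hC, hC0, hC1⟩ := BFormula.exists_subfunctions_card_le
    (fun v => varBlock v = some i₀) E
    (by
      rintro (⟨i, t, b⟩ | r) hv z y y'
      · rcases Fin.eq_self_or_eq_succAbove i₀ i with rfl | ⟨j, rfl⟩
        · exact absurd rfl hv
        · simp [E, blockInput, adInput]
      · rfl)
    (by
      rintro (⟨i, t, b⟩ | r) hv z z' y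
      · obtain rfl : i = i₀ := Option.some_injective _ hv
        simp [E, blockInput, adInput]
      · exact absurd hv (by simp [varBlock])) G
  have hdense := fun a : Fin n × Fin k → Fin n => exists_dense_fiber
    (fun (p : Fin k → Fin (n / k) × Fin k) w => G.eval (E (a, w) (transversal a p)) = true)
    fun p => (hG _).1 (adProp_transversal hn p)
  choose w P hPw hPcard using hdense
  let φ : (Fin n × Fin k → Fin n) → (Fin k → ℕ) → Bool := fun a y => G.eval (E (a, w a) y)
  have hfiber : ∀ c ∈ C, (Finset.univ.filter fun a => φ a = c).card
      ≤ n ^ (n * k - 4 * s * n) := by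
    intro c _
    rcases (Finset.univ.filter fun a => φ a = c).eq_empty_or_nonempty with h | ⟨a, ha⟩
    · simp [h]
    have hac : φ a = c := (Finset.mem_filter.1 ha).2
    let e : (Σ _ : Fin k, Fin (n / k) × Fin k) → Fin n × Fin k :=
      fun q => (groupBlock q.1 q.2.1, q.2.2)
    have he : Function.Injective e := by
      rintro ⟨i, q, t⟩ ⟨i', q', t'⟩ h
      obtain ⟨h1, h2⟩ := Prod.mk.inj h
      obtain ⟨h3, h4⟩ := groupBlock_inj h1
      dsimp only at h2 h3 h4
      subst h2 h3 h4
      rfl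
    let D : Finset (Fin n × Fin k) :=
      (Finset.univ.sigma fun i => (P a).image fun p => p i).image e
    have hDcard : 4 * s * n ≤ D.card := by
      have hdiv : 1 ≤ n / k := (Nat.one_le_div_iff (by omega)).2 hn
      have hΓ : Fintype.card (Fin (n / k) × Fin k) = n / k * k := by simp
      have hM : n ≤ 2 * (n / k * k) := by
        have h1 := Nat.div_add_mod' n k
        have h2 := Nat.mod_lt n (show 0 < k by omega)
        have h3 : 1 * k ≤ n / k * k := Nat.mul_le_mul_right _ hdiv
        omega
      have hsum := mul_card_le_sum_card_proj (P a) (s := s)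
        (by rw [hΓ]; exact Nat.mul_pos hdiv (by omega))
        (by simpa using hPcard a)
      rw [Finset.card_image_of_injective _ he, Finset.card_sigma]
      rw [hΓ, show k - s = 19 * s by omega] at hsum
      have h5 : s * n ≤ s * (2 * (n / k * k)) := Nat.mul_le_mul_left _ hM
      nlinarith
    have hsub : (Finset.univ.filter fun a' => φ a' = c)
        ⊆ Finset.univ.filter fun a' => ∀ x ∈ D, a' x = a x := by
      intro a' ha'
      have ha'c : φ a' = c := (Finset.mem_filter.1 ha').2
      refine Finset.mem_filter.2 ⟨Finset.mem_univ _, fun x hx => ?_⟩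
      obtain ⟨⟨i, q⟩, hq, rfl⟩ := Finset.mem_image.1 hx
      obtain ⟨p, hp, hpq⟩ := Finset.mem_image.1 (Finset.mem_sigma.1 hq).2
      obtain rfl : p i = q := hpq
      have hacc : φ a' (transversal a p) = true := by
        rw [ha'c, ← hac]
        exact hPw a p hp
      obtain ⟨j, t', hjt⟩ := exists_slotVal_eq_of_adProp hn (by omega)
        (fun t => slotVal_le hn _ _ _) ((hG _).2 ⟨w a', hacc⟩) i
      obtain ⟨rfl, rfl, h⟩ := slotVal_inj hjt
      exact h.symm
    calc _ ≤ _ := Finset.card_le_card hsub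
      _ = n ^ (n * k - D.card) := by rw [card_filter_eqOn]; simp
      _ ≤ _ := Nat.pow_le_pow_right (by omega) (by omega)
  have hcount := Finset.card_le_mul_card_image_of_maps_to
    (s := (Finset.univ : Finset (Fin n × Fin k → Fin n))) (f := φ)
    (fun a _ => hC (a, w a) id) _ hfiber
  simp only [Finset.card_univ, Fintype.card_fun, Fintype.card_prod, Fintype.card_fin] at hcount
  have hle : 4 * s * n ≤ n * k := by
    rw [hk]
    nlinarith [Nat.zero_le (s * n)]
  have h1 : n ^ (4 * s * n) ≤ C.card := by
    refine Nat.le_of_mul_le_mul_left ?_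
      (show 0 < n ^ (n * k - 4 * s * n) from Nat.pow_pos (by omega))
    rwa [← pow_add, Nat.sub_add_cancel hle]
  refine h1.trans ?_
  rcases Nat.eq_zero_or_pos (G.leafCount_s16 fun v => varBlock v = some i₀) with h0 | hpos
  · simpa [h0] using hC0 h0
  · have := hC1 hpos
    omega

/-- Every nondeterministic Boolean formula with `s` nondeterministic bits
computing `AD_{n,20s}` has size at least `c·n²·s·log₂ n`. -/
theorem stmt16 :
    ∃ c : ℝ, 0 < c ∧ ∃ n₀ s₀ : ℕ,
      ∀ n s : ℕ, n₀ ≤ n → s₀ ≤ s → 20 * s ≤ n →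
        ∀ G : BFormula (ADVar n (20 * s) ⊕ Fin s),
          (∀ x : ADVar n (20 * s) → Bool,
            ADProp n (20 * s) x ↔ ∃ w : Fin s → Bool, G.eval (Sum.elim x w) = true) →
          c * ((n : ℝ) ^ 2 * s * Real.logb 2 n) ≤ G.size := by
  refine ⟨1 / 4, by norm_num, 2, 1, fun n s hn hs hsn G hG => ?_⟩
  set L := Real.logb 2 n with hL
  have hL1 : 1 ≤ L := by
    rw [hL, Real.le_logb_iff_rpow_le one_lt_two (by positivity)]
    simpa using (by exact_mod_cast hn : (2 : ℝ) ≤ n)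
  have hn' : (2 : ℝ) ≤ n := by exact_mod_cast hn
  have hs' : (1 : ℝ) ≤ s := by exact_mod_cast hs
  have hsnL : 1 ≤ (s : ℝ) * n * L :=
    one_le_mul_of_one_le_of_one_le (one_le_mul_of_one_le_of_one_le hs' (by linarith)) hL1
  have hblock : ∀ i₀ : Fin (n + 1), 3 * (s * n * L) ≤
      8 * (G.leafCount_s16 (fun v => varBlock v = some i₀) : ℝ) := by
    intro i₀
    have h := pow_le_two_mul_pow_leafCount hs rfl hsn G hG i₀
    set l := G.leafCount_s16 fun v => varBlock v = some i₀
    have h2 : (n : ℝ) ^ (4 * s * n) ≤ 2 ^ (8 * l + 1) := by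
      have : 2 * 16 ^ (2 * l) = 2 ^ (8 * l + 1) := by
        rw [show (16 : ℕ) = 2 ^ 4 by norm_num, ← pow_mul, pow_succ]
        ring_nf
      rw [this] at h
      exact_mod_cast h
    have h3 := Real.logb_le_logb_of_le one_lt_two (by positivity) h2
    rw [Real.logb_pow, Real.logb_pow, Real.logb_self_eq_one one_lt_two] at h3
    push_cast at h3
    nlinarith
  have hsum : (∑ i₀ : Fin (n + 1), (G.leafCount_s16 (fun v => varBlock v = some i₀) : ℝ)) ≤ G.size := by
    exact_mod_cast BFormula.sum_leafCount_le_size Finset.univ varBlock G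
  have htotal := Finset.sum_le_sum fun i₀ (_ : i₀ ∈ (Finset.univ : Finset (Fin (n + 1)))) =>
    hblock i₀
  rw [Finset.sum_const, ← Finset.mul_sum, Finset.card_univ, Fintype.card_fin, nsmul_eq_mul] at htotal
  push_cast at htotal
  nlinarith
end
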